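/- Let B = B₁(0) ⊂ ℝ^d and let A₀ be a constant d×d matrix satisfying λ|ξ|² ≤ A₀ξ·ξ and |A₀ξ·η| ≤ Λ|ξ||η| for all ξ, η ∈ ℝ^d. For vector field F ∈ L^p(B; ℝ^d) and g ∈ L^p(B) with some p > 1, let u ∈ W^{1,p}₀(B) be the weak solution of div(A₀ Du) = div F + g in B with u = 0 on ∂B. Then for every t > 0, |{x ∈ B : |Du(x)| > t}| ≤ (C/t) ∫_B (|F| + |g|), where C = C(d, λ, Λ). -/

import Mathlib

open MeasureTheory Metric Filter
open scoped RealInnerProductSpace ENNReal Topology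

noncomputable section

/-- Euclidean space `ℝ^d`. -/
abbrev Euc (d : ℕ) := EuclideanSpace ℝ (Fin d)

/-- The mean oscillation function `ω_f(r) = sup_{x ∈ Ω} ⨍_{Ω ∩ B_r(x)} |f - (f)_{Ω ∩ B_r(x)}|`. -/
noncomputable def meanOsc {d : ℕ} {F : Type*} [NormedAddCommGroup F] [NormedSpace ℝ F]
    (Ω : Set (Euc d)) (f : Euc d → F) (r : ℝ) : ℝ :=
  ⨆ x : Ω, ⨍ y in Ω ∩ ball (x : Euc d) r, ‖f y - ⨍ z in Ω ∩ ball (x : Euc d) r, f z‖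

/-- `f` has Dini mean oscillation on `Ω`: `∫₀¹ ω_f(r)/r dr < ∞`. -/
def HasDMO {d : ℕ} {F : Type*} [NormedAddCommGroup F] [NormedSpace ℝ F]
    (Ω : Set (Euc d)) (f : Euc d → F) : Prop :=
  IntegrableOn (fun r => meanOsc Ω f r / r) (Set.Ioc (0 : ℝ) 1)

/-- A modulus of continuity: nonnegative, nondecreasing on `(0,∞)`, tending to `0` at `0⁺`. -/
def IsModulus (ρ : ℝ → ℝ) : Prop :=
  (∀ t, 0 ≤ ρ t) ∧ MonotoneOn ρ (Set.Ioi 0) ∧ Tendsto ρ (𝓝[>] 0) (𝓝 0)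

/-- The sup norm `‖g‖_{L^∞(s)}` (for continuous `g`). -/
noncomputable def supNorm {d : ℕ} {F : Type*} [NormedAddCommGroup F]
    (g : Euc d → F) (s : Set (Euc d)) : ℝ :=
  ⨆ x : s, ‖g (x : Euc d)‖

/-- `sup_{x ∈ Ω} ∫_{Ω ∩ B_r(x)} g`. -/
noncomputable def supInt {d : ℕ} (Ω : Set (Euc d)) (g : Euc d → ℝ) (r : ℝ) : ℝ :=
  ⨆ x : Ω, ∫ y in Ω ∩ ball (x : Euc d) r, g y

/-- The Hessian `D²u(x)` of `u` at `x`, as a continuous bilinear form. -/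
noncomputable def hess {d : ℕ} (u : Euc d → ℝ) (x : Euc d) :
    Euc d →L[ℝ] Euc d →L[ℝ] ℝ :=
  fderiv ℝ (fun y => fderiv ℝ u y) x

/-- The Dini sum `ω̃(t) = Σ_{i≥1} κ^{iβ} (ω(κ^{-i}t) if κ^{-i}t ≤ 1, else ω(1))`. -/
noncomputable def diniSum (ω : ℝ → ℝ) (κ β : ℝ) (t : ℝ) : ℝ :=
  ∑' i : ℕ, (κ ^ β) ^ (i + 1) *
    (if t / κ ^ (i + 1) ≤ 1 then ω (t / κ ^ (i + 1)) else ω 1)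

/-- The norm `|𝒮| = sup_{|ξ|=1} |𝒮(ξ,ξ,ξ)|` of a (0,3)-tensor. -/
noncomputable def tnorm {d : ℕ} (S : Euc d →L[ℝ] Euc d →L[ℝ] Euc d →L[ℝ] ℝ) : ℝ :=
  ⨆ ξ : sphere (0 : Euc d) 1, |S ξ.1 ξ.1 ξ.1|

/-- A fully symmetric (0,3)-tensor. -/
def Sym3 {d : ℕ} (S : Euc d →L[ℝ] Euc d →L[ℝ] Euc d →L[ℝ] ℝ) : Prop :=
  ∀ x y z : Euc d, S x y z = S y x z ∧ S x y z = S x z y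

/-- `u` is a weak solution of `div(A Du) + b·Du + c u = f` in `Ω`. -/
def IsWeakSolDiv {d : ℕ} (Ω : Set (Euc d)) (A : Euc d → Euc d →L[ℝ] Euc d)
    (b : Euc d → Euc d) (c f u : Euc d → ℝ) : Prop :=
  ∀ φ : Euc d → ℝ, ContDiff ℝ (⊤ : ℕ∞) φ → HasCompactSupport φ → tsupport φ ⊆ Ω →
    ∫ x in Ω, (⟪b x, gradient u x⟫ + c x * u x - f x) * φ x
      = ∫ x in Ω, ⟪A x (gradient u x), gradient φ x⟫

/-- Hölder continuity with exponent `α` on `s`. -/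
def HolderOnE {d : ℕ} {F : Type*} [NormedAddCommGroup F]
    (g : Euc d → F) (α : ℝ) (s : Set (Euc d)) : Prop :=
  ∃ M : ℝ, ∀ x ∈ s, ∀ y ∈ s, ‖g x - g y‖ ≤ M * ‖x - y‖ ^ α

/-- `v` is the weak gradient of `u` on `s`. -/
def IsWeakGrad {d : ℕ} (s : Set (Euc d)) (u : Euc d → ℝ) (v : Euc d → Euc d) : Prop :=
  ∀ φ : Euc d → ℝ, ContDiff ℝ (⊤ : ℕ∞) φ → HasCompactSupport φ → tsupport φ ⊆ s →
    ∫ x in s, u x • gradient φ x = - ∫ x in s, φ x • v x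

/-- `u ∈ W^{1,p}₀(s)`, with weak gradient `v`: `u, v ∈ L^p`, `v` is the weak gradient of `u`,
and `u` is approximable by smooth compactly supported functions in the `W^{1,p}` norm. -/
def MemW1p0 {d : ℕ} (p : ℝ) (s : Set (Euc d)) (u : Euc d → ℝ) (v : Euc d → Euc d) : Prop :=
  IsWeakGrad s u v ∧
  MemLp u (ENNReal.ofReal p) (volume.restrict s) ∧
  MemLp v (ENNReal.ofReal p) (volume.restrict s) ∧
  ∀ ε : ℝ, 0 < ε → ∃ φ : Euc d → ℝ, ContDiff ℝ (⊤ : ℕ∞) φ ∧ HasCompactSupport φ ∧ tsupport φ ⊆ s ∧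
    eLpNorm (fun x => u x - φ x) (ENNReal.ofReal p) (volume.restrict s) < ENNReal.ofReal ε ∧
    eLpNorm (fun x => v x - gradient φ x) (ENNReal.ofReal p) (volume.restrict s) < ENNReal.ofReal ε

/-- The quantity `φ(r) = (1/r) inf_{l ∈ 𝔄} (⨍_{B_r} |Du - l|^{1/2})²`, the infimum being over
affine maps `l(x) = Sx + p` with `S` symmetric. -/
noncomputable def phiFun {d : ℕ} (u : Euc d → ℝ) (r : ℝ) : ℝ :=
  (1 / r) * ⨅ S : {S : Euc d →L[ℝ] Euc d // ∀ ξ η, ⟪S ξ, η⟫ = ⟪ξ, S η⟫}, ⨅ p : Euc d,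
    (⨍ x in ball (0 : Euc d) r, Real.sqrt ‖gradient u x - S.1 x - p‖) ^ 2

end

section

namespace W11

/-! ### L2 norm -/

/-- The `L²` norm over the whole space. -/
noncomputable def nrm {d : ℕ} {V : Type*} [NormedAddCommGroup V] (f : Euc d → V) : ℝ :=
  (eLpNorm f 2 volume).toReal

section nrm
variable {d : ℕ} {V : Type*} [NormedAddCommGroup V] {f g : Euc d → V}

lemma nrm_nonneg : 0 ≤ nrm f := ENNReal.toReal_nonneg

lemma nrm_add_le (hf : MemLp f 2) (hg : MemLp g 2) : nrm (fun x => f x + g x) ≤ nrm f + nrm g := by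
  have := eLpNorm_add_le hf.1 hg.1 (p := 2) (by norm_num)
  have h2 := ENNReal.toReal_mono (by simp [hf.2.ne, hg.2.ne]) this
  rwa [ENNReal.toReal_add hf.2.ne hg.2.ne] at h2

lemma nrm_sub_le (hf : MemLp f 2) (hg : MemLp g 2) : nrm (fun x => f x - g x) ≤ nrm f + nrm g := by
  have := eLpNorm_sub_le hf.1 hg.1 (p := 2) (by norm_num)
  have h2 := ENNReal.toReal_mono (by simp [hf.2.ne, hg.2.ne]) this
  rwa [ENNReal.toReal_add hf.2.ne hg.2.ne] at h2

lemma nrm_sub_comm : nrm (fun x => f x - g x) = nrm (fun x => g x - f x) := by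
  unfold nrm; congr 1; exact eLpNorm_sub_comm f g 2 _

lemma nrm_le_mul {W : Type*} [NormedAddCommGroup W] {g : Euc d → W} (hg : MemLp g 2) {C : ℝ}
    (hC : 0 ≤ C) (h : ∀ᵐ x, ‖f x‖ ≤ C * ‖g x‖) : nrm f ≤ C * nrm g := by
  have := eLpNorm_le_mul_eLpNorm_of_ae_le_mul h 2
  have h2 := ENNReal.toReal_mono (ENNReal.mul_ne_top (by simp) hg.2.ne) this
  rwa [ENNReal.toReal_mul, ENNReal.toReal_ofReal hC] at h2

lemma nrm_mono {W : Type*} [NormedAddCommGroup W] {g : Euc d → W} (hg : MemLp g 2)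
    (h : ∀ᵐ x, ‖f x‖ ≤ ‖g x‖) : nrm f ≤ nrm g := by
  simpa using nrm_le_mul hg zero_le_one (by simpa using h)

lemma nrm_norm : nrm (fun x => ‖f x‖) = nrm f := by
  unfold nrm; rw [eLpNorm_norm]

lemma nrm_congr (h : f =ᵐ[volume] g) : nrm f = nrm g := by
  unfold nrm; rw [eLpNorm_congr_ae h]

lemma integrable_norm_sq (hf : MemLp f 2) : Integrable (fun x => ‖f x‖ ^ 2) :=
  hf.integrable_norm_pow (by norm_num)

lemma nrm_sq (hf : MemLp f 2) : ∫ x, ‖f x‖ ^ 2 = nrm f ^ 2 := by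
  have h := real_inner_self_eq_norm_sq hf.norm.toLp
  rw [Lp.norm_toLp, L2.inner_def] at h
  have h2 := nrm_norm (f := f)
  unfold nrm at h2
  rw [h2] at h
  unfold nrm
  rw [← h]
  apply integral_congr_ae
  filter_upwards [hf.norm.coeFn_toLp] with x h1
  rw [h1, real_inner_self_eq_norm_sq, norm_norm]

lemma integrable_norm_mul {W : Type*} [NormedAddCommGroup W] {g : Euc d → W}
    (hf : MemLp f 2) (hg : MemLp g 2) : Integrable (fun x => ‖f x‖ * ‖g x‖) :=
  hf.norm.integrable_mul hg.norm

lemma integral_norm_mul_le {W : Type*} [NormedAddCommGroup W] {g : Euc d → W}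
    (hf : MemLp f 2) (hg : MemLp g 2) : ∫ x, ‖f x‖ * ‖g x‖ ≤ nrm f * nrm g := by
  have h := real_inner_le_norm hf.norm.toLp hg.norm.toLp
  rw [Lp.norm_toLp, Lp.norm_toLp, L2.inner_def] at h
  have h2 := nrm_norm (f := f)
  have h3 := nrm_norm (f := g)
  unfold nrm at h2 h3
  rw [h2, h3] at h
  refine le_trans (le_of_eq ?_) h
  apply integral_congr_ae
  filter_upwards [hf.norm.coeFn_toLp, hg.norm.coeFn_toLp] with x h1 h2
  rw [h1, h2]
  simp [mul_comm]

lemma nrm_zero_ae (hf : MemLp f 2) (h : nrm f = 0) : f =ᵐ[volume] 0 := by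
  rw [← eLpNorm_eq_zero_iff hf.1 (p := 2) (by norm_num)]
  have := (ENNReal.toReal_eq_zero_iff _).mp h
  exact this.resolve_right hf.2.ne

end nrm

variable {d : ℕ}

lemma integrable_inner {f g : Euc d → Euc d} (hf : MemLp f 2)
    (hg : MemLp g 2) : Integrable (fun x => ⟪f x, g x⟫) := by
  refine (integrable_norm_mul hf hg).mono (hf.1.inner hg.1) (ae_of_all _ fun x => ?_)
  simpa using abs_real_inner_le_norm (f x) (g x)

lemma abs_integral_inner_le {f g : Euc d → Euc d} (hf : MemLp f 2)
    (hg : MemLp g 2) : |∫ x, ⟪f x, g x⟫| ≤ nrm f * nrm g := by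
  refine le_trans ?_ (integral_norm_mul_le hf hg)
  refine (abs_integral_le_integral_abs).trans ?_
  exact integral_mono (integrable_inner hf hg).abs (integrable_norm_mul hf hg)
    fun x => abs_real_inner_le_norm _ _

lemma integrable_mul2 {f g : Euc d → ℝ} (hf : MemLp f 2)
    (hg : MemLp g 2) : Integrable (fun x => f x * g x) := hf.integrable_mul hg

lemma abs_integral_mul_le {f g : Euc d → ℝ} (hf : MemLp f 2)
    (hg : MemLp g 2) : |∫ x, f x * g x| ≤ nrm f * nrm g := by
  refine le_trans ?_ (integral_norm_mul_le hf hg)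
  refine (abs_integral_le_integral_abs).trans ?_
  exact integral_mono (integrable_mul2 hf hg).abs (integrable_norm_mul hf hg)
    fun x => by simp [abs_mul]

lemma memLp_clm {f : Euc d → Euc d} {p : ℝ≥0∞} {μ : Measure (Euc d)} (hf : MemLp f p μ)
    (A : Euc d →L[ℝ] Euc d) : MemLp (fun x => A (f x)) p μ :=
  A.comp_memLp' hf

lemma tendsto_inner {f : ℕ → Euc d → Euc d} {f' g : Euc d → Euc d} (hf : ∀ n, MemLp (f n) 2)
    (hf' : MemLp f' 2) (hg : MemLp g 2) (h : Tendsto (fun n => nrm (fun x => f n x - f' x)) atTop (𝓝 0)) :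
    Tendsto (fun n => ∫ x, ⟪g x, f n x⟫) atTop (𝓝 (∫ x, ⟪g x, f' x⟫)) := by
  rw [tendsto_iff_dist_tendsto_zero]
  refine squeeze_zero (fun _ => dist_nonneg) (fun n => ?_)
    (by simpa using h.const_mul (nrm g))
  rw [Real.dist_eq, ← integral_sub (integrable_inner hg (hf n)) (integrable_inner hg hf')]
  simp only [← inner_sub_right]
  exact abs_integral_inner_le hg ((hf n).sub hf')

lemma tendsto_mul {f : ℕ → Euc d → ℝ} {f' g : Euc d → ℝ} (hf : ∀ n, MemLp (f n) 2)
    (hf' : MemLp f' 2) (hg : MemLp g 2) (h : Tendsto (fun n => nrm (fun x => f n x - f' x)) atTop (𝓝 0)) :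
    Tendsto (fun n => ∫ x, g x * f n x) atTop (𝓝 (∫ x, g x * f' x)) := by
  rw [tendsto_iff_dist_tendsto_zero]
  refine squeeze_zero (fun _ => dist_nonneg) (fun n => ?_)
    (by simpa using h.const_mul (nrm g))
  rw [Real.dist_eq, ← integral_sub (integrable_mul2 hg (hf n)) (integrable_mul2 hg hf')]
  simp only [← mul_sub]
  exact abs_integral_mul_le hg ((hf n).sub hf')


structure Test (U : Set (Euc d)) (φ : Euc d → ℝ) : Prop where
  smooth : ContDiff ℝ (⊤ : ℕ∞) φ
  cpt : HasCompactSupport φ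
  supp : tsupport φ ⊆ U

lemma contDiff_gradient {φ : Euc d → ℝ} (h : ContDiff ℝ (⊤ : ℕ∞) φ) :
    ContDiff ℝ (⊤ : ℕ∞) (gradient φ) := by
  have : ContDiff ℝ (⊤ : ℕ∞) (fderiv ℝ φ) := h.fderiv_right (by simp)
  exact (LinearIsometryEquiv.contDiff _).comp this

lemma continuous_gradient {φ : Euc d → ℝ} (h : ContDiff ℝ (⊤ : ℕ∞) φ) :
    Continuous (gradient φ) := (contDiff_gradient h).continuous

lemma gradient_supp {φ : Euc d → ℝ} : Function.support (gradient φ) ⊆ tsupport φ := by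
  intro x hx
  apply support_fderiv_subset ℝ
  intro h
  apply hx
  simp [gradient, h]

lemma hasCompactSupport_gradient {φ : Euc d → ℝ} (h : HasCompactSupport φ) :
    HasCompactSupport (gradient φ) :=
  h.mono' gradient_supp

section test
variable {U V : Set (Euc d)} {φ ψ : Euc d → ℝ}

lemma Test.mono (h : Test U φ) (hUV : U ⊆ V) : Test V φ := ⟨h.smooth, h.cpt, h.supp.trans hUV⟩

lemma Test.grad_zero (h : Test U φ) {x : Euc d} (hx : x ∉ U) : gradient φ x = 0 := by
  by_contra hne
  exact hx (h.supp (gradient_supp hne))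

lemma Test.zero_off (h : Test U φ) {x : Euc d} (hx : x ∉ U) : φ x = 0 := by
  by_contra hne
  exact hx (h.supp (subset_tsupport _ hne))

lemma Test.cont (h : Test U φ) : Continuous φ := h.smooth.continuous
lemma Test.contg (h : Test U φ) : Continuous (gradient φ) := continuous_gradient h.smooth
lemma Test.cptg (h : Test U φ) : HasCompactSupport (gradient φ) := hasCompactSupport_gradient h.cpt

lemma Test.memLp_grad (h : Test U φ) {p : ℝ≥0∞} : MemLp (gradient φ) p volume :=
  h.contg.memLp_of_hasCompactSupport h.cptg

lemma Test.memLp (h : Test U φ) {p : ℝ≥0∞} : MemLp φ p volume :=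
  h.cont.memLp_of_hasCompactSupport h.cpt

lemma Test.bdd_grad (h : Test U φ) : ∃ M, 0 ≤ M ∧ ∀ x, ‖gradient φ x‖ ≤ M := by
  obtain ⟨M, hM⟩ := h.contg.bounded_above_of_compact_support h.cptg
  exact ⟨M, (norm_nonneg _).trans (hM 0), hM⟩

lemma Test.bdd (h : Test U φ) : ∃ M, 0 ≤ M ∧ ∀ x, ‖φ x‖ ≤ M := by
  obtain ⟨M, hM⟩ := h.cont.bounded_above_of_compact_support h.cpt
  exact ⟨M, (norm_nonneg _).trans (hM 0), hM⟩

lemma Test.diff (h : Test U φ) : Differentiable ℝ φ := h.smooth.differentiable (by simp)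

lemma gradient_add' {f g : Euc d → ℝ} (hf : Differentiable ℝ f)
    (hg : Differentiable ℝ g) (x : Euc d) :
    gradient (fun x => f x + g x) x = gradient f x + gradient g x := by
  simp only [gradient]
  rw [fderiv_fun_add (hf x) (hg x), map_add]

lemma gradient_const_mul' {f : Euc d → ℝ} (hf : Differentiable ℝ f)
    (c : ℝ) (x : Euc d) :
    gradient (fun x => c * f x) x = c • gradient f x := by
  simp only [gradient]
  rw [fderiv_const_mul (hf x)]
  simp

lemma gradient_mul' {f g : Euc d → ℝ} (hf : Differentiable ℝ f)
    (hg : Differentiable ℝ g) (x : Euc d) :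
    gradient (fun x => f x * g x) x = f x • gradient g x + g x • gradient f x := by
  simp only [gradient]
  rw [fderiv_fun_mul (hf x) (hg x), map_add]
  simp

lemma inner_gradient (f : Euc d → ℝ) (x e : Euc d) : ⟪gradient f x, e⟫ = fderiv ℝ f x e := by
  simp [gradient]

lemma Test.add (h : Test U φ) (h' : Test U ψ) : Test U (fun x => φ x + ψ x) where
  smooth := h.smooth.add h'.smooth
  cpt := h.cpt.add h'.cpt
  supp := (tsupport_add φ ψ).trans (Set.union_subset h.supp h'.supp)

lemma Test.const_mul (h : Test U φ) (c : ℝ) : Test U (fun x => c * φ x) where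
  smooth := contDiff_const.mul h.smooth
  cpt := h.cpt.mul_left (f := fun _ => c)
  supp := (tsupport_mul_subset_right (f := fun _ => c)).trans h.supp

lemma Test.smooth_mul (h : Test U φ) (hχ : ContDiff ℝ (⊤ : ℕ∞) ψ) : Test U (fun x => ψ x * φ x) where
  smooth := hχ.mul h.smooth
  cpt := h.cpt.mul_left
  supp := (tsupport_mul_subset_right).trans h.supp

lemma Test.zero : Test U (fun _ : Euc d => (0 : ℝ)) where
  smooth := contDiff_const
  cpt := HasCompactSupport.zero
  supp := by
    have : tsupport (fun _ : Euc d => (0 : ℝ)) = ∅ := by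
      rw [tsupport_eq_empty_iff]; rfl
    rw [this]; simp

end test

/-! ### directional derivatives -/

/-- Directional derivative. -/
noncomputable def pd (e : Euc d) (ψ : Euc d → ℝ) : Euc d → ℝ := fun x => fderiv ℝ ψ x e

/-- Standard basis vector. -/
noncomputable abbrev bv (i : Fin d) : Euc d := EuclideanSpace.basisFun (Fin d) ℝ i

/-- The operator `div (A D ψ)` (for symmetric `A`). -/
noncomputable def dvA (A : Euc d →L[ℝ] Euc d) (ψ : Euc d → ℝ) : Euc d → ℝ :=
  fun x => ∑ i, pd (bv i) (pd (A (bv i)) ψ) x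

lemma contDiff_pd {ψ : Euc d → ℝ} (h : ContDiff ℝ (⊤ : ℕ∞) ψ) (e : Euc d) :
    ContDiff ℝ (⊤ : ℕ∞) (pd e ψ) :=
  (h.fderiv_right (m := (⊤ : ℕ∞)) (by simp)).clm_apply contDiff_const

lemma contDiff_dvA {ψ : Euc d → ℝ} (h : ContDiff ℝ (⊤ : ℕ∞) ψ) (A : Euc d →L[ℝ] Euc d) :
    ContDiff ℝ (⊤ : ℕ∞) (dvA A ψ) :=
  ContDiff.sum fun i _ => contDiff_pd (contDiff_pd h _) _

lemma pd_supp {e : Euc d} {ψ : Euc d → ℝ} : Function.support (pd e ψ) ⊆ tsupport ψ := by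
  intro x hx
  apply support_fderiv_subset ℝ
  intro h
  apply hx
  simp [pd, h]

lemma tsupport_pd {e : Euc d} {ψ : Euc d → ℝ} : tsupport (pd e ψ) ⊆ tsupport ψ :=
  closure_minimal pd_supp (isClosed_tsupport _)

lemma hasCompactSupport_pd {ψ : Euc d → ℝ} (h : HasCompactSupport ψ) (e : Euc d) :
    HasCompactSupport (pd e ψ) := h.mono' pd_supp

lemma Test.pd {U : Set (Euc d)} {φ : Euc d → ℝ} (h : Test U φ) (e : Euc d) : Test U (pd e φ) :=
  ⟨contDiff_pd h.smooth e, hasCompactSupport_pd h.cpt e, tsupport_pd.trans h.supp⟩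

lemma Test.sum {U : Set (Euc d)} {ι : Type*} (s : Finset ι) {φ : ι → Euc d → ℝ}
    (h : ∀ i ∈ s, Test U (φ i)) : Test U (fun x => ∑ i ∈ s, φ i x) := by
  classical
  induction s using Finset.induction_on with
  | empty => simpa using Test.zero
  | insert a s ha ih =>
    have h1 := ih (fun i hi => h i (Finset.mem_insert_of_mem hi))
    have h2 := (h a (Finset.mem_insert_self _ _)).add h1
    simpa [Finset.sum_insert ha, add_comm] using h2

lemma Test.dvA {U : Set (Euc d)} {φ : Euc d → ℝ} (h : Test U φ) (A : Euc d →L[ℝ] Euc d) :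
    Test U (dvA A φ) := Test.sum _ fun i _ => (h.pd _).pd _

lemma pd_comm {ψ : Euc d → ℝ} (h : ContDiff ℝ (⊤ : ℕ∞) ψ) (a b : Euc d) :
    pd a (pd b ψ) = pd b (pd a ψ) := by
  funext x
  have hd : DifferentiableAt ℝ (fderiv ℝ ψ) x :=
    (h.fderiv_right (m := (⊤ : ℕ∞)) (by simp)).differentiable (by simp) x
  have e : ∀ a b : Euc d, pd a (pd b ψ) x = fderiv ℝ (fderiv ℝ ψ) x a b := by
    intro a b
    unfold pd
    rw [fderiv_clm_apply hd (differentiableAt_const _)]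
    simp
  rw [e, e]
  exact (h.contDiffAt.isSymmSndFDerivAt (by simp; exact WithTop.coe_le_coe.mpr (le_top : (2:ℕ∞) ≤ ⊤))) a b

lemma pd_dvA {ψ : Euc d → ℝ} (h : ContDiff ℝ (⊤ : ℕ∞) ψ) (A : Euc d →L[ℝ] Euc d) (e : Euc d) :
    pd e (dvA A ψ) = dvA A (pd e ψ) := by
  have e1 : ∀ i, pd e (pd (bv i) (pd (A (bv i)) ψ)) = pd (bv i) (pd (A (bv i)) (pd e ψ)) := by
    intro i
    rw [pd_comm (contDiff_pd h _), pd_comm h e]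
  funext x
  have hd : ∀ i, DifferentiableAt ℝ (pd (bv i) (pd (A (bv i)) ψ)) x := fun i =>
    (contDiff_pd (contDiff_pd h _) _).differentiable (by simp) x
  have : pd e (dvA A ψ) x = ∑ i, pd e (pd (bv i) (pd (A (bv i)) ψ)) x := by
    change fderiv ℝ (fun x => ∑ i, pd (bv i) (pd (A (bv i)) ψ) x) x e = _
    rw [fderiv_fun_sum fun i _ => hd i]
    rw [_root_.sum_apply]
    rfl
  rw [this]
  unfold dvA
  simp only [e1]

lemma ibp {f g : Euc d → ℝ} (hf : ContDiff ℝ (⊤ : ℕ∞) f) (hg : ContDiff ℝ (⊤ : ℕ∞) g)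
    (hc : HasCompactSupport f) (e : Euc d) :
    ∫ x, f x * pd e g x = - ∫ x, pd e f x * g x := by
  apply integral_mul_fderiv_eq_neg_fderiv_mul_of_integrable
  · exact ((contDiff_pd hf e).continuous.mul hg.continuous).integrable_of_hasCompactSupport
      ((hasCompactSupport_pd hc e).mul_right)
  · exact (hf.continuous.mul (contDiff_pd hg e).continuous).integrable_of_hasCompactSupport
      (hc.mul_right)
  · exact (hf.continuous.mul hg.continuous).integrable_of_hasCompactSupport (hc.mul_right)
  · exact fun x _ => hf.differentiable (by simp) x
  · exact fun x _ => hg.differentiable (by simp) x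

/-- expansion of the inner product with `A Dψ`. -/
lemma inner_A_grad {A : Euc d →L[ℝ] Euc d} (hs : ∀ x y, ⟪A x, y⟫ = ⟪x, A y⟫) (v : Euc d)
    (ψ : Euc d → ℝ) (x : Euc d) :
    ⟪v, A (gradient ψ x)⟫ = ∑ i, ⟪v, bv i⟫ * pd (A (bv i)) ψ x := by
  rw [← OrthonormalBasis.sum_inner_mul_inner (EuclideanSpace.basisFun (Fin d) ℝ)]
  refine Finset.sum_congr rfl fun i _ => ?_
  congr 1
  rw [← hs, real_inner_comm, inner_gradient]; rfl

lemma ibpA {A : Euc d →L[ℝ] Euc d} (hs : ∀ x y, ⟪A x, y⟫ = ⟪x, A y⟫) {φ Ψ : Euc d → ℝ}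
    {U : Set (Euc d)} (hφ : Test U φ) (hΨ : ContDiff ℝ (⊤ : ℕ∞) Ψ) :
    ∫ x, ⟪A (gradient Ψ x), gradient φ x⟫ = - ∫ x, dvA A Ψ x * φ x := by
  have e : ∀ x, ⟪A (gradient Ψ x), gradient φ x⟫ = ∑ i, pd (bv i) φ x * pd (A (bv i)) Ψ x := by
    intro x
    rw [real_inner_comm, inner_A_grad hs]
    refine Finset.sum_congr rfl fun i _ => ?_
    rw [inner_gradient]; rfl
  have i1 : ∀ i, Integrable (fun x => pd (bv i) φ x * pd (A (bv i)) Ψ x) := fun i =>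
    ((hφ.pd _).cont.mul (contDiff_pd hΨ _).continuous).integrable_of_hasCompactSupport
      ((hφ.pd _).cpt.mul_right)
  have i2 : ∀ i, Integrable (fun x => φ x * pd (bv i) (pd (A (bv i)) Ψ) x) := fun i =>
    (hφ.cont.mul (contDiff_pd (contDiff_pd hΨ _) _).continuous).integrable_of_hasCompactSupport
      (hφ.cpt.mul_right)
  simp only [e]
  rw [integral_finsetSum _ fun i _ => i1 i]
  have : ∀ x, dvA A Ψ x * φ x = ∑ i, φ x * pd (bv i) (pd (A (bv i)) Ψ) x := by
    intro x; unfold dvA; rw [mul_comm, Finset.mul_sum]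
  simp only [this]
  rw [integral_finsetSum _ fun i _ => i2 i, ← Finset.sum_neg_distrib]
  refine Finset.sum_congr rfl fun i _ => ?_
  rw [ibp hφ.smooth (contDiff_pd hΨ _) hφ.cpt, neg_neg]

/-! ### Poincare -/

lemma poincare {φ : Euc d → ℝ} (hd : 0 < d) (h : Test (ball 0 1) φ) : nrm φ ≤ 2 * nrm (gradient φ) := by
  set i : Fin d := ⟨0, hd⟩
  set e := bv i
  have he : ‖e‖ = 1 := by simp [e, bv]
  set ℓ : Euc d → ℝ := fun x => ⟪e, x⟫
  have hℓ : ContDiff ℝ (⊤ : ℕ∞) ℓ := contDiff_const.inner ℝ contDiff_id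
  have hpd : ∀ x, pd e ℓ x = 1 := by
    intro x
    have : HasFDerivAt ℓ (innerSL ℝ e) x := (innerSL ℝ e).hasFDerivAt
    unfold pd
    rw [this.fderiv]
    simp [he]
  have key := ibp (h.smooth.mul h.smooth) hℓ (h.cpt.mul_right) e
  simp only [hpd, mul_one] at key
  have e2 : ∀ x, pd e (fun x => φ x * φ x) x = 2 * (φ x * ⟪gradient φ x, e⟫) := by
    intro x
    unfold pd
    rw [fderiv_fun_mul (h.diff x) (h.diff x), inner_gradient]
    simp; ring
  have h1 : nrm φ ^ 2 ≤ 2 * (nrm φ * nrm (gradient φ)) := by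
    have hI := integrable_norm_mul (h.memLp (p := 2)) (h.memLp_grad (p := 2))
    calc nrm φ ^ 2 = ∫ x, φ x * φ x := by
          rw [← nrm_sq h.memLp]; congr 1; funext x; rw [Real.norm_eq_abs, sq_abs, sq]
      _ = - ∫ x, pd e (fun x => φ x * φ x) x * ℓ x := key
      _ = ∫ x, -(pd e (fun x => φ x * φ x) x * ℓ x) := by rw [integral_neg]
      _ ≤ ∫ x, 2 * (‖φ x‖ * ‖gradient φ x‖) := by
          have ht : Test (ball 0 1) (fun x => φ x * φ x) := h.smooth_mul h.smooth
          refine integral_mono ?_ (hI.const_mul 2) fun x => ?_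
          · exact (((ht.pd e).cont.mul hℓ.continuous).integrable_of_hasCompactSupport
              ((ht.pd e).cpt.mul_right)).neg
          · simp only [e2]
            by_cases hx : x ∈ ball (0 : Euc d) 1
            · have hx1 : ‖x‖ ≤ 1 := by simpa using (mem_ball_zero_iff.mp hx).le
              have a1 : |ℓ x| ≤ 1 := (abs_real_inner_le_norm _ _).trans (by rw [he, one_mul]; exact hx1)
              have a2 : |⟪gradient φ x, e⟫| ≤ ‖gradient φ x‖ :=
                (abs_real_inner_le_norm _ _).trans (by rw [he, mul_one])
              refine (neg_le_abs _).trans ?_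
              rw [abs_mul, abs_mul, abs_mul, abs_two, Real.norm_eq_abs]
              calc 2 * (|φ x| * |⟪gradient φ x, e⟫|) * |ℓ x| ≤ 2 * (|φ x| * ‖gradient φ x‖) * 1 := by
                    gcongr
                _ = _ := by ring
            · rw [h.zero_off hx]; simp
      _ = 2 * ∫ x, ‖φ x‖ * ‖gradient φ x‖ := integral_const_mul _ _
      _ ≤ _ := by gcongr; exact integral_norm_mul_le h.memLp h.memLp_grad
  have := nrm_nonneg (f := φ)
  have := nrm_nonneg (f := gradient φ)
  by_contra hlt
  push Not at hlt
  nlinarith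

end W11

end

section

namespace W11
variable {d : ℕ}

/-- `(z, Z)` belongs to `W^{1,2}_0(U)`. -/
structure W0 (U : Set (Euc d)) (z : Euc d → ℝ) (Z : Euc d → Euc d) : Prop where
  mem : MemLp z 2
  memg : MemLp Z 2
  seq : ∃ φ : ℕ → Euc d → ℝ, (∀ n, Test U (φ n)) ∧
    Tendsto (fun n => nrm (fun x => φ n x - z x)) atTop (𝓝 0) ∧
    Tendsto (fun n => nrm (fun x => gradient (φ n) x - Z x)) atTop (𝓝 0)

lemma W0.of_test {U : Set (Euc d)} {φ : Euc d → ℝ} (h : Test U φ) : W0 U φ (gradient φ) where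
  mem := h.memLp
  memg := h.memLp_grad
  seq := ⟨fun _ => φ, fun _ => h, by simp [nrm], by simp [nrm]⟩

lemma W0.mono {U V : Set (Euc d)} {z Z} (h : W0 U z Z) (hUV : U ⊆ V) : W0 V z Z where
  mem := h.mem
  memg := h.memg
  seq := by
    obtain ⟨φ, h1, h2⟩ := h.seq
    exact ⟨φ, fun n => (h1 n).mono hUV, h2⟩

lemma nrm_lin {V : Type*} [NormedAddCommGroup V] [NormedSpace ℝ V] {f g f' g' : Euc d → V} (c : ℝ)
    (h1 : MemLp f 2) (h2 : MemLp g 2) (h3 : MemLp f' 2) (h4 : MemLp g' 2) :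
    nrm (fun x => (f x + c • g x) - (f' x + c • g' x)) ≤
      nrm (fun x => f x - f' x) + |c| * nrm (fun x => g x - g' x) := by
  have e : (fun x => (f x + c • g x) - (f' x + c • g' x)) =
      fun x => (f x - f' x) + c • (g x - g' x) := by
    funext x; rw [smul_sub]; abel
  rw [e]
  refine (nrm_add_le (h1.sub h3) ((h2.sub h4).const_smul c)).trans ?_
  gcongr
  · exact le_refl _
  · exact nrm_le_mul (h2.sub h4) (abs_nonneg c) (ae_of_all _ fun x => by
      simp [norm_smul])

lemma W0.lin {U : Set (Euc d)} {z Z y Y} (h : W0 U z Z) (h' : W0 U y Y) (c : ℝ) :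
    W0 U (fun x => z x + c * y x) (fun x => Z x + c • Y x) where
  mem := h.mem.add (h'.mem.const_mul c)
  memg := h.memg.add (h'.memg.const_smul c)
  seq := by
    obtain ⟨φ, a1, a2, a3⟩ := h.seq
    obtain ⟨ψ, b1, b2, b3⟩ := h'.seq
    refine ⟨fun n x => φ n x + c * ψ n x, fun n => (a1 n).add ((b1 n).const_mul c), ?_, ?_⟩
    · refine squeeze_zero (fun _ => nrm_nonneg) (fun n => ?_) (by simpa using a2.add (b2.const_mul |c|))
      exact nrm_lin (V := ℝ) c (a1 n).memLp (b1 n).memLp h.mem h'.mem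
    · refine squeeze_zero (fun _ => nrm_nonneg) (fun n => ?_) (by simpa using a3.add (b3.const_mul |c|))
      have e : ∀ x, gradient (fun x => φ n x + c * ψ n x) x =
        gradient (φ n) x + c • gradient (ψ n) x := fun x => by
          rw [gradient_add' (a1 n).diff ((b1 n).const_mul c).diff, gradient_const_mul' (b1 n).diff]
      simp only [e]
      exact nrm_lin c (a1 n).memLp_grad (b1 n).memLp_grad h.memg h'.memg

lemma W0.zero {U : Set (Euc d)} : W0 U (fun _ => 0) (fun _ => 0) := by
  have := W0.of_test (Test.zero (U := U))
  have e : gradient (fun _ : Euc d => (0:ℝ)) = fun _ => 0 := by funext x; exact gradient_fun_const x 0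
  rwa [e] at this

lemma W0.sum {U : Set (Euc d)} {ι : Type*} (s : Finset ι) {z : ι → Euc d → ℝ} {Z : ι → Euc d → Euc d}
    (h : ∀ i ∈ s, W0 U (z i) (Z i)) :
    W0 U (fun x => ∑ i ∈ s, z i x) (fun x => ∑ i ∈ s, Z i x) := by
  classical
  induction s using Finset.induction_on with
  | empty => simpa using W0.zero
  | insert a s ha ih =>
    have h1 := ih (fun i hi => h i (Finset.mem_insert_of_mem hi))
    have h2 := h1.lin (h a (Finset.mem_insert_self _ _)) 1
    simpa [Finset.sum_insert ha, add_comm] using h2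

lemma W0.poincare {U : Set (Euc d)} (hd : 0 < d) (hU : U ⊆ ball 0 1) {z Z} (h : W0 U z Z) :
    nrm z ≤ 2 * nrm Z := by
  obtain ⟨φ, a1, a2, a3⟩ := h.seq
  have key : ∀ n, nrm z ≤ nrm (fun x => φ n x - z x) +
      2 * (nrm (fun x => gradient (φ n) x - Z x) + nrm Z) := by
    intro n
    have m1 := (a1 n).memLp (p := 2)
    have m2 := (a1 n).memLp_grad (p := 2)
    have e1 : nrm z ≤ nrm (fun x => φ n x - z x) + nrm (φ n) := by
      have := nrm_add_le (h.mem.sub m1) m1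
      rw [nrm_sub_comm]
      simp only [Pi.sub_apply, sub_add_cancel] at this
      exact this
    have e2 : nrm (gradient (φ n)) ≤ nrm (fun x => gradient (φ n) x - Z x) + nrm Z := by
      have := nrm_add_le (m2.sub h.memg) h.memg
      simp only [Pi.sub_apply, sub_add_cancel] at this
      exact this
    have := W11.poincare hd ((a1 n).mono hU)
    linarith
  have t : Tendsto (fun n => nrm (fun x => φ n x - z x) +
      2 * (nrm (fun x => gradient (φ n) x - Z x) + nrm Z)) atTop (𝓝 (0 + 2 * (0 + nrm Z))) :=
    a2.add ((a3.add_const _).const_mul 2)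
  have := ge_of_tendsto' t key
  simpa using this

lemma W0.ibp {U : Set (Euc d)} {z Z} (h : W0 U z Z) {ψ : Euc d → ℝ} (hψ : Test Set.univ ψ) (e : Euc d) :
    ∫ x, ⟪Z x, e⟫ * ψ x = - ∫ x, z x * pd e ψ x := by
  obtain ⟨φ, a1, a2, a3⟩ := h.seq
  have m1 : MemLp (fun x => ψ x • e) 2 := by
    refine (hψ.cont.smul continuous_const).memLp_of_hasCompactSupport hψ.cpt.smul_right
  have t1 := tendsto_inner (fun n => (a1 n).memLp_grad) h.memg m1 a3
  have t2 := tendsto_mul (fun n => (a1 n).memLp) h.mem (hψ.pd e).memLp a2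
  have e1 : ∀ n, ∫ x, ⟪ψ x • e, gradient (φ n) x⟫ = - ∫ x, pd e ψ x * φ n x := by
    intro n
    rw [← W11.ibp hψ.smooth (a1 n).smooth hψ.cpt]
    congr 1; funext x
    rw [real_inner_smul_left, real_inner_comm, inner_gradient]; rfl
  simp only [e1] at t1
  have := tendsto_nhds_unique t1 t2.neg
  have e2 : ∀ x, ⟪ψ x • e, Z x⟫ = ⟪Z x, e⟫ * ψ x := fun x => by
    rw [real_inner_smul_left, real_inner_comm, mul_comm]
  simp only [e2] at this
  rw [this]
  simp only [mul_comm]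

lemma W0.ibpA {U : Set (Euc d)} {A : Euc d →L[ℝ] Euc d} (hs : ∀ x y, ⟪A x, y⟫ = ⟪x, A y⟫) {z Z}
    (h : W0 U z Z) {ψ : Euc d → ℝ} (hψ : Test Set.univ ψ) :
    ∫ x, ⟪A (Z x), gradient ψ x⟫ = - ∫ x, z x * dvA A ψ x := by
  have i1 : ∀ i, Integrable (fun x => ⟪Z x, bv i⟫ * pd (A (bv i)) ψ x) := fun i =>
    integrable_mul2 (h.memg.inner_const _) (hψ.pd _).memLp
  have i2 : ∀ i, Integrable (fun x => z x * pd (bv i) (pd (A (bv i)) ψ) x) := fun i =>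
    integrable_mul2 h.mem ((hψ.pd _).pd _).memLp
  simp only [hs, inner_A_grad hs, dvA, Finset.mul_sum]
  rw [integral_finsetSum _ fun i _ => i1 i, integral_finsetSum _ fun i _ => i2 i,
    ← Finset.sum_neg_distrib]
  exact Finset.sum_congr rfl fun i _ => h.ibp (hψ.pd _) _

lemma W0.zero_off {U : Set (Euc d)} (hU : MeasurableSet U) {z Z} (h : W0 U z Z) :
    ∀ᵐ x, x ∉ U → z x = 0 ∧ Z x = 0 := by
  obtain ⟨φ, a1, a2, a3⟩ := h.seq
  have m1 : MemLp (Uᶜ.indicator z) 2 := h.mem.indicator hU.compl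
  have m2 : MemLp (Uᶜ.indicator Z) 2 := h.memg.indicator hU.compl
  have z1 : nrm (Uᶜ.indicator z) = 0 := by
    refine le_antisymm (ge_of_tendsto' a2 fun n => ?_) nrm_nonneg
    refine nrm_mono ((a1 n).memLp.sub h.mem) (ae_of_all _ fun x => ?_)
    by_cases hx : x ∈ U
    · simp [hx]
    · simp [hx, (a1 n).zero_off hx]
  have z2 : nrm (Uᶜ.indicator Z) = 0 := by
    refine le_antisymm (ge_of_tendsto' a3 fun n => ?_) nrm_nonneg
    refine nrm_mono ((a1 n).memLp_grad.sub h.memg) (ae_of_all _ fun x => ?_)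
    by_cases hx : x ∈ U
    · simp [hx]
    · simp [hx, (a1 n).grad_zero hx]
  filter_upwards [nrm_zero_ae m1 z1, nrm_zero_ae m2 z2] with x h1 h2 hx
  constructor
  · simpa [hx] using h1
  · simpa [hx] using h2

lemma memLp_smul_bdd {V : Type*} [NormedAddCommGroup V] [NormedSpace ℝ V] {χ : Euc d → ℝ}
    {f : Euc d → V} {p : ℝ≥0∞} {μ : Measure (Euc d)} {C : ℝ} (hχ : AEStronglyMeasurable χ μ)
    (hC : ∀ x, |χ x| ≤ C) (hf : MemLp f p μ) : MemLp (fun x => χ x • f x) p μ :=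
  hf.of_le_mul (c := C) (hχ.smul hf.1) (ae_of_all _ fun x => by
    rw [norm_smul, Real.norm_eq_abs]; gcongr; exact hC x)

lemma memLp_bdd_smul {V : Type*} [NormedAddCommGroup V] [NormedSpace ℝ V] {χ : Euc d → ℝ}
    {f : Euc d → V} {p : ℝ≥0∞} {μ : Measure (Euc d)} {C : ℝ} (hf : AEStronglyMeasurable f μ)
    (hC : ∀ x, ‖f x‖ ≤ C) (hχ : MemLp χ p μ) : MemLp (fun x => χ x • f x) p μ :=
  hχ.of_le_mul (c := C) (hχ.1.smul hf) (ae_of_all _ fun x => by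
    rw [norm_smul, mul_comm]; gcongr; exact hC x)

/-- product with a smooth compactly supported function. -/
lemma W0.smul {U : Set (Euc d)} {z Z} (h : W0 U z Z) {χ : Euc d → ℝ} (hχ : Test Set.univ χ) :
    W0 U (fun x => χ x * z x) (fun x => χ x • Z x + z x • gradient χ x) := by
  obtain ⟨C, hC0, hC⟩ := hχ.bdd
  obtain ⟨C', hC0', hC'⟩ := hχ.bdd_grad
  have mc := hχ.cont.aestronglyMeasurable (μ := (volume : Measure (Euc d)))
  have mg := hχ.contg.aestronglyMeasurable (μ := (volume : Measure (Euc d)))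
  obtain ⟨φ, a1, a2, a3⟩ := h.seq
  refine ⟨memLp_smul_bdd mc hC h.mem, (memLp_smul_bdd mc hC h.memg).add (memLp_bdd_smul mg hC' h.mem),
    fun n x => χ x * φ n x, fun n => (a1 n).smooth_mul hχ.smooth, ?_, ?_⟩
  · refine squeeze_zero (fun _ => nrm_nonneg) (fun n => ?_) (by simpa using a2.const_mul C)
    refine nrm_le_mul ((a1 n).memLp.sub h.mem) hC0 (ae_of_all _ fun x => ?_)
    rw [← mul_sub, norm_mul]; gcongr
    · exact hC x
    · exact le_refl _
  · refine squeeze_zero (fun _ => nrm_nonneg) (fun n => ?_)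
      (by simpa using (a3.const_mul C).add (a2.const_mul C'))
    have m1 := (a1 n).memLp_grad.sub h.memg
    have m2 := (a1 n).memLp.sub h.mem
    have e : (fun x => gradient (fun x => χ x * φ n x) x - (χ x • Z x + z x • gradient χ x)) =
        fun x => χ x • (gradient (φ n) - Z) x + (φ n - z) x • gradient χ x := by
      funext x
      rw [gradient_mul' hχ.diff (a1 n).diff]
      simp only [Pi.sub_apply, smul_sub, sub_smul]; abel
    rw [e]
    refine (nrm_add_le (memLp_smul_bdd mc hC m1) (memLp_bdd_smul mg hC' m2)).trans ?_
    refine add_le_add ?_ ?_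
    · refine nrm_le_mul m1 hC0 (ae_of_all _ fun x => ?_)
      rw [norm_smul]; gcongr; exact hC x
    · refine nrm_le_mul m2 hC0' (ae_of_all _ fun x => ?_)
      rw [norm_smul, mul_comm]; gcongr; exact hC' x

structure WSol (A : Euc d →L[ℝ] Euc d) (U : Set (Euc d)) (b : Euc d → Euc d) (f : Euc d → ℝ)
    (z : Euc d → ℝ) (Z : Euc d → Euc d) : Prop where
  w0 : W0 U z Z
  memb : MemLp b 2
  memf : MemLp f 2
  weak : ∀ η, Test U η → ∫ x, ⟪A (Z x), gradient η x⟫ = (∫ x, ⟪b x, gradient η x⟫) + ∫ x, f x * η x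

lemma WSol.weak' {A : Euc d →L[ℝ] Euc d} {U : Set (Euc d)} {b f z Z} (h : WSol A U b f z Z) {y Y}
    (hy : W0 U y Y) :
    ∫ x, ⟪A (Z x), Y x⟫ = (∫ x, ⟪b x, Y x⟫) + ∫ x, f x * y x := by
  obtain ⟨φ, a1, a2, a3⟩ := hy.seq
  have t1 := tendsto_inner (fun n => (a1 n).memLp_grad) hy.memg (memLp_clm h.w0.memg A) a3
  have t2 := tendsto_inner (fun n => (a1 n).memLp_grad) hy.memg h.memb a3
  have t3 := tendsto_mul (fun n => (a1 n).memLp) hy.mem h.memf a2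
  simp only [fun n => h.weak _ (a1 n)] at t1
  exact tendsto_nhds_unique t1 (t2.add t3)

end W11

end

section

namespace W11
variable {d : ℕ}

lemma l2_inner_eq {f g : Lp (Euc d) 2 (volume : Measure (Euc d))} {f' g' : Euc d → Euc d}
    (hf : f =ᵐ[volume] f') (hg : g =ᵐ[volume] g') :
    ⟪f, g⟫ = ∫ x, ⟪f' x, g' x⟫ := by
  rw [L2.inner_def]
  apply integral_congr_ae
  filter_upwards [hf, hg] with x h1 h2
  rw [h1, h2]

lemma l2_inner_eq' {f g : Lp ℝ 2 (volume : Measure (Euc d))} {f' g' : Euc d → ℝ}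
    (hf : f =ᵐ[volume] f') (hg : g =ᵐ[volume] g') :
    ⟪f, g⟫ = ∫ x, f' x * g' x := by
  rw [L2.inner_def]
  apply integral_congr_ae
  filter_upwards [hf, hg] with x h1 h2
  rw [h1, h2]; simp [mul_comm]

lemma lax_milgram {S H : Type*} [NormedAddCommGroup S] [InnerProductSpace ℝ S] [CompleteSpace S]
    [NormedAddCommGroup H] [InnerProductSpace ℝ H] (L : S →L[ℝ] H) (AL : H →L[ℝ] H) {c : ℝ}
    (hc : 0 < c) (hco : ∀ p, c * (‖p‖ * ‖p‖) ≤ ⟪AL (L p), L p⟫) (ℓ : S →L[ℝ] ℝ) :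
    ∃ p : S, ∀ q, ⟪AL (L p), L q⟫ = ℓ q := by
  let B0 : S →ₗ[ℝ] S →ₗ[ℝ] ℝ := LinearMap.mk₂ ℝ (fun p q => ⟪AL (L p), L q⟫)
    (by intros; simp [inner_add_left]) (by intros; simp [real_inner_smul_left])
    (by intros; simp [inner_add_right]) (by intros; simp [real_inner_smul_right])
  let B : S →L[ℝ] S →L[ℝ] ℝ := LinearMap.mkContinuous₂ B0 (‖AL.comp L‖ * ‖L‖) (by
    intro p q
    refine (norm_inner_le_norm (𝕜 := ℝ) (AL (L p)) (L q)).trans ?_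
    calc _ ≤ (‖AL.comp L‖ * ‖p‖) * (‖L‖ * ‖q‖) := by
          gcongr
          · exact (AL.comp L).le_opNorm p
          · exact L.le_opNorm q
      _ = _ := by ring)
  have hBapp : ∀ p q, B p q = ⟪AL (L p), L q⟫ := fun p q => rfl
  have hc : IsCoercive B := ⟨c, hc, fun p => by rw [hBapp, mul_assoc]; exact hco p⟩
  refine ⟨hc.continuousLinearEquivOfBilin.symm ((InnerProductSpace.toDual ℝ S).symm ℓ), fun q => ?_⟩
  rw [← hBapp, ← hc.continuousLinearEquivOfBilin_apply]
  simp [InnerProductSpace.toDual_symm_apply]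

/-- Existence of weak solutions. -/
theorem exists_sol (hd : 0 < d) {A : Euc d →L[ℝ] Euc d} {lam : ℝ} (hl : 0 < lam)
    (hA : ∀ ξ, lam * ‖ξ‖ ^ 2 ≤ ⟪A ξ, ξ⟫) {U : Set (Euc d)} (hU : U ⊆ ball 0 1)
    {b : Euc d → Euc d} {f : Euc d → ℝ} (hb : MemLp b 2) (hf : MemLp f 2) :
    ∃ z Z, WSol A U b f z Z := by
  let X := WithLp 2 (Lp ℝ 2 (volume : Measure (Euc d)) × Lp (Euc d) 2 (volume : Measure (Euc d)))
  let P : Submodule ℝ X :=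
    { carrier := {p | ∃ φ, Test U φ ∧ p.fst =ᵐ[volume] φ ∧ p.snd =ᵐ[volume] gradient φ}
      add_mem' := by
        rintro p q ⟨φ, h1, h2, h3⟩ ⟨ψ, k1, k2, k3⟩
        refine ⟨_, h1.add k1, ?_, ?_⟩
        · filter_upwards [Lp.coeFn_add p.fst q.fst, h2, k2] with x hx h2 k2
          rw [← h2, ← k2]; exact hx
        · filter_upwards [Lp.coeFn_add p.snd q.snd, h3, k3] with x hx h2 k2
          rw [gradient_add' h1.diff k1.diff, ← h2, ← k2]; exact hx
      zero_mem' := by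
        refine ⟨_, Test.zero, ?_, ?_⟩
        · exact Lp.coeFn_zero _ _ _
        · filter_upwards [Lp.coeFn_zero (Euc d) 2 (volume : Measure (Euc d))] with x hx
          rw [gradient_fun_const]; exact hx
      smul_mem' := by
        rintro c p ⟨φ, h1, h2, h3⟩
        refine ⟨_, h1.const_mul c, ?_, ?_⟩
        · filter_upwards [Lp.coeFn_smul c p.fst, h2] with x hx h2
          rw [← h2]; exact hx
        · filter_upwards [Lp.coeFn_smul c p.snd, h3] with x hx h2
          rw [gradient_const_mul' h1.diff, ← h2]; exact hx }
  let S : Submodule ℝ X := P.topologicalClosure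
  have hS : ∀ p ∈ S, W0 U p.fst p.snd := by
    intro p hp
    have hp' : p ∈ closure (P : Set X) := hp
    obtain ⟨u, hu, ht⟩ := mem_closure_iff_seq_limit.mp hp'
    choose φ h1 h2 h3 using hu
    have t1 : Tendsto (fun n => (u n).fst) atTop (𝓝 p.fst) :=
      ((WithLp.fstL 2 ℝ _ _).continuous.tendsto p).comp ht
    have t2 : Tendsto (fun n => (u n).snd) atTop (𝓝 p.snd) :=
      ((WithLp.sndL 2 ℝ _ _).continuous.tendsto p).comp ht
    refine ⟨Lp.memLp _, Lp.memLp _, φ, h1, ?_, ?_⟩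
    · rw [tendsto_iff_norm_sub_tendsto_zero] at t1
      refine t1.congr fun n => ?_
      rw [Lp.norm_def]
      refine nrm_congr ?_
      filter_upwards [Lp.coeFn_sub (u n).fst p.fst, h2 n] with x k1 k2
      rw [k1, Pi.sub_apply, k2]
    · rw [tendsto_iff_norm_sub_tendsto_zero] at t2
      refine t2.congr fun n => ?_
      rw [Lp.norm_def]
      refine nrm_congr ?_
      filter_upwards [Lp.coeFn_sub (u n).snd p.snd, h3 n] with x k1 k2
      rw [k1, Pi.sub_apply, k2]
  have hclosed : IsClosed (S : Set X) := P.isClosed_topologicalClosure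
  have : CompleteSpace S := hclosed.completeSpace_coe
  have hcoer : ∀ p : S, (lam / 5) * (‖p‖ * ‖p‖) ≤ ⟪A.compLpL 2 volume p.1.snd, p.1.snd⟫ := by
    intro p
    have hw := hS p.1 p.2
    have hn1 : nrm (p.1.fst : Euc d → ℝ) = ‖p.1.fst‖ := rfl
    have hn2 : nrm (p.1.snd : Euc d → Euc d) = ‖p.1.snd‖ := rfl
    have hp := hw.poincare hd hU
    rw [hn1, hn2] at hp
    have h1 : ‖p‖ * ‖p‖ = ‖p.1.fst‖ ^ 2 + ‖p.1.snd‖ ^ 2 := by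
      rw [← sq]; exact WithLp.prod_norm_sq_eq_of_L2 p.1
    rw [l2_inner_eq (A.coeFn_compLpL _) (ae_eq_refl _), h1]
    have h2 : lam * ‖p.1.snd‖ ^ 2 ≤ ∫ x, ⟪A (p.1.snd x), p.1.snd x⟫ := by
      rw [← hn2, ← nrm_sq hw.memg, ← integral_const_mul]
      exact integral_mono ((integrable_norm_sq hw.memg).const_mul _)
        (integrable_inner (memLp_clm hw.memg A) hw.memg) fun x => hA _
    refine le_trans ?_ h2
    have := norm_nonneg p.1.fst
    have h4 : ‖p.1.fst‖ ^ 2 ≤ 4 * ‖p.1.snd‖ ^ 2 := by nlinarith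
    nlinarith
  obtain ⟨p, hp⟩ := lax_milgram ((WithLp.sndL 2 ℝ _ _).comp S.subtypeL)
    (A.compLpL 2 volume) (c := lam / 5) (by positivity) hcoer
    ((innerSL ℝ hb.toLp).comp ((WithLp.sndL 2 ℝ _ _).comp S.subtypeL)
      + (innerSL ℝ hf.toLp).comp ((WithLp.fstL 2 ℝ _ _).comp S.subtypeL))
  refine ⟨p.1.fst, p.1.snd, hS p.1 p.2, hb, hf, fun η hη => ?_⟩
  let q0 : X := WithLp.toLp 2 ((hη.memLp (p := 2)).toLp, (hη.memLp_grad (p := 2)).toLp)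
  have hq0 : q0 ∈ S := P.le_topologicalClosure
    ⟨η, hη, (hη.memLp (p := 2)).coeFn_toLp, (hη.memLp_grad (p := 2)).coeFn_toLp⟩
  have := hp ⟨q0, hq0⟩
  change ⟪A.compLpL 2 volume p.1.snd, (hη.memLp_grad (p := 2)).toLp⟫ =
    ⟪hb.toLp, (hη.memLp_grad (p := 2)).toLp⟫ + ⟪hf.toLp, (hη.memLp (p := 2)).toLp⟫ at this
  rw [l2_inner_eq (A.coeFn_compLpL _) ((hη.memLp_grad (p := 2)).coeFn_toLp)] at this
  rw [l2_inner_eq hb.coeFn_toLp (hη.memLp_grad (p := 2)).coeFn_toLp,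
    l2_inner_eq' hf.coeFn_toLp (hη.memLp (p := 2)).coeFn_toLp] at this
  exact this

end W11

end

section

namespace W11
variable {d : ℕ}

/-- A smooth convex function vanishing on the negatives, with derivative in `[0,1]`. -/
noncomputable def bet (s : ℝ) : ℝ := ∫ t in (0:ℝ)..s, Real.smoothTransition t

lemma bet_deriv (s : ℝ) : HasDerivAt bet (Real.smoothTransition s) s :=
  intervalIntegral.integral_hasDerivAt_right (Real.smoothTransition.continuous.intervalIntegrable _ _)
    (Real.smoothTransition.continuous.stronglyMeasurableAtFilter _ _)
    Real.smoothTransition.continuous.continuousAt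

lemma bet_smooth : ContDiff ℝ (⊤ : ℕ∞) bet := by
  rw [contDiff_infty_iff_deriv]
  refine ⟨fun s => (bet_deriv s).differentiableAt, ?_⟩
  rw [show deriv bet = Real.smoothTransition from funext fun s => (bet_deriv s).deriv]
  exact Real.smoothTransition.contDiff

lemma bet_lip (a b : ℝ) : |bet a - bet b| ≤ |a - b| := by
  have := Convex.norm_image_sub_le_of_norm_hasDerivWithin_le (f := bet) (f' := Real.smoothTransition)
    (C := 1) (s := Set.univ) (fun x _ => (bet_deriv x).hasDerivWithinAt) (fun x _ => by
      rw [Real.norm_eq_abs, abs_of_nonneg (Real.smoothTransition.nonneg x)]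
      exact Real.smoothTransition.le_one x) convex_univ (Set.mem_univ b) (Set.mem_univ a)
  simpa using this

lemma bet_mono : Monotone bet :=
  monotone_of_deriv_nonneg (fun s => (bet_deriv s).differentiableAt) fun s => by
    rw [(bet_deriv s).deriv]; exact Real.smoothTransition.nonneg s

lemma bet_zero_nonpos {s : ℝ} (hs : s ≤ 0) : bet s = 0 := by
  have h : ∀ t ∈ Set.uIcc (0:ℝ) s, Real.smoothTransition t = 0 := by
    intro t ht
    rw [Set.uIcc_of_ge hs] at ht
    exact Real.smoothTransition.zero_of_nonpos ht.2
  rw [bet, intervalIntegral.integral_congr (g := fun _ => 0) h]; simp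

lemma bet_nonneg (s : ℝ) : 0 ≤ bet s := by
  rcases le_total s 0 with h | h
  · rw [bet_zero_nonpos h]
  · rw [← bet_zero_nonpos le_rfl]; exact bet_mono h

lemma bet_pos {s : ℝ} (hs : 0 < s) : 0 < bet s := by
  refine (bet_nonneg s).lt_of_ne fun h => ?_
  have h1 : ∀ t ≤ s, bet t = 0 := fun t ht => le_antisymm (h ▸ bet_mono ht) (bet_nonneg t)
  have h2 : deriv bet (s/2) = 0 := by
    have : bet =ᶠ[𝓝 (s/2)] fun _ => 0 := by
      filter_upwards [Iio_mem_nhds (show s/2 < s by linarith)] with t ht using h1 t (le_of_lt ht)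
    rw [this.deriv_eq]; simp
  rw [(bet_deriv _).deriv] at h2
  have := Real.smoothTransition.pos_of_pos (show 0 < s/2 by linarith)
  linarith

lemma bet_abs_le (s : ℝ) : |bet s| ≤ |s| := by
  simpa [bet_zero_nonpos le_rfl] using bet_lip s 0

lemma gradient_bet_comp {f : Euc d → ℝ} (hf : Differentiable ℝ f) (x : Euc d) :
    gradient (fun y => bet (f y)) x = Real.smoothTransition (f x) • gradient f x := by
  refine ext_inner_right ℝ fun e => ?_
  have e1 : fderiv ℝ (fun y => bet (f y)) x = _ :=
    ((bet_deriv (f x)).comp_hasFDerivAt x (hf x).hasFDerivAt).fderiv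
  rw [inner_gradient, real_inner_smul_left, inner_gradient, e1]
  simp

theorem comparison (hd : 0 < d) {A : Euc d →L[ℝ] Euc d} {lam : ℝ} (hl : 0 < lam)
    (hA : ∀ ξ, lam * ‖ξ‖ ^ 2 ≤ ⟪A ξ, ξ⟫) (hs : ∀ x y, ⟪A x, y⟫ = ⟪x, A y⟫)
    {U : Set (Euc d)} (hUm : MeasurableSet U) (hU : U ⊆ ball 0 1)
    {f z : Euc d → ℝ} {Z : Euc d → Euc d} (h : WSol A U (fun _ => 0) f z Z)
    {Ψ θ : Euc d → ℝ} (hΨ : Test Set.univ Ψ) (hΨ0 : ∀ x, 0 ≤ Ψ x) (hθ : Test Set.univ θ)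
    (hθ0 : ∀ x, 0 ≤ θ x) (hθ1 : ∀ x, θ x ≤ 1)
    (h1 : ∀ᵐ x, x ∈ U → gradient θ x ≠ 0 → z x ≤ Ψ x)
    (h2 : ∀ᵐ x, x ∈ U → Ψ x < z x → θ x ≠ 0 → f x + dvA A Ψ x ≤ 0) :
    ∀ᵐ x, x ∈ U → 0 < θ x → z x ≤ Ψ x := by
  obtain ⟨φ, hφ, t1, t2⟩ := h.w0.seq
  have hz := h.w0.mem
  have hZ := h.w0.memg
  obtain ⟨G, hG0, hG⟩ := hθ.bdd_grad
  set V : Euc d → Euc d := fun x => Z x - gradient Ψ x with hV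
  have hVm : MemLp V 2 := hZ.sub hΨ.memLp_grad
  set ζ : ℕ → Euc d → ℝ := fun n x => bet (φ n x - Ψ x) * θ x with hζ
  have hdiff : ∀ n, ContDiff ℝ (⊤ : ℕ∞) (fun x => φ n x - Ψ x) := fun n => (hφ n).smooth.sub hΨ.smooth
  have hζs : ∀ n, ContDiff ℝ (⊤ : ℕ∞) (ζ n) := fun n => (bet_smooth.comp (hdiff n)).mul hθ.smooth
  have hζsupp : ∀ n, Function.support (ζ n) ⊆ tsupport (φ n) := by
    intro n x hx
    by_contra hx'
    have := image_eq_zero_of_notMem_tsupport hx'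
    exact hx (by simp [hζ, this, bet_zero_nonpos (show -Ψ x ≤ 0 by linarith [hΨ0 x])])
  have hζt : ∀ n, Test U (ζ n) := fun n =>
    ⟨hζs n, (hφ n).cpt.mono' (hζsupp n),
      (closure_minimal (hζsupp n) (isClosed_tsupport _)).trans (hφ n).supp⟩
  set a : ℕ → Euc d → ℝ := fun n x => Real.smoothTransition (φ n x - Ψ x) * θ x with ha
  have ha0 : ∀ n x, 0 ≤ a n x := fun n x => mul_nonneg (Real.smoothTransition.nonneg _) (hθ0 x)
  have ha1 : ∀ n x, a n x ≤ 1 := fun n x =>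
    mul_le_one₀ (Real.smoothTransition.le_one _) (hθ0 x) (hθ1 x)
  have haabs : ∀ n x, |a n x| ≤ 1 := fun n x => by rw [abs_of_nonneg (ha0 n x)]; exact ha1 n x
  have hacont : ∀ n, Continuous (a n) := fun n =>
    (Real.smoothTransition.continuous.comp (hdiff n).continuous).mul hθ.cont
  have ham : ∀ n, AEStronglyMeasurable (a n) volume := fun n => (hacont n).aestronglyMeasurable
  set R : ℕ → Euc d → Euc d := fun n x => gradient (φ n) x - Z x with hR
  have hRm : ∀ n, MemLp (R n) 2 := fun n => (hφ n).memLp_grad.sub hZ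
  set T : ℕ → Euc d → Euc d := fun n x => bet (φ n x - Ψ x) • gradient θ x with hT
  have hgrad : ∀ n x, gradient (ζ n) x = T n x + a n x • (V x + R n x) := by
    intro n x
    have e0 : gradient (ζ n) x = _ := gradient_mul' (f := fun x => bet (φ n x - Ψ x))
      ((bet_smooth.comp (hdiff n)).differentiable (by simp)) hθ.diff x
    rw [e0, gradient_bet_comp ((hdiff n).differentiable (by simp))]
    have : gradient (fun y => φ n y - Ψ y) x = V x + R n x := by
      have e := gradient_add' (hφ n).diff (hΨ.const_mul (-1)).diff x
      rw [gradient_const_mul' hΨ.diff] at e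
      have e' : (fun y => φ n y - Ψ y) = fun y => φ n y + -1 * Ψ y := by ext; ring
      rw [e', e, hV, hR]; simp only []; module
    rw [this, smul_smul, ha, hT]; simp only [mul_comm]
  -- off `U` everything is fine
  have hoff := h.w0.zero_off hUm
  -- convergence of `T`
  have hTbd : ∀ n, ∀ᵐ x, ‖T n x‖ ≤ G * ‖φ n x - z x‖ := by
    intro n
    filter_upwards [h1, hoff] with x hx hx2
    by_cases hg : gradient θ x = 0
    · simp [hT, hg]; positivity
    have hzl : z x ≤ Ψ x := by
      by_cases hxU : x ∈ U
      · exact hx hxU hg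
      · rw [(hx2 hxU).1]; exact hΨ0 x
    have e0 : bet (z x - Ψ x) = 0 := bet_zero_nonpos (by linarith)
    have e1 := bet_lip (φ n x - Ψ x) (z x - Ψ x)
    rw [e0, sub_zero] at e1
    have e2 : φ n x - Ψ x - (z x - Ψ x) = φ n x - z x := by ring
    rw [e2] at e1
    simp only [hT, norm_smul, Real.norm_eq_abs]
    rw [mul_comm]
    exact mul_le_mul (hG x) e1 (abs_nonneg _) hG0
  have hdm : ∀ n, MemLp (fun x => φ n x - z x) 2 := fun n => (hφ n).memLp.sub hz
  have hTnrm : ∀ n, nrm (T n) ≤ G * nrm (fun x => φ n x - z x) := fun n =>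
    nrm_le_mul (hdm n) hG0 (hTbd n)
  have hTc : ∀ n, Continuous (T n) := fun n =>
    (bet_smooth.continuous.comp (hdiff n).continuous).smul hθ.contg
  have hTm : ∀ n, MemLp (T n) 2 := fun n =>
    MemLp.of_le_mul (hdm n) (hTc n).aestronglyMeasurable (hTbd n)
  have haV : ∀ n, MemLp (fun x => a n x • V x) 2 := fun n => memLp_smul_bdd (ham n) (haabs n) hVm
  have haR : ∀ n, MemLp (fun x => a n x • R n x) 2 := fun n => memLp_smul_bdd (ham n) (haabs n) (hRm n)
  have haRn : ∀ n, nrm (fun x => a n x • R n x) ≤ nrm (R n) := fun n => by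
    refine nrm_mono (hRm n) (.of_forall fun x => ?_)
    rw [norm_smul]
    exact mul_le_of_le_one_left (norm_nonneg _) (haabs n x)
  -- `ζ` convergence
  set ζ' : Euc d → ℝ := fun x => bet (z x - Ψ x) * θ x with hζ'
  have hζbd : ∀ n x, ‖ζ n x - ζ' x‖ ≤ 1 * ‖φ n x - z x‖ := by
    intro n x
    have e : ζ n x - ζ' x = (bet (φ n x - Ψ x) - bet (z x - Ψ x)) * θ x := by rw [hζ, hζ']; ring
    have e1 := bet_lip (φ n x - Ψ x) (z x - Ψ x)
    rw [show φ n x - Ψ x - (z x - Ψ x) = φ n x - z x by ring] at e1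
    rw [e, norm_mul, Real.norm_eq_abs, Real.norm_eq_abs, Real.norm_eq_abs, abs_of_nonneg (hθ0 x), one_mul]
    calc _ ≤ |bet (φ n x - Ψ x) - bet (z x - Ψ x)| * 1 := by gcongr; exact hθ1 x
      _ ≤ _ := by simpa using e1
  have hζ'm : MemLp ζ' 2 := by
    refine MemLp.of_le (hz.sub hΨ.memLp) ?_ (.of_forall fun x => ?_)
    · exact (bet_smooth.continuous.comp_aestronglyMeasurable
        (hz.1.sub hΨ.cont.aestronglyMeasurable)).mul hθ.cont.aestronglyMeasurable
    · rw [hζ', norm_mul, Real.norm_eq_abs, Real.norm_eq_abs, Real.norm_eq_abs, abs_of_nonneg (hθ0 x)]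
      calc _ ≤ |z x - Ψ x| * 1 := mul_le_mul (bet_abs_le _) (hθ1 x) (hθ0 x) (abs_nonneg _)
        _ = _ := by simp
  have hζlim : Tendsto (fun n => nrm (fun x => ζ n x - ζ' x)) atTop (𝓝 0) := by
    refine squeeze_zero (fun n => nrm_nonneg) (fun n => ?_) t1
    have := nrm_le_mul (hdm n) zero_le_one (.of_forall (hζbd n))
    simpa using this
  -- the right-hand side
  set q : Euc d → ℝ := fun x => f x + dvA A Ψ x with hq
  have hΨd : MemLp (dvA A Ψ) 2 := (hΨ.dvA A).memLp
  have hqm : MemLp q 2 := h.memf.add hΨd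
  have hrhs : Tendsto (fun n => ∫ x, q x * ζ n x) atTop (𝓝 (∫ x, q x * ζ' x)) :=
    tendsto_mul (fun n => (hζt n).memLp) hζ'm hqm hζlim
  have hrhs0 : ∫ x, q x * ζ' x ≤ 0 := by
    refine integral_nonpos_of_ae ?_
    filter_upwards [h2, hoff] with x hx hx2
    simp only [Pi.zero_apply]
    have hb : 0 ≤ ζ' x := mul_nonneg (bet_nonneg _) (hθ0 x)
    by_cases hz0 : ζ' x = 0
    · rw [hz0]; simp
    have hθx : θ x ≠ 0 := fun hh => hz0 (by simp [hζ', hh])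
    have hlt : Ψ x < z x := by
      by_contra hh
      exact hz0 (by simp [hζ', bet_zero_nonpos (show z x - Ψ x ≤ 0 by linarith)])
    have hxU : x ∈ U := by
      by_contra hh
      have := (hx2 hh).1
      have := hΨ0 x
      linarith
    exact mul_nonpos_of_nonpos_of_nonneg (hx hxU hlt hθx) hb
  -- the key identity
  have hAVm : MemLp (fun x => A (V x)) 2 := memLp_clm hVm A
  have key : ∀ n, (∫ x, ⟪A (V x), T n x⟫) + (∫ x, ⟪A (V x), a n x • V x⟫)
      + (∫ x, ⟪A (V x), a n x • R n x⟫) = ∫ x, q x * ζ n x := by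
    intro n
    have e1 := h.weak (ζ n) (hζt n)
    have e2 := ibpA hs (hζt n) hΨ.smooth
    have e3 : (∫ x, q x * ζ n x) = (∫ x, f x * ζ n x) + ∫ x, dvA A Ψ x * ζ n x := by
      rw [← integral_add (integrable_mul2 h.memf (hζt n).memLp) (integrable_mul2 hΨd (hζt n).memLp)]
      congr 1; ext x; rw [hq]; ring
    have e4 : (∫ x, ⟪A (V x), T n x⟫) + (∫ x, ⟪A (V x), a n x • V x⟫)
      + (∫ x, ⟪A (V x), a n x • R n x⟫) = (∫ x, ⟪A (Z x), gradient (ζ n) x⟫)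
        - ∫ x, ⟪A (gradient Ψ x), gradient (ζ n) x⟫ := by
      rw [← integral_add (integrable_inner hAVm (hTm n)) (integrable_inner hAVm (haV n)),
        ← integral_add (f := fun x => ⟪A (V x), T n x⟫ + ⟪A (V x), a n x • V x⟫)
          ((integrable_inner hAVm (hTm n)).add (integrable_inner hAVm (haV n)))
          (integrable_inner hAVm (haR n)),
        ← integral_sub (integrable_inner (memLp_clm hZ A) (hζt n).memLp_grad)
          (integrable_inner (memLp_clm hΨ.memLp_grad A) (hζt n).memLp_grad)]
      congr 1; ext x
      rw [← inner_sub_left, ← map_sub, hgrad, ← inner_add_right, ← inner_add_right, smul_add, add_assoc]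
    rw [e4, e1, e2, e3]; simp
  have hlow : ∀ n, lam * nrm (fun x => a n x • V x) ^ 2 ≤ ∫ x, ⟪A (V x), a n x • V x⟫ := by
    intro n
    rw [← nrm_sq (haV n), ← integral_const_mul]
    refine integral_mono ((integrable_norm_sq (haV n)).const_mul _) (integrable_inner hAVm (haV n))
      fun x => ?_
    simp only [norm_smul, real_inner_smul_right, Real.norm_eq_abs, mul_pow, sq_abs]
    have := hA (V x)
    have h3 : a n x ^ 2 ≤ a n x := by nlinarith [ha0 n x, ha1 n x]
    have h4 : 0 ≤ lam * ‖V x‖ ^ 2 := by positivity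
    nlinarith [ha0 n x]
  set CV := nrm (fun x => A (V x)) with hCV
  have hup : ∀ n, lam * nrm (fun x => a n x • V x) ^ 2 ≤ (∫ x, q x * ζ n x)
      + CV * (G * nrm (fun x => φ n x - z x)) + CV * nrm (R n) := by
    intro n
    have e1 := abs_integral_inner_le hAVm (hTm n)
    have e2 := abs_integral_inner_le hAVm (haR n)
    have e3 := mul_le_mul_of_nonneg_left (hTnrm n) (nrm_nonneg : 0 ≤ CV)
    have e4 := mul_le_mul_of_nonneg_left (haRn n) (nrm_nonneg : 0 ≤ CV)
    have := key n
    have := hlow n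
    have := neg_abs_le (∫ x, ⟪A (V x), T n x⟫)
    have := neg_abs_le (∫ x, ⟪A (V x), a n x • R n x⟫)
    linarith
  have hlim0 : Tendsto (fun n => nrm (fun x => a n x • V x)) atTop (𝓝 0) := by
    have u1 : Tendsto (fun n => ((∫ x, q x * ζ n x) - (∫ x, q x * ζ' x)
      + CV * (G * nrm (fun x => φ n x - z x)) + CV * nrm (R n)) / lam) atTop (𝓝 0) := by
      have := (((hrhs.sub_const (∫ x, q x * ζ' x)).add ((t1.const_mul G).const_mul CV)).add
        (t2.const_mul CV)).div_const lam
      simpa using this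
    have u2 : Tendsto (fun n => nrm (fun x => a n x • V x) ^ 2) atTop (𝓝 0) := by
      refine squeeze_zero (fun n => sq_nonneg _) (fun n => ?_) u1
      rw [le_div_iff₀ hl]
      have := hup n
      linarith
    have := u2.sqrt
    simpa [Real.sqrt_sq nrm_nonneg] using this
  have hgz : ∀ n, nrm (gradient (ζ n)) ≤ G * nrm (fun x => φ n x - z x)
      + (nrm (fun x => a n x • V x) + nrm (R n)) := by
    intro n
    have e : gradient (ζ n) = fun x => T n x + (a n x • V x + a n x • R n x) := by
      ext1 x; rw [hgrad, smul_add]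
    rw [e]
    refine (nrm_add_le (hTm n) ((haV n).add (haR n))).trans (add_le_add (hTnrm n) ?_)
    exact (nrm_add_le (haV n) (haR n)).trans (add_le_add le_rfl (haRn n))
  have hζz : nrm ζ' = 0 := by
    have b : ∀ n, nrm ζ' ≤ nrm (fun x => ζ n x - ζ' x) + 2 * (G * nrm (fun x => φ n x - z x)
      + (nrm (fun x => a n x • V x) + nrm (R n))) := by
      intro n
      have e : ζ' = fun x => ζ n x - (ζ n x - ζ' x) := by ext; ring
      have := poincare hd ((hζt n).mono hU)
      calc nrm ζ' = nrm (fun x => ζ n x - (ζ n x - ζ' x)) := by rw [← e]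
        _ ≤ nrm (ζ n) + nrm (fun x => ζ n x - ζ' x) := nrm_sub_le (hζt n).memLp ((hζt n).memLp.sub hζ'm)
        _ ≤ _ := by linarith [hgz n]
    have lim : Tendsto (fun n => nrm (fun x => ζ n x - ζ' x) + 2 * (G * nrm (fun x => φ n x - z x)
      + (nrm (fun x => a n x • V x) + nrm (R n)))) atTop (𝓝 0) := by
      have := hζlim.add ((((t1.const_mul G).add (hlim0.add t2))).const_mul 2)
      simpa using this
    exact le_antisymm (ge_of_tendsto' lim b) nrm_nonneg
  filter_upwards [nrm_zero_ae hζ'm hζz] with x hx _ hθx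
  by_contra hh
  push Not at hh
  have : 0 < ζ' x := mul_pos (bet_pos (by linarith)) hθx
  simp at hx
  linarith

end W11

end

section

namespace W11
variable {d : ℕ}

/-! ### One-dimensional profile -/

noncomputable def gam (d : ℕ) (s : ℝ) : ℝ := s ^ (-(d:ℝ)/2) * Real.smoothTransition (2 * s - 1)

lemma gam_zero {s : ℝ} (hs : s ≤ 1/2) : gam d s = 0 := by
  rw [gam, Real.smoothTransition.zero_of_nonpos (by linarith), mul_zero]

lemma gam_nonneg (s : ℝ) : 0 ≤ gam d s := by
  rcases le_total s (1/2) with h | h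
  · rw [gam_zero h]
  · exact mul_nonneg (Real.rpow_nonneg (by linarith) _) (Real.smoothTransition.nonneg _)

lemma gam_le {s : ℝ} (hs : 0 < s) : gam d s ≤ s ^ (-(d:ℝ)/2) :=
  mul_le_of_le_one_right (Real.rpow_nonneg hs.le _) (Real.smoothTransition.le_one _)

lemma gam_smooth : ContDiff ℝ (⊤ : ℕ∞) (gam d) := by
  rw [contDiff_iff_contDiffAt]
  intro s
  rcases lt_or_ge s (1/2) with h | h
  · have : gam d =ᶠ[𝓝 s] fun _ => 0 := by
      filter_upwards [Iio_mem_nhds h] with t ht using gam_zero (le_of_lt ht)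
    exact contDiffAt_const.congr_of_eventuallyEq this
  · refine (Real.contDiffAt_rpow_const_of_ne (by linarith)).mul ?_
    exact (Real.smoothTransition.contDiff.comp
      ((contDiff_const.mul contDiff_id).sub contDiff_const)).contDiffAt

noncomputable def kap (d : ℕ) (s : ℝ) : ℝ := 4 * s * deriv (gam d) s + 2 * d * gam d s

lemma kap_smooth : ContDiff ℝ (⊤ : ℕ∞) (kap d) := by
  have : ContDiff ℝ (⊤ : ℕ∞) (deriv (gam d)) := (contDiff_infty_iff_deriv.mp gam_smooth).2
  exact ((contDiff_const.mul contDiff_id).mul this).add (contDiff_const.mul gam_smooth)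

lemma kap_zero {s : ℝ} (hs : s < 1/2) : kap d s = 0 := by
  have : gam d =ᶠ[𝓝 s] fun _ => 0 := by
    filter_upwards [Iio_mem_nhds hs] with t ht using gam_zero (le_of_lt ht)
  rw [kap, this.deriv_eq, gam_zero hs.le]; simp

lemma kap_eq {s : ℝ} (hs : 0 < s) :
    kap d s = 8 * s ^ (1 - (d:ℝ)/2) * deriv Real.smoothTransition (2 * s - 1) := by
  have h1 : HasDerivAt (fun t : ℝ => t ^ (-(d:ℝ)/2)) (-(d:ℝ)/2 * s ^ (-(d:ℝ)/2 - 1)) s :=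
    Real.hasDerivAt_rpow_const (Or.inl hs.ne')
  have h2 : HasDerivAt (fun t : ℝ => Real.smoothTransition (2 * t - 1))
      (deriv Real.smoothTransition (2 * s - 1) * 2) s := by
    have h3 : HasDerivAt (fun t : ℝ => 2 * t - 1) 2 s := by
      simpa using ((hasDerivAt_id s).const_mul 2).sub_const 1
    exact HasDerivAt.comp s (h₂ := Real.smoothTransition) (h := fun t : ℝ => 2 * t - 1)
      ((Real.smoothTransition.contDiff (n := 1)).differentiable (by simp) _).hasDerivAt h3
  have h3 := (h1.mul h2).deriv
  have h3' : deriv (gam d) s = _ := h3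
  rw [kap, h3', gam]
  have e1 : s ^ (-(d:ℝ)/2) = s * s ^ (-(d:ℝ)/2 - 1) := by
    nth_rewrite 2 [← Real.rpow_one s]
    rw [← Real.rpow_add hs]; congr 1; ring
  have e2 : s ^ (1 - (d:ℝ)/2) = s * (s * s ^ (-(d:ℝ)/2 - 1)) := by
    rw [← e1]
    nth_rewrite 2 [← Real.rpow_one s]
    rw [← Real.rpow_add hs]; congr 1; ring
  rw [e2, e1]; ring

lemma kap_nonneg (s : ℝ) : 0 ≤ kap d s := by
  rcases lt_or_ge s (1/2) with h | h
  · rw [kap_zero h]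
  · rw [kap_eq (by linarith)]
    have := Real.smoothTransition.monotone.deriv_nonneg (x := 2 * s - 1)
    have := Real.rpow_nonneg (show 0 ≤ s by linarith) (1 - (d:ℝ)/2)
    positivity

lemma kap_zero' {s : ℝ} (hs : 1 < s) : kap d s = 0 := by
  rw [kap_eq (by linarith)]
  have : Real.smoothTransition =ᶠ[𝓝 (2 * s - 1)] fun _ => 1 := by
    filter_upwards [Ioi_mem_nhds (show 1 < 2 * s - 1 by linarith)] with t ht
      using Real.smoothTransition.one_of_one_le (le_of_lt ht)
  rw [this.deriv_eq]; simp

lemma kap_cpt : HasCompactSupport (kap d) := by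
  refine HasCompactSupport.intro (isCompact_Icc (a := (1/2:ℝ)) (b := 1)) fun s hs => ?_
  rw [Set.mem_Icc, not_and_or] at hs
  rcases hs with h | h
  · exact kap_zero (by linarith)
  · exact kap_zero' (by linarith)

lemma kap_bdd (d : ℕ) : ∃ C, 0 < C ∧ (∀ s, |kap d s| ≤ C) ∧ ∀ s, |deriv (kap d) s| ≤ C := by
  obtain ⟨C1, h1⟩ := kap_cpt.exists_bound_of_continuous (kap_smooth (d := d)).continuous
  obtain ⟨C2, h2⟩ := (kap_cpt (d := d)).deriv.exists_bound_of_continuous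
    (contDiff_infty_iff_deriv.mp kap_smooth).2.continuous
  refine ⟨max 1 (max C1 C2), by positivity, fun s => ?_, fun s => ?_⟩
  · exact (h1 s).trans (by simp)
  · exact (h2 s).trans (by simp)

lemma kap_lower (d : ℕ) (hd : 0 < d) : ∃ s0 δ : ℝ, 1/2 < s0 ∧ s0 < 1 ∧ 0 < δ ∧
    ∀ s, |s - s0| < δ → 2 ≤ kap d s := by
  obtain ⟨ξ, hξ, h1⟩ := exists_deriv_eq_slope Real.smoothTransition zero_lt_one
    Real.smoothTransition.continuous.continuousOn
    ((Real.smoothTransition.contDiff (n := 1)).differentiable (by simp)).differentiableOn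
  simp only [Real.smoothTransition.zero, Real.smoothTransition.one, sub_zero, div_one] at h1
  have hs0 : (1:ℝ)/2 < (ξ + 1)/2 := by linarith [hξ.1]
  have hs1 : (ξ + 1)/2 < 1 := by linarith [hξ.2]
  have : 2 < kap d ((ξ + 1)/2) := by
    rw [kap_eq (by linarith), show 2 * ((ξ + 1)/2) - 1 = ξ by ring, h1, mul_one]
    have h2 : 1/2 < ((ξ + 1)/2) ^ (1 - (d:ℝ)/2) := by
      calc (1:ℝ)/2 < ((ξ+1)/2) ^ (1:ℝ) := by rw [Real.rpow_one]; exact hs0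
        _ ≤ _ := Real.rpow_le_rpow_of_exponent_ge (by linarith) hs1.le (by
          have : (0:ℝ) ≤ d := by positivity
          linarith)
    linarith
  have hc := (kap_smooth (d := d)).continuous.continuousAt.eventually (lt_mem_nhds this)
  obtain ⟨δ, hδ, h⟩ := Metric.eventually_nhds_iff.mp hc
  exact ⟨_, δ, hs0, hs1, hδ, fun s hs => (h (by rwa [Real.dist_eq])).le⟩

/-! ### The quadratic form -/

structure Ell (A : Euc d →L[ℝ] Euc d) (lam Lam : ℝ) : Prop where
  pos : 0 < lam
  posL : 0 < Lam
  sym : ∀ x y, ⟪A x, y⟫ = ⟪x, A y⟫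
  coer : ∀ ξ, lam * ‖ξ‖ ^ 2 ≤ ⟪A ξ, ξ⟫
  bdd : ∀ ξ, ‖A ξ‖ ≤ Lam * ‖ξ‖

noncomputable def Qi (A : Euc d →L[ℝ] Euc d) : Euc d →L[ℝ] Euc d := ContinuousLinearMap.inverse A

section ell
variable {A : Euc d →L[ℝ] Euc d} {lam Lam : ℝ}

lemma Ell.A_Qi (h : Ell A lam Lam) (z : Euc d) : A (Qi A z) = z := by
  have hinj : Function.Injective (A : Euc d →ₗ[ℝ] Euc d) := by
    rw [← LinearMap.ker_eq_bot, LinearMap.ker_eq_bot']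
    intro m hm
    have h1 := h.coer m
    have hm' : A m = 0 := hm
    rw [hm', inner_zero_left] at h1
    have h2 : ‖m‖ ^ 2 ≤ 0 := by nlinarith [h.pos]
    have h3 : ‖m‖ = 0 := by nlinarith [norm_nonneg m]
    exact norm_eq_zero.mp h3
  let e := (LinearEquiv.ofInjectiveEndo (A : Euc d →ₗ[ℝ] Euc d) hinj).toContinuousLinearEquiv
  have he : (e : Euc d →L[ℝ] Euc d) = A := by ext1 x; rfl
  have : Qi A = (e.symm : Euc d →L[ℝ] Euc d) := by
    rw [Qi, ← he, ContinuousLinearMap.inverse_equiv]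
  rw [this]
  conv_lhs => rw [← he]
  exact e.apply_symm_apply z

lemma Ell.Qi_sym (h : Ell A lam Lam) (x y : Euc d) : ⟪Qi A x, y⟫ = ⟪x, Qi A y⟫ := by
  conv_lhs => rw [← h.A_Qi y]
  conv_rhs => rw [← h.A_Qi x]
  rw [h.sym]

lemma Ell.Qi_norm (h : Ell A lam Lam) (z : Euc d) : ‖Qi A z‖ ≤ ‖z‖ / lam := by
  have h1 := h.coer (Qi A z)
  rw [h.A_Qi] at h1
  have h2 := real_inner_le_norm z (Qi A z)
  rw [le_div_iff₀ h.pos]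
  rcases (norm_nonneg (Qi A z)).eq_or_lt with h3 | h3
  · rw [← h3]; simp
  · nlinarith

noncomputable def qf (A : Euc d →L[ℝ] Euc d) (z : Euc d) : ℝ := ⟪Qi A z, z⟫

lemma Ell.qf_le (h : Ell A lam Lam) (z : Euc d) : qf A z ≤ ‖z‖ ^ 2 / lam := by
  have := real_inner_le_norm (Qi A z) z
  have h2 := mul_le_mul_of_nonneg_right (h.Qi_norm z) (norm_nonneg z)
  calc _ ≤ _ := this.trans h2
    _ = _ := by ring

lemma Ell.le_qf (h : Ell A lam Lam) (z : Euc d) : lam / Lam ^ 2 * ‖z‖ ^ 2 ≤ qf A z := by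
  have h1 := h.coer (Qi A z)
  rw [h.A_Qi, real_inner_comm] at h1
  have h2 := h.bdd (Qi A z)
  rw [h.A_Qi] at h2
  have h3 : ‖z‖ ^ 2 ≤ Lam ^ 2 * ‖Qi A z‖ ^ 2 := by
    rw [← mul_pow]; exact pow_le_pow_left₀ (norm_nonneg _) h2 2
  have := h.pos; have := h.posL
  calc lam / Lam ^ 2 * ‖z‖ ^ 2 ≤ lam / Lam ^ 2 * (Lam ^ 2 * ‖Qi A z‖ ^ 2) := by gcongr
    _ = lam * ‖Qi A z‖ ^ 2 := by field_simp
    _ ≤ _ := h1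

lemma Ell.qf_nonneg (h : Ell A lam Lam) (z : Euc d) : 0 ≤ qf A z :=
  le_trans (by have := h.pos; positivity) (h.le_qf z)

lemma qf_smooth : ContDiff ℝ (⊤ : ℕ∞) (qf A) :=
  (Qi A).contDiff.inner ℝ contDiff_id

lemma qf_smul (c : ℝ) (z : Euc d) : qf A (c • z) = c ^ 2 * qf A z := by
  simp only [qf, map_smul, real_inner_smul_left, real_inner_smul_right]; ring

lemma Ell.qf_deriv (h : Ell A lam Lam) (x y : Euc d) :
    HasFDerivAt (fun y => qf A (y - x)) (2 • innerSL ℝ (Qi A (y - x))) y := by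
  have h0 : HasFDerivAt (fun y : Euc d => y - x) (ContinuousLinearMap.id ℝ (Euc d)) y :=
    (hasFDerivAt_id y).sub_const x
  have h1 : HasFDerivAt (fun y : Euc d => Qi A (y - x)) ((Qi A).comp (ContinuousLinearMap.id ℝ (Euc d))) y :=
    (Qi A).hasFDerivAt.comp y h0
  have := h1.inner ℝ h0
  refine this.congr_fderiv ?_
  ext e
  have := h.Qi_sym e (y - x)
  simp only [fderivInnerCLM_apply, ContinuousLinearMap.comp_apply, ContinuousLinearMap.prod_apply,
    ContinuousLinearMap.id_apply, ContinuousLinearMap.smul_apply, innerSL_apply_apply, nsmul_eq_mul,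
    Nat.cast_ofNat]
  rw [this, real_inner_comm (Qi A (y-x)) e]; ring

/-- First derivative of a radial function. -/
lemma Ell.pd_radial (h : Ell A lam Lam) {G : ℝ → ℝ} (hG : Differentiable ℝ G) (x e y : Euc d) :
    pd e (fun y => G (qf A (y - x))) y = 2 * deriv G (qf A (y - x)) * ⟪Qi A (y - x), e⟫ := by
  have := (hG (qf A (y - x))).hasDerivAt.comp_hasFDerivAt y (h.qf_deriv x y)
  have e1 : fderiv ℝ (fun y => G (qf A (y - x))) y = _ := this.fderiv
  rw [pd, e1]
  simp only [ContinuousLinearMap.smul_apply, innerSL_apply_apply, smul_eq_mul, nsmul_eq_mul, Nat.cast_ofNat]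
  ring

lemma Ell.dvA_radial (h : Ell A lam Lam) {G : ℝ → ℝ} (hG : ContDiff ℝ (⊤ : ℕ∞) G) (x y : Euc d) :
    dvA A (fun y => G (qf A (y - x))) y =
      4 * qf A (y - x) * deriv (deriv G) (qf A (y - x)) + 2 * d * deriv G (qf A (y - x)) := by
  have hG' : ContDiff ℝ (⊤ : ℕ∞) (deriv G) := (contDiff_infty_iff_deriv.mp hG).2
  have h1 : ∀ i, pd (A (bv i)) (fun y => G (qf A (y - x)))
      = fun y => (fun y => deriv G (qf A (y - x))) y * (2 * ⟪y - x, bv i⟫) := by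
    intro i; ext1 y
    rw [h.pd_radial (hG.differentiable (by simp)), ← h.sym, h.A_Qi]; ring
  have h2 : ∀ i : Fin d, pd (bv i) (pd (A (bv i)) (fun y => G (qf A (y - x)))) y =
      4 * deriv (deriv G) (qf A (y - x)) * (⟪Qi A (y - x), bv i⟫ * ⟪bv i, y - x⟫)
        + 2 * deriv G (qf A (y - x)) := by
    intro i
    rw [h1]
    have a1 := ((hG'.differentiable (by simp)) (qf A (y - x))).hasDerivAt.comp_hasFDerivAt y
      (h.qf_deriv x y)
    have a2 : HasFDerivAt (fun y : Euc d => 2 * ⟪y - x, bv i⟫) ((2:ℝ) • innerSL ℝ (bv i)) y := by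
      have : HasFDerivAt (fun y : Euc d => innerSL ℝ (bv i) (y - x)) (innerSL ℝ (bv i)) y :=
        (innerSL ℝ (bv i)).hasFDerivAt.comp y ((hasFDerivAt_id y).sub_const x)
      have := this.const_mul 2
      refine this.congr_of_eventuallyEq (.of_forall fun y => ?_)
      simp [real_inner_comm]
    have e1 : fderiv ℝ (fun y => (fun y => deriv G (qf A (y - x))) y * (2 * ⟪y - x, bv i⟫)) y = _ :=
      (a1.mul a2).fderiv
    rw [pd, e1]
    have : ⟪bv i, bv i⟫ = (1:ℝ) := by simp [bv]
    simp only [ContinuousLinearMap.add_apply, ContinuousLinearMap.smul_apply, innerSL_apply_apply, this,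
      smul_eq_mul, Function.comp, nsmul_eq_mul, Nat.cast_ofNat]
    rw [real_inner_comm (bv i) (y - x)]
    ring
  rw [dvA, Finset.sum_congr rfl fun i _ => h2 i, Finset.sum_add_distrib, ← Finset.mul_sum,
    (EuclideanSpace.basisFun (Fin d) ℝ).sum_inner_mul_inner]
  simp [qf]; ring

end ell
end W11

end

section

namespace W11
variable {d : ℕ}

noncomputable def gme (d : ℕ) (ε s : ℝ) : ℝ := (ε ^ d)⁻¹ * gam d (s / ε ^ 2)

noncomputable def kk (A : Euc d →L[ℝ] Euc d) (ε : ℝ) (z : Euc d) : ℝ := (ε ^ d)⁻¹ * kap d (qf A z / ε ^ 2)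

noncomputable def GG (d : ℕ) (ε S s : ℝ) : ℝ := ∫ t in s..S, gme d ε t

lemma gme_smooth (ε : ℝ) : ContDiff ℝ (⊤ : ℕ∞) (gme d ε) :=
  contDiff_const.mul (gam_smooth.comp (contDiff_id.div_const _))

lemma gme_nonneg {ε : ℝ} (hε : 0 < ε) (s : ℝ) : 0 ≤ gme d ε s :=
  mul_nonneg (by positivity) (gam_nonneg _)

lemma pow_scale {ε s : ℝ} (hε : 0 < ε) (hs : 0 < s) :
    (ε ^ d)⁻¹ * (s / ε ^ 2) ^ (-(d:ℝ)/2) = s ^ (-(d:ℝ)/2) := by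
  rw [Real.div_rpow hs.le (by positivity)]
  have : (ε ^ 2) ^ (-(d:ℝ)/2) = (ε ^ d)⁻¹ := by
    rw [← Real.rpow_natCast ε 2, ← Real.rpow_mul hε.le, ← Real.rpow_natCast ε d, ← Real.rpow_neg hε.le]
    congr 1; push_cast; ring
  rw [this]
  have : (ε ^ d)⁻¹ ≠ 0 := by positivity
  field_simp

lemma gme_le {ε s : ℝ} (hε : 0 < ε) (hs : 0 < s) : gme d ε s ≤ s ^ (-(d:ℝ)/2) := by
  rw [← pow_scale (d := d) hε hs, gme]
  gcongr
  exact gam_le (by positivity)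

lemma gme_eq {ε s : ℝ} (hε : 0 < ε) (hs : ε ^ 2 ≤ s) : gme d ε s = s ^ (-(d:ℝ)/2) := by
  have hs0 : 0 < s := lt_of_lt_of_le (by positivity) hs
  rw [← pow_scale (d := d) hε hs0, gme, gam, Real.smoothTransition.one_of_one_le, mul_one]
  have : 1 ≤ s / ε ^ 2 := by rwa [one_le_div (by positivity)]
  linarith

lemma GG_deriv (ε S s : ℝ) : HasDerivAt (GG d ε S) (-gme d ε s) s :=
  intervalIntegral.integral_hasDerivAt_left ((gme_smooth ε).continuous.intervalIntegrable _ _)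
    ((gme_smooth ε).continuous.stronglyMeasurableAtFilter _ _)
    (gme_smooth ε).continuous.continuousAt

lemma GG_deriv' (ε S : ℝ) : deriv (GG d ε S) = fun s => -gme d ε s :=
  funext fun s => (GG_deriv ε S s).deriv

lemma GG_smooth (ε S : ℝ) : ContDiff ℝ (⊤ : ℕ∞) (GG d ε S) := by
  rw [contDiff_infty_iff_deriv]
  refine ⟨fun s => (GG_deriv ε S s).differentiableAt, ?_⟩
  rw [GG_deriv']
  exact (gme_smooth ε).neg

lemma gme_deriv (ε s : ℝ) : deriv (gme d ε) s = (ε ^ d)⁻¹ * (deriv (gam d) (s / ε ^ 2) / ε ^ 2) := by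
  have h1 : HasDerivAt (fun s : ℝ => s / ε ^ 2) (1 / ε ^ 2) s := (hasDerivAt_id s).div_const _
  have h2 : HasDerivAt (gam d) (deriv (gam d) (s / ε ^ 2)) (s / ε ^ 2) :=
    (gam_smooth.differentiable (by simp) _).hasDerivAt
  have := (HasDerivAt.comp s h2 h1).const_mul (ε ^ d)⁻¹
  have e : deriv (gme d ε) s = _ := this.deriv
  rw [e]; ring

section ell
variable {A : Euc d →L[ℝ] Euc d} {lam Lam : ℝ}

lemma Ell.dvA_GG (h : Ell A lam Lam) {ε : ℝ} (hε : 0 < ε) (S : ℝ) (x y : Euc d) :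
    dvA A (fun y => GG d ε S (qf A (y - x))) y = - kk A ε (y - x) := by
  rw [h.dvA_radial (GG_smooth ε S)]
  have : deriv (deriv (GG d ε S)) (qf A (y - x)) = - deriv (gme d ε) (qf A (y - x)) := by
    rw [GG_deriv', deriv.fun_neg]
  rw [this, gme_deriv, GG_deriv', kk, kap]
  simp only [gme]
  ring

lemma GG_nonneg {ε S s : ℝ} (hε : 0 < ε) (hs : s ≤ S) : 0 ≤ GG d ε S s :=
  intervalIntegral.integral_nonneg hs fun t _ => gme_nonneg hε t

lemma GG_le {ε S s a : ℝ} (hε : 0 < ε) (ha : 0 < a) (has : a ≤ s) (hs : s ≤ S) :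
    GG d ε S s ≤ S * a ^ (-(d:ℝ)/2) := by
  have h1 : GG d ε S s ≤ ∫ t in s..S, a ^ (-(d:ℝ)/2) := by
    refine intervalIntegral.integral_mono_on hs ((gme_smooth ε).continuous.intervalIntegrable _ _)
      (by simp) fun t ht => ?_
    refine (gme_le hε (by linarith [ht.1])).trans ?_
    exact Real.rpow_le_rpow_of_nonpos ha (by linarith [ht.1]) (by
      have : (0:ℝ) ≤ d := by positivity
      linarith)
  refine h1.trans ?_
  rw [intervalIntegral.integral_const, smul_eq_mul]
  have := Real.rpow_nonneg ha.le (-(d:ℝ)/2)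
  gcongr
  linarith

lemma kk_nonneg {ε : ℝ} (hε : 0 < ε) (z : Euc d) : 0 ≤ kk A ε z :=
  mul_nonneg (by positivity) (kap_nonneg _)

lemma Ell.mu_pos (h : Ell A lam Lam) : 0 < Lam / √lam :=
  div_pos h.posL (Real.sqrt_pos.mpr h.pos)

lemma Ell.norm_le_of_qf (h : Ell A lam Lam) {ε : ℝ} (hε : 0 < ε) {z : Euc d} (hz : qf A z ≤ ε ^ 2) :
    ‖z‖ ≤ Lam / √lam * ε := by
  have h1 := (h.le_qf z).trans hz
  have hp := h.pos; have hp2 := h.posL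
  refine abs_le_of_sq_le_sq' ?_ (by have := h.mu_pos; positivity) |>.2
  rw [mul_pow, div_pow, Real.sq_sqrt hp.le]
  calc ‖z‖ ^ 2 = Lam ^ 2 / lam * (lam / Lam ^ 2 * ‖z‖ ^ 2) := by field_simp
    _ ≤ _ := by gcongr

lemma kk_zero {ε : ℝ} (hε : 0 < ε) {z : Euc d} (hz : ε ^ 2 < qf A z) : kk A ε z = 0 := by
  rw [kk, kap_zero', mul_zero]
  rwa [one_lt_div (by positivity)]

lemma Ell.kk_zero' (h : Ell A lam Lam) {ε : ℝ} (hε : 0 < ε) {z : Euc d} (hz : Lam / √lam * ε < ‖z‖) :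
    kk A ε z = 0 := by
  refine kk_zero hε ?_
  by_contra hh
  exact absurd (h.norm_le_of_qf hε (not_lt.mp hh)) (not_le.mpr hz)

lemma kk_smooth (ε : ℝ) (x : Euc d) : ContDiff ℝ (⊤ : ℕ∞) (fun y => kk A ε (y - x)) :=
  contDiff_const.mul (kap_smooth.comp ((qf_smooth.comp (contDiff_id.sub contDiff_const)).div_const _))

lemma Ell.kk_test (h : Ell A lam Lam) {ε : ℝ} (hε : 0 < ε) (x : Euc d) {U : Set (Euc d)}
    (hU : closedBall x (Lam / √lam * ε) ⊆ U) : Test U (fun y => kk A ε (y - x)) := by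
  have hs : Function.support (fun y => kk A ε (y - x)) ⊆ closedBall x (Lam / √lam * ε) := by
    intro y hy
    by_contra hh
    rw [mem_closedBall, dist_eq_norm, not_le] at hh
    exact hy (h.kk_zero' hε hh)
  exact ⟨kk_smooth ε x, HasCompactSupport.of_support_subset_isCompact (isCompact_closedBall _ _) hs,
    (closure_minimal hs isClosed_closedBall).trans hU⟩

lemma kk_scale {ε : ℝ} (hε : 0 < ε) (z : Euc d) : kk A ε z = (ε ^ d)⁻¹ * kk A 1 (ε⁻¹ • z) := by
  rw [kk, kk, qf_smul]
  have : ε⁻¹ ^ 2 * qf A z / 1 ^ 2 = qf A z / ε ^ 2 := by field_simp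
  rw [this]; simp

noncomputable def cA (A : Euc d →L[ℝ] Euc d) : ℝ := ∫ z, kk A 1 z

lemma integral_kk {ε : ℝ} (hε : 0 < ε) (x : Euc d) : ∫ y, kk A ε (y - x) = cA A := by
  rw [integral_sub_right_eq_self (fun y => kk A ε y) x]
  simp_rw [kk_scale hε]
  rw [integral_const_mul, Measure.integral_comp_inv_smul, cA]
  simp only [finrank_euclideanSpace, Fintype.card_fin, smul_eq_mul]
  rw [abs_of_pos (by positivity)]
  field_simp

/-- volume of the unit ball -/
noncomputable def vd (d : ℕ) : ℝ := volume.real (closedBall (0 : Euc d) 1)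

lemma vol_cb (x : Euc d) {r : ℝ} (hr : 0 ≤ r) : volume.real (closedBall x r) = r ^ d * vd d := by
  rw [vd, measureReal_def, measureReal_def, Measure.addHaar_closedBall' _ _ hr]
  simp [ENNReal.toReal_mul, ENNReal.toReal_ofReal (pow_nonneg hr d), Measure.addHaar_unitClosedBall_eq_addHaar_unitBall]

lemma vd_pos : 0 < vd d := by
  rw [vd, measureReal_def]
  exact ENNReal.toReal_pos (measure_closedBall_pos _ _ one_pos).ne' measure_closedBall_lt_top.ne

lemma cA_lower (d : ℕ) (hd : 0 < d) (lam Lam : ℝ) : ∃ c > 0, ∀ A : Euc d →L[ℝ] Euc d, Ell A lam Lam → c ≤ cA A := by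
  obtain ⟨s0, δ, hs0, hs1, hδ, hk⟩ := kap_lower d hd
  by_cases hlL : 0 < lam ∧ 0 < Lam
  swap
  · exact ⟨1, one_pos, fun A h => absurd ⟨h.pos, h.posL⟩ hlL⟩
  obtain ⟨hl, hL⟩ := hlL
  set μ := Lam / √lam with hμ
  have hμ0 : 0 < μ := div_pos hL (Real.sqrt_pos.mpr hl)
  set η := min 1 (δ * lam / (4 * (μ + 1))) with hη
  have hη0 : 0 < η := by positivity
  refine ⟨2 * (η ^ d * vd d), by have := vd_pos (d := d); positivity, fun A h => ?_⟩
  -- a point on the level set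
  obtain ⟨z0, hz0⟩ : ∃ z0, qf A z0 = s0 := by
    have hne : ((EuclideanSpace.basisFun (Fin d) ℝ) ⟨0, hd⟩ : Euc d) ≠ 0 := by
      intro h0
      have := congrArg norm h0
      simp at this
    set e := ((EuclideanSpace.basisFun (Fin d) ℝ) ⟨0, hd⟩ : Euc d)
    have hq : 0 < qf A e := lt_of_lt_of_le (by
      have := norm_pos_iff.mpr hne
      positivity) (h.le_qf e)
    refine ⟨√(s0 / qf A e) • e, ?_⟩
    rw [qf_smul, Real.sq_sqrt (by positivity)]
    field_simp
  have hz0n : ‖z0‖ ≤ μ := by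
    simpa using h.norm_le_of_qf one_pos (z := z0) (by rw [hz0]; linarith)
  have hlow : ∀ z ∈ closedBall z0 η, 2 ≤ kk A 1 z := by
    intro z hz
    rw [mem_closedBall, dist_eq_norm] at hz
    have e1 : qf A z - s0 = ⟪Qi A (z - z0), z⟫ + ⟪Qi A z0, z - z0⟫ := by
      rw [← hz0]; simp only [qf, map_sub, inner_sub_left, inner_sub_right]; ring
    have hzn : ‖z‖ ≤ μ + 1 := by
      have := norm_add_le (z - z0) z0
      rw [sub_add_cancel] at this
      have : η ≤ 1 := min_le_left _ _
      linarith
    have e2 : |qf A z - s0| ≤ η / lam * (μ + 1) + (μ / lam) * η := by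
      rw [e1]
      refine (abs_add_le _ _).trans (add_le_add ?_ ?_)
      · refine (abs_real_inner_le_norm _ _).trans (mul_le_mul ((h.Qi_norm _).trans ?_) hzn
          (norm_nonneg _) (by positivity))
        gcongr
      · refine (abs_real_inner_le_norm _ _).trans (mul_le_mul ((h.Qi_norm _).trans ?_) hz
          (norm_nonneg _) (by positivity))
        gcongr
    have e3 : |qf A z - s0| < δ := by
      refine lt_of_le_of_lt e2 ?_
      have e4 : η ≤ δ * lam / (4 * (μ + 1)) := min_le_right _ _
      have e5 : η * (4 * (μ + 1)) ≤ δ * lam := by rwa [le_div_iff₀ (by positivity)] at e4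
      have : η / lam * (μ + 1) + (μ / lam) * η ≤ (η * (2 * (μ + 1))) / lam := by
        rw [le_div_iff₀ hl]
        field_simp
        nlinarith
      refine lt_of_le_of_lt this ?_
      rw [div_lt_iff₀ hl]
      nlinarith [mul_pos hδ hl]
    have := hk _ e3
    rw [kk]; simpa using this
  have hintg : Integrable (kk A 1) := by
    have := (h.kk_test one_pos 0 (Set.subset_univ _)).memLp (p := 1)
    rw [memLp_one_iff_integrable] at this
    simpa using this
  calc 2 * (η ^ d * vd d) = ∫ z in closedBall z0 η, (2:ℝ) := by
        rw [setIntegral_const, vol_cb _ hη0.le, smul_eq_mul]; ring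
    _ ≤ ∫ z in closedBall z0 η, kk A 1 z :=
        setIntegral_mono_on (by simp [measure_closedBall_lt_top]) hintg.integrableOn
          measurableSet_closedBall hlow
    _ ≤ ∫ z, kk A 1 z := setIntegral_le_integral hintg (.of_forall fun z => kk_nonneg one_pos z)

/-- bounds for the kernel. -/
lemma kk_bounds (d : ℕ) (lam Lam : ℝ) : ∃ C > 0, ∀ A : Euc d →L[ℝ] Euc d, Ell A lam Lam →
    ∀ ε > 0, (∀ z, |kk A ε z| ≤ C * (ε ^ d)⁻¹) ∧
      ∀ x e y, |pd e (fun y => kk A ε (y - x)) y| ≤ C * (ε ^ d)⁻¹ * ε⁻¹ * ‖e‖ := by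
  obtain ⟨C, hC, h1, h2⟩ := kap_bdd d
  refine ⟨max C (2 * C * (|Lam / √lam| / |lam|)), by positivity, fun A h ε hε => ⟨fun z => ?_, fun x e y => ?_⟩⟩
  · rw [kk, abs_mul, abs_of_pos (by positivity), mul_comm]
    gcongr
    exact (h1 _).trans (le_max_left _ _)
  · have hG : ContDiff ℝ (⊤ : ℕ∞) (fun s : ℝ => (ε ^ d)⁻¹ * kap d (s / ε ^ 2)) :=
      contDiff_const.mul (kap_smooth.comp (contDiff_id.div_const _))
    have e1 := h.pd_radial (hG.differentiable (by simp)) x e y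
    have e2 : deriv (fun s : ℝ => (ε ^ d)⁻¹ * kap d (s / ε ^ 2)) (qf A (y - x)) =
        (ε ^ d)⁻¹ * (deriv (kap d) (qf A (y - x) / ε ^ 2) / ε ^ 2) := by
      have g1 : HasDerivAt (fun s : ℝ => s / ε ^ 2) (1 / ε ^ 2) (qf A (y - x)) :=
        (hasDerivAt_id _).div_const _
      have g2 : HasDerivAt (kap d) (deriv (kap d) (qf A (y - x) / ε ^ 2)) (qf A (y - x) / ε ^ 2) :=
        (kap_smooth.differentiable (by simp) _).hasDerivAt
      have := (HasDerivAt.comp (qf A (y - x)) (h := fun s : ℝ => s / ε ^ 2) g2 g1).const_mul (ε ^ d)⁻¹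
      have e : deriv (fun s : ℝ => (ε ^ d)⁻¹ * kap d (s / ε ^ 2)) (qf A (y - x)) = _ := this.deriv
      rw [e]; ring
    have e3 : pd e (fun y => kk A ε (y - x)) y = _ := e1
    rw [e3, e2]
    have hl := h.pos
    have hμ := h.mu_pos
    by_cases hq : qf A (y - x) ≤ ε ^ 2
    · have hn := h.norm_le_of_qf hε hq
      have hQ := (h.Qi_norm (y - x)).trans (div_le_div_of_nonneg_right hn hl.le)
      have hin : |⟪Qi A (y - x), e⟫| ≤ (Lam / √lam * ε / lam) * ‖e‖ :=
        (abs_real_inner_le_norm _ _).trans (by gcongr)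
      rw [abs_mul, abs_mul, abs_mul, abs_div, abs_of_pos (show (0:ℝ) < 2 by norm_num),
        abs_of_pos (show (0:ℝ) < (ε ^ d)⁻¹ by positivity), abs_of_pos (show (0:ℝ) < ε ^ 2 by positivity)]
      calc 2 * ((ε ^ d)⁻¹ * (|deriv (kap d) (qf A (y - x) / ε ^ 2)| / ε ^ 2)) * |⟪Qi A (y - x), e⟫|
          ≤ 2 * ((ε ^ d)⁻¹ * (C / ε ^ 2)) * ((Lam / √lam * ε / lam) * ‖e‖) := by
            gcongr; exact h2 _
        _ = (2 * C * (|Lam / √lam| / |lam|)) * (ε ^ d)⁻¹ * ε⁻¹ * ‖e‖ := by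
            rw [abs_of_pos hμ, abs_of_pos hl]; field_simp
        _ ≤ _ := by gcongr; exact le_max_right _ _
    · have : deriv (kap d) (qf A (y - x) / ε ^ 2) = 0 := by
        have hq' : 1 < qf A (y - x) / ε ^ 2 := by
          rw [one_lt_div (by positivity)]; linarith
        have : kap d =ᶠ[𝓝 (qf A (y - x) / ε ^ 2)] fun _ => 0 := by
          filter_upwards [Ioi_mem_nhds hq'] with t ht using kap_zero' ht
        rw [this.deriv_eq]; simp
      rw [this]; simp; positivity

end ell
end W11

end

section

namespace W11
variable {d : ℕ}

/-- Lebesgue point property with respect to the kernel -/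
def LPt (A : Euc d →L[ℝ] Euc d) (h : Euc d → ℝ) (x : Euc d) : Prop :=
  Tendsto (fun ε => ∫ y, h y * kk A ε (y - x)) (𝓝[>] 0) (𝓝 (cA A * h x))

section ell
variable {A : Euc d →L[ℝ] Euc d} {lam Lam : ℝ}

lemma Ell.ae_LPt (hE : Ell A lam Lam) {h : Euc d → ℝ} (hh : MemLp h 2) : ∀ᵐ x, LPt A h x := by
  have hloc : LocallyIntegrable h := hh.locallyIntegrable (by norm_num)
  obtain ⟨C, hC, hk⟩ := kk_bounds d lam Lam
  set μ := Lam / √lam with hμ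
  have hμ0 : 0 < μ := hE.mu_pos
  filter_upwards [IsUnifLocDoublingMeasure.ae_tendsto_average_norm_sub volume hloc 1] with x hx
  have hδ : Tendsto (fun ε : ℝ => μ * ε) (𝓝[>] 0) (𝓝[>] 0) := by
    refine tendsto_nhdsWithin_iff.mpr ⟨?_, ?_⟩
    · have : Tendsto (fun ε : ℝ => μ * ε) (𝓝 0) (𝓝 (μ * 0)) := tendsto_id.const_mul μ
      rw [mul_zero] at this
      exact this.mono_left nhdsWithin_le_nhds
    · filter_upwards [self_mem_nhdsWithin] with ε hε
      exact mul_pos hμ0 hε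
  have h1 := hx (fun _ : ℝ => x) (fun ε => μ * ε) hδ (by
    filter_upwards [self_mem_nhdsWithin] with ε hε
    simp only [one_mul]
    exact mem_closedBall_self (mul_pos hμ0 hε).le)
  rw [LPt, tendsto_iff_norm_sub_tendsto_zero]
  have h2 := h1.const_mul (C * (μ ^ d * vd d))
  rw [mul_zero] at h2
  refine squeeze_zero' (.of_forall fun _ => norm_nonneg _) ?_ h2
  filter_upwards [self_mem_nhdsWithin] with ε hε
  have hε : 0 < ε := hε
  have ht : Test Set.univ (fun y => kk A ε (y - x)) := hE.kk_test hε x (Set.subset_univ _)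
  have hti : Integrable (fun y => kk A ε (y - x)) := memLp_one_iff_integrable.mp ht.memLp
  have e1 : (∫ y, h y * kk A ε (y - x)) - cA A * h x = ∫ y, (h y - h x) * kk A ε (y - x) := by
    rw [← integral_kk (A := A) hε x, ← integral_mul_const, ← integral_sub (integrable_mul2 hh ht.memLp)
      (hti.mul_const _)]
    congr 1; ext y; ring
  have hfin : volume (closedBall x (μ * ε)) ≠ ∞ := measure_closedBall_lt_top.ne
  have hIn : IntegrableOn (fun y => ‖h y - h x‖) (closedBall x (μ * ε)) :=
    ((hloc.integrableOn_isCompact (isCompact_closedBall _ _)).sub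
      (integrableOn_const hfin)).norm
  have e2 : ‖∫ y, (h y - h x) * kk A ε (y - x)‖ ≤
      ∫ y in closedBall x (μ * ε), (C * (ε ^ d)⁻¹) * ‖h y - h x‖ := by
    have e3 : (∫ y, (h y - h x) * kk A ε (y - x)) =
        ∫ y in closedBall x (μ * ε), (h y - h x) * kk A ε (y - x) := by
      rw [setIntegral_eq_integral_of_forall_compl_eq_zero]
      intro y hy
      rw [mem_closedBall, dist_eq_norm, not_le] at hy
      rw [hE.kk_zero' hε hy, mul_zero]
    rw [e3]
    refine norm_integral_le_of_norm_le (hIn.const_mul _) (.of_forall fun y => ?_)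
    rw [norm_mul, mul_comm]
    gcongr
    exact (hk A hE ε hε).1 _
  rw [e1]
  refine e2.trans (le_of_eq ?_)
  rw [integral_const_mul, setAverage_eq, vol_cb _ (by positivity), smul_eq_mul, mul_pow]
  have := vd_pos (d := d)
  field_simp

lemma Ell.mean_value (hE : Ell A lam Lam) {h : Euc d → ℝ} (hh : MemLp h 2) {x : Euc d}
    (hx : LPt A h x) {ρ : ℝ} (hw : ∀ ψ, Test (ball x ρ) ψ → ∫ y, h y * dvA A ψ y = 0) {ε : ℝ}
    (hε : 0 < ε) (hερ : Lam / √lam * ε < ρ) : ∫ y, h y * kk A ε (y - x) = cA A * h x := by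
  have key : ∀ ε', 0 < ε' → ε' < ε → ∫ y, h y * kk A ε' (y - x) = ∫ y, h y * kk A ε (y - x) := by
    intro ε' h0 h1
    set ψ : Euc d → ℝ := fun y => GG d ε (ε ^ 2) (qf A (y - x)) + -1 * GG d ε' (ε ^ 2) (qf A (y - x)) with hψ
    have s1 : ∀ δ, ContDiff ℝ (⊤ : ℕ∞) (fun y => GG d δ (ε ^ 2) (qf A (y - x))) := fun δ =>
      (GG_smooth δ _).comp (qf_smooth.comp (contDiff_id.sub contDiff_const))
    have hG : ContDiff ℝ (⊤ : ℕ∞) (fun s => GG d ε (ε ^ 2) s + -1 * GG d ε' (ε ^ 2) s) :=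
      (GG_smooth _ _).add (contDiff_const.mul (GG_smooth _ _))
    have hzero : ∀ y, ε ^ 2 ≤ qf A (y - x) → ψ y = 0 := by
      intro y hy
      have : GG d ε (ε ^ 2) (qf A (y - x)) = GG d ε' (ε ^ 2) (qf A (y - x)) := by
        refine intervalIntegral.integral_congr fun t ht => ?_
        rw [Set.uIcc_of_ge hy] at ht
        have : ε' ^ 2 ≤ ε ^ 2 := by gcongr
        change gme d ε t = gme d ε' t
        rw [gme_eq hε ht.1, gme_eq h0 (this.trans ht.1)]
      rw [hψ]; simp only [this]; ring
    have hsupp : Function.support ψ ⊆ closedBall x (Lam / √lam * ε) := by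
      intro y hy
      rw [mem_closedBall, dist_eq_norm]
      refine hE.norm_le_of_qf hε ?_
      by_contra hc
      exact hy (hzero y (by linarith))
    have ht : Test (ball x ρ) ψ := by
      refine ⟨hG.comp (qf_smooth.comp (contDiff_id.sub contDiff_const)), HasCompactSupport.of_support_subset_isCompact
        (isCompact_closedBall _ _) hsupp, (closure_minimal hsupp isClosed_closedBall).trans ?_⟩
      exact closedBall_subset_ball hερ
    have hdv : ∀ y, dvA A ψ y = kk A ε' (y - x) - kk A ε (y - x) := by
      intro y
      have a1 := hE.dvA_radial hG x y
      have a2 := hE.dvA_GG hε (ε ^ 2) x y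
      have a3 := hE.dvA_GG h0 (ε ^ 2) x y
      rw [hE.dvA_radial (GG_smooth _ _)] at a2 a3
      have d1 : deriv (fun s => GG d ε (ε ^ 2) s + -1 * GG d ε' (ε ^ 2) s) =
          fun s => deriv (GG d ε (ε ^ 2)) s + -1 * deriv (GG d ε' (ε ^ 2)) s := by
        ext s
        exact ((GG_deriv ε _ s).differentiableAt.hasDerivAt.add
          ((GG_deriv ε' _ s).differentiableAt.hasDerivAt.const_mul (-1))).deriv
      have hd' : ∀ δ : ℝ, Differentiable ℝ (deriv (GG d δ (ε ^ 2))) := fun δ =>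
        (contDiff_infty_iff_deriv.mp (GG_smooth _ _)).2.differentiable (by simp)
      have d2 : deriv (deriv (fun s => GG d ε (ε ^ 2) s + -1 * GG d ε' (ε ^ 2) s)) (qf A (y - x)) =
          deriv (deriv (GG d ε (ε ^ 2))) (qf A (y - x)) + -1 * deriv (deriv (GG d ε' (ε ^ 2))) (qf A (y - x)) := by
        rw [d1]
        exact ((hd' ε _).hasDerivAt.add ((hd' ε' _).hasDerivAt.const_mul (-1))).deriv
      have a1' : dvA A ψ y = _ := a1
      rw [a1', d2, d1]
      simp only
      linarith
    have := hw ψ ht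
    have t1 : ∀ δ > 0, MemLp (fun y => kk A δ (y - x)) 2 := fun δ hδ =>
      (hE.kk_test hδ x (Set.subset_univ _)).memLp
    simp_rw [hdv, mul_sub] at this
    rw [integral_sub (integrable_mul2 hh (t1 _ h0)) (integrable_mul2 hh (t1 _ hε))] at this
    linarith
  refine tendsto_nhds_unique (f := fun ε' => ∫ y, h y * kk A ε' (y - x)) (l := 𝓝[>] 0) ?_ hx
  refine Tendsto.congr' ?_ tendsto_const_nhds
  filter_upwards [Ioo_mem_nhdsGT hε] with ε' hε'
  exact (key ε' hε'.1 hε'.2).symm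

/-- Interior gradient estimate. -/
theorem grad_est (d : ℕ) (hd : 0 < d) (lam Lam : ℝ) : ∃ C > 0, ∀ A : Euc d →L[ℝ] Euc d, Ell A lam Lam →
    ∀ U z Z, W0 U z Z → ∀ᵐ x, ∀ ρ > 0, ∀ M ≥ 0,
      (∀ ψ, Test (ball x ρ) ψ → ∫ y, ⟪A (Z y), gradient ψ y⟫ = 0) →
      (∀ᵐ y, y ∈ ball x ρ → |z y| ≤ M) → ‖Z x‖ ≤ C * M / ρ := by
  obtain ⟨C, hC, hk⟩ := kk_bounds d lam Lam
  obtain ⟨c, hc, hcA⟩ := cA_lower d hd lam Lam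
  set μ := Lam / √lam with hμ
  have hvd := vd_pos (d := d)
  refine ⟨(d : ℝ) * (C * (|μ| ^ d * vd d) * (2 * |μ|)) / c + 1, by positivity, fun A hE U z Z hW => ?_⟩
  have hμ0 : 0 < μ := hE.mu_pos
  have hZi : ∀ i : Fin d, MemLp (fun y => ⟪Z y, bv i⟫) 2 := fun i => by
    refine MemLp.of_le hW.memg (hW.memg.1.inner aestronglyMeasurable_const) (.of_forall fun y => ?_)
    refine (norm_inner_le_norm (𝕜 := ℝ) _ _).trans ?_
    simp [bv]
  have := ae_all_iff.mpr fun i => hE.ae_LPt (hZi i)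
  filter_upwards [this] with x hx ρ hρ M hM hw hz
  set ε := ρ / (2 * μ) with hε
  have hε0 : 0 < ε := by positivity
  have hμε : μ * ε = ρ / 2 := by rw [hε]; field_simp
  have hερ : μ * ε < ρ := by linarith
  have hi : ∀ i : Fin d, |⟪Z x, bv i⟫| ≤ (C * (μ ^ d * vd d) * (2 * μ)) / c * M / ρ := by
    intro i
    have hmv := hE.mean_value (hZi i) (hx i) (ρ := ρ) (fun ψ hψ => by
      have a1 := hW.ibp ((hψ.dvA A).mono (Set.subset_univ _)) (bv i)
      rw [a1, pd_dvA hψ.smooth]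
      have a2 := hW.ibpA hE.sym ((hψ.pd (bv i)).mono (Set.subset_univ _))
      rw [← a2]
      exact hw _ (hψ.pd (bv i))) hε0 hερ
    have ht : Test Set.univ (fun y => kk A ε (y - x)) := hE.kk_test hε0 x (Set.subset_univ _)
    rw [hW.ibp ht] at hmv
    have hpdz : ∀ y, y ∉ closedBall x (μ * ε) → pd (bv i) (fun y => kk A ε (y - x)) y = 0 := by
      intro y hy
      have := ((hE.kk_test hε0 x (U := closedBall x (μ * ε)) le_rfl).pd (bv i)).zero_off hy
      exact this
    have e3 : (∫ y, z y * pd (bv i) (fun y => kk A ε (y - x)) y) =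
        ∫ y in closedBall x (μ * ε), z y * pd (bv i) (fun y => kk A ε (y - x)) y := by
      rw [setIntegral_eq_integral_of_forall_compl_eq_zero]
      intro y hy
      rw [hpdz y hy, mul_zero]
    have hfin : volume (closedBall x (μ * ε)) < ∞ := measure_closedBall_lt_top
    have e4 : ‖∫ y in closedBall x (μ * ε), z y * pd (bv i) (fun y => kk A ε (y - x)) y‖ ≤
        (M * (C * (ε ^ d)⁻¹ * ε⁻¹)) * volume.real (closedBall x (μ * ε)) := by
      refine norm_setIntegral_le_of_norm_le_const_ae' hfin ?_
      filter_upwards [hz] with y hy hyb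
      rw [norm_mul, Real.norm_eq_abs, Real.norm_eq_abs]
      refine mul_le_mul (hy (closedBall_subset_ball hερ hyb)) ?_ (abs_nonneg _) hM
      have := (hk A hE ε hε0).2 x (bv i) y
      simpa [bv] using this
    rw [vol_cb _ (by positivity)] at e4
    have e5 : cA A * |⟪Z x, bv i⟫| ≤ M * (C * (ε ^ d)⁻¹ * ε⁻¹) * ((μ * ε) ^ d * vd d) := by
      have hcp : 0 < cA A := hc.trans_le (hcA A hE)
      calc cA A * |⟪Z x, bv i⟫| = |cA A * ⟪Z x, bv i⟫| := by rw [abs_mul, abs_of_pos hcp]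
        _ ≤ _ := by rw [← hmv, abs_neg, e3]; exact e4
    have e6 : M * (C * (ε ^ d)⁻¹ * ε⁻¹) * ((μ * ε) ^ d * vd d) = M * C * (μ ^ d * vd d) * (2 * μ) / ρ := by
      have : ε⁻¹ = 2 * μ / ρ := by rw [hε, inv_div]
      rw [mul_pow, this]; field_simp
    rw [e6] at e5
    have e7 := (mul_le_mul_of_nonneg_right (hcA A hE) (abs_nonneg _)).trans e5
    rw [← le_div_iff₀' hc] at e7
    refine e7.trans (le_of_eq ?_)
    field_simp
  have hsum : ‖Z x‖ ≤ ∑ i, |⟪Z x, bv i⟫| := by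
    conv_lhs => rw [← (EuclideanSpace.basisFun (Fin d) ℝ).sum_repr' (Z x)]
    refine (norm_sum_le _ _).trans (Finset.sum_le_sum fun i _ => ?_)
    rw [norm_smul, real_inner_comm]
    simp [bv]
  refine hsum.trans ((Finset.sum_le_sum fun i _ => hi i).trans ?_)
  rw [Finset.sum_const, Finset.card_univ, Fintype.card_fin, nsmul_eq_mul, abs_of_pos hμ0]
  have : 0 ≤ M / ρ := by positivity
  calc (d:ℝ) * ((C * (μ ^ d * vd d) * (2 * μ)) / c * M / ρ)
      = ((d:ℝ) * (C * (μ ^ d * vd d) * (2 * μ)) / c) * (M / ρ) := by ring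
    _ ≤ ((d:ℝ) * (C * (μ ^ d * vd d) * (2 * μ)) / c + 1) * (M / ρ) := by gcongr; linarith
    _ = _ := by ring

end ell
end W11

end

section

namespace W11
variable {d : ℕ}

lemma exists_bump (c : Euc d) {a b : ℝ} (ha : 0 < a) (hab : a < b) : ∃ χ : Euc d → ℝ,
    Test Set.univ χ ∧ (∀ x, 0 ≤ χ x) ∧ (∀ x, χ x ≤ 1) ∧ (∀ x ∈ closedBall c a, χ x = 1) ∧
    (∀ x, x ∉ ball c b → χ x = 0) ∧ (∀ x, gradient χ x ≠ 0 → a ≤ dist x c ∧ dist x c ≤ b) ∧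
    Test (closedBall c b) χ := by
  let f : ContDiffBump c := ⟨a, b, ha, hab⟩
  have ht : Test (closedBall c b) f := ⟨f.contDiff, f.hasCompactSupport, f.tsupport_eq.le⟩
  refine ⟨f, ht.mono (Set.subset_univ _), fun x => f.nonneg, fun x => f.le_one,
    fun x hx => f.one_of_mem_closedBall hx, fun x hx => ?_, fun x hx => ⟨?_, ?_⟩, ht⟩
  · exact f.zero_of_le_dist (by simpa using hx)
  · by_contra hh
    push Not at hh
    apply hx
    have : (f : Euc d → ℝ) =ᶠ[𝓝 x] fun _ => 1 := by
      filter_upwards [isOpen_ball.mem_nhds (show x ∈ ball c a from hh)] with y hy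
        using f.one_of_mem_closedBall (ball_subset_closedBall hy)
    rw [gradient, this.fderiv_eq]; simp
  · by_contra hh
    exact hx (ht.grad_zero (by simpa using hh))

lemma pd_congr {e x : Euc d} {f g : Euc d → ℝ} (h : f =ᶠ[𝓝 x] g) : pd e f =ᶠ[𝓝 x] pd e g := by
  filter_upwards [h.fderiv (𝕜 := ℝ)] with y hy
  rw [pd, pd, hy]

lemma dvA_congr {A : Euc d →L[ℝ] Euc d} {x : Euc d} {f g : Euc d → ℝ} (h : f =ᶠ[𝓝 x] g) :
    dvA A f x = dvA A g x := by
  rw [dvA, dvA]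
  exact Finset.sum_congr rfl fun i _ => (pd_congr (pd_congr h)).eq_of_nhds

/-- The barrier polynomial. -/
noncomputable def bar (α L k σ : ℝ) (y0 ν : Euc d) (y : Euc d) : ℝ :=
  α * (⟪y - y0, y - y0⟫ + L * (k * (σ - ⟪ν, y⟫) - (σ - ⟪ν, y⟫) ^ 2))

lemma bar_smooth (α L k σ : ℝ) (y0 ν : Euc d) : ContDiff ℝ (⊤ : ℕ∞) (bar α L k σ y0 ν) := by
  have h1 : ContDiff ℝ (⊤ : ℕ∞) (fun y : Euc d => y - y0) := contDiff_id.sub contDiff_const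
  have h2 : ContDiff ℝ (⊤ : ℕ∞) (fun y : Euc d => σ - ⟪ν, y⟫) :=
    contDiff_const.sub (contDiff_const.inner ℝ contDiff_id)
  exact contDiff_const.mul ((h1.inner ℝ h1).add (contDiff_const.mul ((contDiff_const.mul h2).sub (h2.pow 2))))

lemma bar_pd (α L k σ : ℝ) (y0 ν e : Euc d) : pd e (bar α L k σ y0 ν) =
    fun y => α * (2 * ⟪e, y - y0⟫ + L * (-k * ⟪ν, e⟫ + 2 * (σ - ⟪ν, y⟫) * ⟪ν, e⟫)) := by
  ext y
  have h0 : HasFDerivAt (fun y : Euc d => y - y0) (ContinuousLinearMap.id ℝ (Euc d)) y :=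
    (hasFDerivAt_id y).sub_const y0
  have h1 := h0.inner ℝ h0
  have h2 : HasFDerivAt (fun y : Euc d => σ - ⟪ν, y⟫) (-(innerSL ℝ ν)) y :=
    (innerSL ℝ ν).hasFDerivAt.const_sub σ
  have h3 := (h1.add (((h2.const_mul k).sub (h2.pow 2)).const_mul L)).const_mul α
  have e1 : fderiv ℝ (bar α L k σ y0 ν) y = _ := h3.fderiv
  rw [pd, e1]
  simp only [ContinuousLinearMap.smul_apply, ContinuousLinearMap.add_apply, ContinuousLinearMap.sub_apply,
    ContinuousLinearMap.neg_apply, innerSL_apply_apply, smul_eq_mul, fderivInnerCLM_apply,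
    ContinuousLinearMap.comp_apply, ContinuousLinearMap.prod_apply, ContinuousLinearMap.id_apply, nsmul_eq_mul]
  rw [real_inner_comm e (y - y0)]
  push_cast
  ring

lemma bar_pd2 (α L k σ : ℝ) (y0 ν e b y : Euc d) : pd b (pd e (bar α L k σ y0 ν)) y =
    α * (2 * ⟪e, b⟫ - 2 * L * (⟪ν, b⟫ * ⟪ν, e⟫)) := by
  rw [bar_pd]
  have h0 : HasFDerivAt (fun y : Euc d => ⟪e, y - y0⟫) (innerSL ℝ e) y :=
    (innerSL ℝ e).hasFDerivAt.comp y ((hasFDerivAt_id y).sub_const y0)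
  have h2 : HasFDerivAt (fun y : Euc d => σ - ⟪ν, y⟫) (-(innerSL ℝ ν)) y :=
    (innerSL ℝ ν).hasFDerivAt.const_sub σ
  have h3 := ((h0.const_mul 2).add ((((h2.const_mul 2).mul_const ⟪ν, e⟫).const_add (-k * ⟪ν, e⟫)).const_mul L)).const_mul α
  have e1 : fderiv ℝ (fun y => α * (2 * ⟪e, y - y0⟫ + L * (-k * ⟪ν, e⟫ + 2 * (σ - ⟪ν, y⟫) * ⟪ν, e⟫))) y = _ := h3.fderiv
  rw [pd, e1]
  simp only [ContinuousLinearMap.smul_apply, ContinuousLinearMap.add_apply,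
    ContinuousLinearMap.neg_apply, innerSL_apply_apply, smul_eq_mul]
  ring

section ell
variable {A : Euc d →L[ℝ] Euc d} {lam Lam : ℝ}

lemma Ell.bar_dvA (h : Ell A lam Lam) {α L k σ : ℝ} {y0 ν : Euc d} (hα : 0 ≤ α) (hL : L = d * Lam / lam)
    (hν : ‖ν‖ = 1) (y : Euc d) : dvA A (bar α L k σ y0 ν) y ≤ 0 := by
  rw [dvA]
  simp_rw [bar_pd2]
  rw [← Finset.mul_sum, Finset.sum_sub_distrib, ← Finset.mul_sum, ← Finset.mul_sum]
  have h1 : ∑ i, ⟪A (bv i), bv i⟫ ≤ d * Lam := by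
    have : ∀ i : Fin d, ⟪A (bv i), bv i⟫ ≤ Lam := fun i => by
      refine (real_inner_le_norm _ _).trans ?_
      have := h.bdd (bv i)
      simpa [bv] using this
    refine (Finset.sum_le_sum fun i _ => this i).trans ?_
    simp
  have h2 : ∑ i, ⟪ν, bv i⟫ * ⟪ν, A (bv i)⟫ = ⟪A ν, ν⟫ := by
    have : ∀ i : Fin d, ⟪ν, bv i⟫ * ⟪ν, A (bv i)⟫ = ⟪A ν, bv i⟫ * ⟪bv i, ν⟫ := fun i => by
      rw [h.sym, real_inner_comm ν (bv i)]; ring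
    rw [Finset.sum_congr rfl fun i _ => this i, (EuclideanSpace.basisFun (Fin d) ℝ).sum_inner_mul_inner]
  have h3 := h.coer ν
  rw [hν] at h3
  rw [h2]
  have hl := h.pos
  have hL0 : 0 ≤ L := by rw [hL]; have := h.posL; positivity
  have h4 : L * lam = d * Lam := by rw [hL]; field_simp
  have h5 : L * lam ≤ L * ⟪A ν, ν⟫ := by gcongr; linarith
  exact mul_nonpos_of_nonneg_of_nonpos hα (by nlinarith)

lemma WSol.neg {U : Set (Euc d)} {f z Z} (h : WSol A U (fun _ => 0) f z Z) :
    WSol A U (fun _ => 0) (fun x => - f x) (fun x => - z x) (fun x => - Z x) := by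
  refine ⟨?_, h.memb, h.memf.neg, fun η hη => ?_⟩
  · have := W0.lin (W0.zero (U := U)) h.w0 (-1)
    simpa using this
  · have := h.weak η hη
    simp only [map_neg, inner_neg_left, integral_neg, inner_zero_left, neg_mul] at this ⊢
    rw [this]; simp

lemma rpow_aux {c r : ℝ} (hc : 0 < c) (hr : 0 < r) :
    (c * r ^ 2) ^ (-(d:ℝ)/2) = c ^ (-(d:ℝ)/2) * (r ^ d)⁻¹ := by
  rw [Real.mul_rpow hc.le (by positivity)]
  congr 1
  rw [← Real.rpow_natCast r 2, ← Real.rpow_mul hr.le, ← Real.rpow_natCast r d, ← Real.rpow_neg hr.le]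
  congr 1; push_cast; ring

/-- pointwise bounds for the dual solution -/
lemma dual_bound (d : ℕ) (hd : 0 < d) (lam Lam : ℝ) : ∃ C > 0, ∀ A : Euc d →L[ℝ] Euc d, Ell A lam Lam →
    ∀ ρ0 r : ℝ, 0 < ρ0 → ρ0 ≤ 1 → 0 < r → ∀ x0 x : Euc d, 10 * r < ‖x - x0‖ → x ∈ ball x0 (40 * r) →
    ∀ ε > 0, ∀ z Z,
    WSol A (ball 0 ρ0 ∩ ball x0 (40 * r)) (fun _ => 0) (fun y => kk A ε (y - x)) z Z →
    ∀ᵐ y, y ∈ ball (0 : Euc d) ρ0 ∩ ball x0 (40 * r) → 0 ≤ z y ∧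
      (y ∈ closedBall x0 (8 * r) → z y ≤ C * (r ^ 2 * (r ^ d)⁻¹)) := by
  by_cases hlL : 0 < lam ∧ 0 < Lam
  swap
  · exact ⟨1, one_pos, fun A h => absurd ⟨h.pos, h.posL⟩ hlL⟩
  obtain ⟨hl, hL⟩ := hlL
  refine ⟨(100 ^ 2 / lam) * (lam / Lam ^ 2 * 4) ^ (-(d:ℝ)/2), by positivity, ?_⟩
  intro A hE ρ0 r hρ0 hρ1 hr x0 x hx hx40 ε hε z Z hz
  set U := ball (0 : Euc d) ρ0 ∩ ball x0 (40 * r) with hU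
  have hUo : IsOpen U := isOpen_ball.inter isOpen_ball
  have hU1 : U ⊆ ball 0 1 := Set.inter_subset_left.trans (ball_subset_ball hρ1)
  obtain ⟨θ, hθ, hθ0, hθ1, hθ2, -, hθ3, -⟩ := exists_bump (0 : Euc d) one_pos one_lt_two
  have hθU : ∀ y ∈ U, θ y = 1 := fun y hy => hθ2 y (ball_subset_closedBall (hU1 hy))
  have hθg : ∀ y ∈ U, gradient θ y = 0 := fun y hy => by
    by_contra hh
    have h1 := (hθ3 y hh).1
    have h2 : dist y 0 < 1 := hU1 hy
    linarith
  have hdz : ∀ y, dvA A (fun _ => (0:ℝ)) y = 0 := fun y => by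
    rw [dvA]
    refine Finset.sum_eq_zero fun i _ => ?_
    have : pd (A (bv i)) (fun _ : Euc d => (0:ℝ)) = fun _ => 0 := by ext; simp [pd]
    rw [this]; simp [pd]
  have hpos := comparison hd hl hE.coer hE.sym hUo.measurableSet hU1 hz.neg (Test.zero (U := Set.univ))
    (fun _ => le_rfl) hθ hθ0 hθ1 (.of_forall fun y hy hg => absurd (hθg y hy) hg)
    (.of_forall fun y hy _ _ => by
      rw [hdz, add_zero, neg_nonpos]; exact kk_nonneg hε _)
  obtain ⟨χ, hχ, hχ0, hχ1, hχ2, hχ3, -, -⟩ := exists_bump x0 (show 0 < 40 * r by positivity) (show 40 * r < 50 * r by linarith)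
  set S := (100 ^ 2 / lam) * r ^ 2 with hS
  set P : Euc d → ℝ := fun y => GG d ε S (qf A (y - x)) with hP
  have hPs : ContDiff ℝ (⊤ : ℕ∞) P := (GG_smooth ε S).comp (qf_smooth.comp (contDiff_id.sub contDiff_const))
  have hqS : ∀ y ∈ ball x0 (50 * r), qf A (y - x) ≤ S := by
    intro y hy
    have h1 : ‖y - x‖ ≤ 100 * r := by
      rw [mem_ball, dist_eq_norm] at hy hx40
      calc ‖y - x‖ = ‖(y - x0) - (x - x0)‖ := by congr 1; abel
        _ ≤ ‖y - x0‖ + ‖x - x0‖ := norm_sub_le _ _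
        _ ≤ _ := by linarith
    refine (hE.qf_le _).trans ?_
    calc ‖y - x‖ ^ 2 / lam ≤ (100 * r) ^ 2 / lam := by gcongr
      _ = S := by rw [hS]; ring
  have hΨ : Test Set.univ (fun y => P y * χ y) := hχ.smooth_mul hPs
  have hΨ0 : ∀ y, 0 ≤ P y * χ y := fun y => by
    by_cases hy : y ∈ ball x0 (50 * r)
    · exact mul_nonneg (GG_nonneg hε (hqS y hy)) (hχ0 y)
    · rw [hχ3 y hy, mul_zero]
  have hΨU : ∀ y ∈ U, P y * χ y = P y := fun y hy => by
    rw [hχ2 y (ball_subset_closedBall hy.2), mul_one]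
  have hup := comparison hd hl hE.coer hE.sym hUo.measurableSet hU1 hz hΨ
    hΨ0 hθ hθ0 hθ1 (.of_forall fun y hy hg => absurd (hθg y hy) hg)
    (.of_forall fun y hy _ _ => by
      have : (fun y => P y * χ y) =ᶠ[𝓝 y] P := by
        filter_upwards [hUo.mem_nhds hy] with y' hy' using hΨU y' hy'
      rw [dvA_congr this, hE.dvA_GG hε]; simp)
  filter_upwards [hpos, hup] with y h1 h2 hy
  have hθy : 0 < θ y := by rw [hθU y hy]; exact one_pos
  refine ⟨by linarith [h1 hy hθy], fun hy8 => ?_⟩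
  have h3 := h2 hy hθy
  rw [hΨU y hy] at h3
  refine h3.trans ?_
  have hyx : 2 * r ≤ ‖y - x‖ := by
    rw [mem_closedBall, dist_eq_norm] at hy8
    have : ‖x - x0‖ ≤ ‖y - x0‖ + ‖y - x‖ := by
      calc ‖x - x0‖ = ‖(y - x0) - (y - x)‖ := by congr 1; abel
        _ ≤ _ := norm_sub_le _ _
    linarith
  have ha : lam / Lam ^ 2 * 4 * r ^ 2 ≤ qf A (y - x) := by
    refine le_trans ?_ (hE.le_qf _)
    have : (2 * r) ^ 2 ≤ ‖y - x‖ ^ 2 := by gcongr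
    calc lam / Lam ^ 2 * 4 * r ^ 2 = lam / Lam ^ 2 * (2 * r) ^ 2 := by ring
      _ ≤ _ := by gcongr
  have h4 := GG_le (d := d) hε (by positivity) ha (hqS y (ball_subset_ball (by linarith) hy.2))
  refine h4.trans (le_of_eq ?_)
  rw [rpow_aux (by positivity) hr, hS]; ring

end ell
end W11

end

section

namespace W11
variable {d : ℕ}

lemma exists_dir (hd : 0 < d) (y0 : Euc d) : ∃ ν : Euc d, ‖ν‖ = 1 ∧ y0 = ‖y0‖ • ν := by
  by_cases h : y0 = 0
  · refine ⟨EuclideanSpace.single ⟨0, hd⟩ (1:ℝ), by simp, by simp [h]⟩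
  · refine ⟨‖y0‖⁻¹ • y0, ?_, ?_⟩
    · rw [norm_smul, norm_inv, norm_norm, inv_mul_cancel₀ (norm_ne_zero_iff.2 h)]
    · rw [smul_smul, mul_inv_cancel₀ (norm_ne_zero_iff.2 h), one_smul]

variable {A : Euc d →L[ℝ] Euc d} {lam Lam : ℝ}

lemma bdry_bound (hE : Ell A lam Lam) (hd : 0 < d) {ρ0 r δ M : ℝ} (hρ0 : 0 < ρ0) (hρ1 : ρ0 ≤ 1) (hr : 0 < r)
    (hM : 0 ≤ M)
    {x0 y0 : Euc d} (hy0 : y0 ∈ closedBall x0 (5 * r)) (hδ : δ = ρ0 - ‖y0‖) (hδ0 : 0 < δ) (hδr : δ < r)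
    {f z : Euc d → ℝ} {Z : Euc d → Euc d}
    (h : WSol A (ball 0 ρ0 ∩ ball x0 (40 * r)) (fun _ => 0) f z Z)
    (hf : ∀ y ∈ closedBall x0 (8 * r), f y = 0)
    (hz : ∀ᵐ y, y ∈ ball (0 : Euc d) ρ0 ∩ ball x0 (40 * r) → y ∈ closedBall x0 (8 * r) → z y ≤ M) :
    ∀ᵐ y, y ∈ ball y0 δ → z y ≤ M / r * (1 + 30 * (d * Lam / lam)) * δ := by
  obtain ⟨ν, hν, hyν⟩ := exists_dir hd y0
  set L := d * Lam / lam with hL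
  have hL0 : 0 ≤ L := by have := hE.pos; have := hE.posL; positivity
  set α := M / r ^ 2
  have hα : 0 ≤ α := by positivity
  obtain ⟨χ1, t1, p1, q1, e1, s1, -, -⟩ := exists_bump (0 : Euc d) hρ0 (by linarith : ρ0 < ρ0 + δ)
  obtain ⟨χ2, t2, p2, q2, e2, s2, -, -⟩ := exists_bump y0 (by linarith : 0 < 3 * r) (by linarith : 3 * r < 4 * r)
  obtain ⟨θ, tθ, pθ, qθ, eθ, sθ, gθ, -⟩ := exists_bump y0 hr (by linarith : r < 2 * r)
  set β := bar α L (10 * r) (ρ0 + δ) y0 ν with hβ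
  have hβval : ∀ y, β y = α * (‖y - y0‖ ^ 2 + L * ((ρ0 + δ - ⟪ν, y⟫) * (10 * r - (ρ0 + δ - ⟪ν, y⟫)))) := by
    intro y; rw [hβ]; simp only [bar]; rw [real_inner_self_eq_norm_sq]; ring
  have hin : ∀ y : Euc d, ⟪ν, y⟫ = ‖y0‖ + ⟪ν, y - y0⟫ := by
    intro y
    rw [inner_sub_right]
    have : ⟪ν, y0⟫ = ‖y0‖ := by
      conv_lhs => rw [hyν]
      rw [inner_smul_right, real_inner_self_eq_norm_sq, hν]; ring
    rw [this]; ring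
  have hs1 : ∀ y : Euc d, ‖y‖ ≤ ρ0 + δ → 0 ≤ ρ0 + δ - ⟪ν, y⟫ := by
    intro y hy
    have := real_inner_le_norm ν y
    rw [hν] at this; linarith
  have hs2 : ∀ y : Euc d, ρ0 + δ - ⟪ν, y⟫ ≤ 2 * δ + ‖y - y0‖ := by
    intro y
    have := abs_real_inner_le_norm ν (y - y0)
    rw [hν] at this
    have := (abs_le.1 this).1
    rw [hin y]; linarith
  have hβ0 : ∀ y : Euc d, ‖y‖ ≤ ρ0 + δ → ‖y - y0‖ ≤ 4 * r → α * ‖y - y0‖ ^ 2 ≤ β y := by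
    intro y h1 h2
    rw [hβval]
    have a1 := hs1 y h1
    have a2 := hs2 y
    have : 0 ≤ L * ((ρ0 + δ - ⟪ν, y⟫) * (10 * r - (ρ0 + δ - ⟪ν, y⟫))) :=
      mul_nonneg hL0 (mul_nonneg a1 (by linarith))
    apply mul_le_mul_of_nonneg_left _ hα; linarith
  set Ψ : Euc d → ℝ := fun y => (β y * χ1 y) * χ2 y with hΨ
  have tΨ : Test Set.univ Ψ := by
    have := t2.smooth_mul ((bar_smooth α L (10 * r) (ρ0 + δ) y0 ν).mul t1.smooth)
    exact this
  have hΨβ : ∀ y, y ∈ ball (0 : Euc d) ρ0 → y ∈ ball y0 (3 * r) → Ψ =ᶠ[𝓝 y] β := by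
    intro y h1 h2
    filter_upwards [isOpen_ball.mem_nhds h1, isOpen_ball.mem_nhds h2] with w hw1 hw2
    simp only [hΨ]
    rw [e1 w (ball_subset_closedBall hw1), e2 w (ball_subset_closedBall hw2)]; ring
  have hΨ0 : ∀ y, 0 ≤ Ψ y := by
    intro y
    by_cases h1 : y ∈ ball (0 : Euc d) (ρ0 + δ)
    · by_cases h2 : y ∈ ball y0 (4 * r)
      · have := hβ0 y (by rw [mem_ball_zero_iff] at h1; exact h1.le) (by rw [mem_ball, dist_eq_norm] at h2; exact h2.le)
        have : 0 ≤ β y := le_trans (by positivity) this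
        exact mul_nonneg (mul_nonneg this (p1 y)) (p2 y)
      · simp [hΨ, s2 y h2]
    · simp [hΨ, s1 y h1]
  have hx08 : ∀ y, dist y y0 ≤ 2 * r → y ∈ closedBall x0 (8 * r) := by
    intro y hy
    rw [mem_closedBall] at *
    have := dist_triangle y y0 x0; linarith
  have key := comparison hd hE.pos hE.coer hE.sym (isOpen_ball.inter isOpen_ball).measurableSet
    (Set.inter_subset_left.trans (ball_subset_ball hρ1)) h tΨ hΨ0 tθ pθ qθ ?_ ?_
  · filter_upwards [key] with y hy hyb
    rw [mem_ball, dist_eq_norm] at hyb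
    have hy0' : dist y0 x0 ≤ 5 * r := hy0
    have hyD : y ∈ ball (0 : Euc d) ρ0 := by
      rw [mem_ball_zero_iff]
      have := norm_le_norm_add_norm_sub' y y0
      linarith
    have hyU : y ∈ ball x0 (40 * r) := by
      rw [mem_ball]; have := dist_triangle y y0 x0
      rw [dist_eq_norm y y0] at this; linarith
    have h2 := hy ⟨hyD, hyU⟩ (by
      rw [eθ y (by rw [mem_closedBall, dist_eq_norm]; linarith)]; norm_num)
    refine h2.trans ?_
    rw [(hΨβ y hyD (by rw [mem_ball, dist_eq_norm]; linarith)).eq_of_nhds, hβval]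
    have a1 := hs1 y (by have := hyD; rw [mem_ball_zero_iff] at this; linarith)
    have a2 := hs2 y
    have : ‖y - y0‖ ^ 2 + L * ((ρ0 + δ - ⟪ν, y⟫) * (10 * r - (ρ0 + δ - ⟪ν, y⟫))) ≤ r * δ + L * (3 * δ * (10 * r)) := by
      apply add_le_add
      · have := norm_nonneg (y - y0); nlinarith
      · apply mul_le_mul_of_nonneg_left _ hL0
        apply mul_le_mul <;> first | linarith | nlinarith
    refine (mul_le_mul_of_nonneg_left this hα).trans (le_of_eq ?_)
    simp only [α]; field_simp; ring
  · filter_upwards [hz] with y hy hyU hg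
    obtain ⟨g1, g2⟩ := gθ y hg
    refine (hy hyU (hx08 y g2)).trans ?_
    rw [(hΨβ y hyU.1 (by rw [mem_ball]; linarith)).eq_of_nhds]
    rw [dist_eq_norm] at g1 g2
    refine le_trans ?_ (hβ0 y (by have := hyU.1; rw [mem_ball_zero_iff] at this; linarith) (by linarith))
    have : r ^ 2 ≤ ‖y - y0‖ ^ 2 := by gcongr
    refine le_trans (le_of_eq ?_) (mul_le_mul_of_nonneg_left this hα)
    simp only [α]; field_simp
  · refine Eventually.of_forall fun y hyU _ hθ => ?_
    have hb : y ∈ ball y0 (2 * r) := by by_contra hc; exact hθ (sθ y hc)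
    rw [hf y (hx08 y hb.le), dvA_congr (hΨβ y hyU.1 (ball_subset_ball (by linarith) hb)), zero_add]
    exact hE.bar_dvA hα hL hν y

lemma dual_grad (d : ℕ) (hd : 0 < d) (lam Lam : ℝ) : ∃ C > 0, ∀ A : Euc d →L[ℝ] Euc d, Ell A lam Lam →
    ∀ ρ0 r : ℝ, 0 < ρ0 → ρ0 ≤ 1 → 0 < r → ∀ x0 x : Euc d, 10 * r < ‖x - x0‖ → x ∈ ball x0 (40 * r) →
    ∀ ε > 0, Lam / √lam * ε < r → ∀ z Z,
    WSol A (ball 0 ρ0 ∩ ball x0 (40 * r)) (fun _ => 0) (fun y => kk A ε (y - x)) z Z →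
    ∀ᵐ y, y ∈ ball (0 : Euc d) ρ0 ∩ ball x0 (40 * r) → y ∈ closedBall x0 (5 * r) →
      |z y| ≤ C * (r ^ 2 * (r ^ d)⁻¹) ∧ ‖Z y‖ ≤ C * (r * (r ^ d)⁻¹) := by
  obtain ⟨C1, hC1, H1⟩ := dual_bound d hd lam Lam
  obtain ⟨C2, hC2, H2⟩ := grad_est d hd lam Lam
  set K := 1 + 30 * |d * Lam / lam| with hK
  have hK1 : 1 ≤ K := by have := abs_nonneg (d * Lam / lam); linarith
  refine ⟨C1 + C2 * C1 * K, by positivity, ?_⟩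
  intro A hE ρ0 r hρ0 hρ1 hr x0 x hx hx40 ε hε hεr z Z h
  set M := C1 * (r ^ 2 * (r ^ d)⁻¹) with hM
  have hM0 : 0 ≤ M := by positivity
  have hzb := H1 A hE ρ0 r hρ0 hρ1 hr x0 x hx hx40 ε hε z Z h
  have hk0 : ∀ y ∈ closedBall x0 (8 * r), kk A ε (y - x) = 0 := by
    intro y hy
    apply hE.kk_zero' hε
    rw [mem_closedBall, dist_eq_norm] at hy
    have : ‖x - x0‖ ≤ ‖y - x0‖ + ‖y - x‖ := by
      have := norm_sub_le (y - x0) (y - x); rwa [sub_sub_sub_cancel_left] at this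
    linarith
  have hKeq : 1 + 30 * (d * Lam / lam) = K := by
    rw [hK, abs_of_nonneg]; have := hE.pos; have := hE.posL; positivity
  have fin : ∀ y ρ, 0 < ρ → ‖Z y‖ ≤ C2 * (M / r * K * ρ) / ρ → ‖Z y‖ ≤ (C1 + C2 * C1 * K) * (r * (r ^ d)⁻¹) := by
    intro y ρ hρ h
    refine h.trans ?_
    have : C2 * (M / r * K * ρ) / ρ = (C2 * C1 * K) * (r * (r ^ d)⁻¹) := by
      rw [hM]; field_simp
    rw [this]
    gcongr; linarith
  filter_upwards [hzb, H2 A hE _ z Z h.w0] with y0 hy0 hg hyU hy5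
  constructor
  · obtain ⟨a1, a2⟩ := hy0 hyU
    rw [abs_of_nonneg a1]
    refine (a2 (closedBall_subset_closedBall (by linarith) hy5)).trans ?_
    gcongr; have : 0 < C2 * C1 * K := by positivity
    linarith
  have hy5' : dist y0 x0 ≤ 5 * r := hy5
  have hyD : ‖y0‖ < ρ0 := by have := hyU.1; rwa [mem_ball_zero_iff] at this
  have hsub : ∀ ρ ≤ ρ0 - ‖y0‖, ρ ≤ r → ball y0 ρ ⊆ (ball (0 : Euc d) ρ0 ∩ ball x0 (40 * r)) ∩ closedBall x0 (8 * r) := by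
    intro ρ h1 h2 y hy
    rw [mem_ball] at hy
    have t1 := dist_triangle y y0 x0
    refine ⟨⟨?_, ?_⟩, ?_⟩
    · rw [mem_ball_zero_iff]; rw [dist_eq_norm] at hy
      have := norm_le_norm_add_norm_sub' y y0
      linarith
    · rw [mem_ball]; linarith
    · rw [mem_closedBall]; linarith
  have hharm : ∀ ρ ≤ ρ0 - ‖y0‖, ρ ≤ r → ∀ ψ, Test (ball y0 ρ) ψ → ∫ y, ⟪A (Z y), gradient ψ y⟫ = 0 := by
    intro ρ h1 h2 ψ hψ
    have hs := hsub ρ h1 h2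
    rw [h.weak ψ (hψ.mono (hs.trans Set.inter_subset_left))]
    have : ∀ y, kk A ε (y - x) * ψ y = 0 := by
      intro y
      by_cases hy : y ∈ ball y0 ρ
      · rw [hk0 y (hs hy).2, zero_mul]
      · rw [hψ.zero_off hy, mul_zero]
    simp [this]
  by_cases hc : r ≤ ρ0 - ‖y0‖
  · apply fin y0 r hr
    have : M / r * K * r = M * K := by field_simp
    rw [this]
    refine hg r hr (M * K) (by positivity) (hharm r hc le_rfl) ?_
    filter_upwards [hzb] with y hy hyb
    have hs := hsub r hc le_rfl hyb
    obtain ⟨a1, a2⟩ := hy hs.1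
    rw [abs_of_nonneg a1]
    exact (a2 hs.2).trans (le_mul_of_one_le_right hM0 hK1)
  · push Not at hc
    have hδ0 : 0 < ρ0 - ‖y0‖ := by linarith
    apply fin y0 _ hδ0
    refine hg _ hδ0 _ (by positivity) (hharm _ le_rfl hc.le) ?_
    have hz : ∀ᵐ y, y ∈ ball (0 : Euc d) ρ0 ∩ ball x0 (40 * r) → y ∈ closedBall x0 (8 * r) → z y ≤ M := by
      filter_upwards [hzb] with y hy h1 h2 using (hy h1).2 h2
    filter_upwards [hzb, bdry_bound hE hd hρ0 hρ1 hr hM0 hy5 rfl hδ0 hc h hk0 hz] with y hy hyb hyδ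
    rw [abs_of_nonneg (hy (hsub _ le_rfl hc.le hyδ).1).1, ← hKeq]
    exact hyb hyδ

end W11

end

section

namespace W11
variable {d : ℕ}

lemma abs_int_inner_le_of_bdd {b Z : Euc d → Euc d} {M : ℝ} (hb : Integrable b)
    (h : ∀ᵐ y, b y ≠ 0 → ‖Z y‖ ≤ M) : |∫ y, ⟪b y, Z y⟫| ≤ M * ∫ y, ‖b y‖ := by
  rw [← integral_const_mul, ← Real.norm_eq_abs]
  apply norm_integral_le_of_norm_le (hb.norm.const_mul M)
  filter_upwards [h] with y hy
  by_cases h0 : b y = 0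
  · simp [h0]
  · rw [mul_comm]
    exact (norm_inner_le_norm _ _).trans (mul_le_mul_of_nonneg_left (hy h0) (norm_nonneg _))

lemma abs_int_mul_le_of_bdd {b Z : Euc d → ℝ} {M : ℝ} (hb : Integrable b)
    (h : ∀ᵐ y, b y ≠ 0 → |Z y| ≤ M) : |∫ y, b y * Z y| ≤ M * ∫ y, |b y| := by
  rw [← integral_const_mul, ← Real.norm_eq_abs]
  apply norm_integral_le_of_norm_le (hb.norm.const_mul M)
  filter_upwards [h] with y hy
  by_cases h0 : b y = 0
  · simp [h0]
  · rw [mul_comm M, norm_mul]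
    exact mul_le_mul_of_nonneg_left (hy h0) (norm_nonneg _)

theorem single_ball (d : ℕ) (hd : 0 < d) (lam Lam : ℝ) : ∃ C > 0, ∀ A : Euc d →L[ℝ] Euc d, Ell A lam Lam →
    ∀ ρ0 r : ℝ, 0 < ρ0 → ρ0 ≤ 1 → 0 < r → r ≤ 1 → ∀ x0 : Euc d, ∀ b g w W,
    WSol A (ball 0 ρ0 ∩ ball x0 (40 * r)) b g w W →
    Integrable b → Integrable g → (∀ y ∉ closedBall x0 (5 * r), b y = 0 ∧ g y = 0) →
    ∀ᵐ x, 10 * r < ‖x - x0‖ → |w x| ≤ C * (r * (r ^ d)⁻¹) * ((∫ y, ‖b y‖) + ∫ y, |g y|) := by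
  obtain ⟨C1, hC1, H1⟩ := dual_grad d hd lam Lam
  obtain ⟨c, hc, Hc⟩ := cA_lower d hd lam Lam
  refine ⟨C1 / c, by positivity, ?_⟩
  intro A hE ρ0 r hρ0 hρ1 hr hr1 x0 b g w W h hb hg hsupp
  set U := ball (0 : Euc d) ρ0 ∩ ball x0 (40 * r) with hU
  have hUm : MeasurableSet U := (isOpen_ball.inter isOpen_ball).measurableSet
  set m := (∫ y, ‖b y‖) + ∫ y, |g y| with hm
  have hm0 : 0 ≤ m := add_nonneg (integral_nonneg fun _ => norm_nonneg _) (integral_nonneg fun _ => abs_nonneg _)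
  clear_value m
  filter_upwards [hE.ae_LPt h.w0.mem, h.w0.zero_off hUm] with x hx hx0 hx10
  by_cases hxU : x ∈ U
  swap
  · rw [(hx0 hxU).1, abs_zero]; exact mul_nonneg (by positivity) hm0
  have hmu := hE.mu_pos
  have ev : ∀ᶠ ε in 𝓝[>] (0:ℝ), |∫ y, w y * kk A ε (y - x)| ≤ C1 * (r * (r ^ d)⁻¹) * m := by
    have : Set.Ioo (0:ℝ) (r / (Lam / √lam)) ∈ 𝓝[>] (0:ℝ) := Ioo_mem_nhdsGT (by positivity)
    filter_upwards [this] with ε hε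
    have hε2 : Lam / √lam * ε < r := by
      have := hε.2; rwa [lt_div_iff₀ hmu, mul_comm] at this
    obtain ⟨z, Z, hz⟩ := exists_sol hd hE.pos hE.coer (Set.inter_subset_left.trans (ball_subset_ball hρ1) : U ⊆ _)
      (b := fun _ => 0) (f := fun y => kk A ε (y - x)) MemLp.zero'
      (hE.kk_test hε.1 x (Set.subset_univ _)).memLp
    have hbd := H1 A hE ρ0 r hρ0 hρ1 hr x0 x hx10 hxU.2 ε hε.1 hε2 z Z hz
    have e1 := h.weak' hz.w0
    have e2 := hz.weak' h.w0
    have e3 : ∫ x, ⟪A (W x), Z x⟫ = ∫ x, ⟪A (Z x), W x⟫ := by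
      congr 1; ext y; rw [hE.sym, real_inner_comm]
    have e4 : ∫ y, w y * kk A ε (y - x) = (∫ x, ⟪b x, Z x⟫) + ∫ x, g x * z x := by
      rw [← e1, e3, e2]; simp [mul_comm]
    rw [e4]
    have hz0 := hz.w0.zero_off hUm
    have f1 : |∫ x, ⟪b x, Z x⟫| ≤ (C1 * (r * (r ^ d)⁻¹)) * ∫ y, ‖b y‖ := by
      apply abs_int_inner_le_of_bdd hb
      filter_upwards [hbd, hz0] with y hy hy0 hne
      have h5 : y ∈ closedBall x0 (5 * r) := by by_contra hc; exact hne (hsupp y hc).1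
      by_cases hyU : y ∈ U
      · exact (hy hyU h5).2
      · rw [(hy0 hyU).2, norm_zero]; positivity
    have f2 : |∫ x, g x * z x| ≤ (C1 * (r * (r ^ d)⁻¹)) * ∫ y, |g y| := by
      apply abs_int_mul_le_of_bdd hg
      filter_upwards [hbd, hz0] with y hy hy0 hne
      have h5 : y ∈ closedBall x0 (5 * r) := by by_contra hc; exact hne (hsupp y hc).2
      by_cases hyU : y ∈ U
      · refine (hy hyU h5).1.trans ?_
        gcongr; nlinarith
      · rw [(hy0 hyU).1, abs_zero]; positivity
    refine (abs_add_le _ _).trans ?_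
    rw [hm, mul_add]; exact add_le_add f1 f2
  have lim := le_of_tendsto (Tendsto.abs hx) ev
  have hcA := Hc A hE
  rw [abs_mul, abs_of_pos (by linarith)] at lim
  have : c * |w x| ≤ C1 * (r * (r ^ d)⁻¹) * m := le_trans (by gcongr) lim
  rw [show C1 / c * (r * (r ^ d)⁻¹) * m = (C1 * (r * (r ^ d)⁻¹) * m) / c by ring, le_div_iff₀ hc]
  linarith

end W11

end

section

namespace W11
variable {d : ℕ}

lemma lintegral_affine (G : Euc d → ℝ≥0∞) (hG : Measurable G) {s : ℝ} (hs : 1 / 2 ≤ s) (v : Euc d) :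
    ∫⁻ x, G (s • x + v) ≤ ENNReal.ofReal (2 ^ d) * ∫⁻ x, G x := by
  have hs0 : s ≠ 0 := by positivity
  have h1 : ∫⁻ x, G (s • x + v) = ∫⁻ x, G (x + v) ∂(Measure.map (s • ·) (volume : Measure (Euc d))) := by
    rw [lintegral_map (f := fun x => G (x + v)) (hG.comp (measurable_add_const v)) (measurable_const_smul s)]
  rw [h1, Measure.map_addHaar_smul _ hs0, lintegral_smul_measure, lintegral_add_right_eq_self]
  rw [smul_eq_mul]
  gcongr
  rw [abs_of_nonneg (by positivity), finrank_euclideanSpace, Fintype.card_fin, ← inv_pow]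
  gcongr
  rw [inv_le_comm₀ (by positivity) (by positivity)]
  linarith

lemma seg_bound {φ : Euc d → ℝ} (hφ : ContDiff ℝ (⊤ : ℕ∞) φ) {c : Euc d} {R : ℝ} {x y : Euc d}
    (hx : x ∈ ball c R) (hy : y ∈ ball c R) :
    ‖φ x - φ y‖ₑ ≤ ENNReal.ofReal (2 * R) *
      ∫⁻ s in Set.Icc (0:ℝ) 1, (ball c R).indicator (fun z => ‖gradient φ z‖ₑ) (s • x + (1 - s) • y) := by
  have hmem : ∀ s ∈ Set.Icc (0:ℝ) 1, s • x + (1 - s) • y ∈ ball c R := fun s hs =>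
    convex_ball c R hx hy hs.1 (by linarith [hs.2]) (by ring)
  have hR : 0 < R := pos_of_mem_ball hx
  set γ : ℝ → ℝ := fun s => φ (s • x + (1 - s) • y) with hγ
  have hder : ∀ s, HasDerivAt γ (⟪gradient φ (s • x + (1 - s) • y), x - y⟫) s := by
    intro s
    have h1 : HasDerivAt (fun s : ℝ => s • x + (1 - s) • y) (x - y) s := by
      have := ((hasDerivAt_id s).smul_const x).add (((hasDerivAt_const s (1:ℝ)).sub (hasDerivAt_id s)).smul_const y)
      exact this.congr_deriv (by simp [sub_eq_add_neg])
    have h2 := (hφ.differentiable (by simp) (s • x + (1 - s) • y)).hasFDerivAt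
    have := h2.comp_hasDerivAt s h1
    rwa [← inner_gradient] at this
  have hcont : Continuous fun s : ℝ => (⟪gradient φ (s • x + (1 - s) • y), x - y⟫ : ℝ) := by
    have := continuous_gradient hφ
    fun_prop
  have hftc := intervalIntegral.integral_eq_sub_of_hasDerivAt (a := 0) (b := 1) (fun s _ => hder s)
    (hcont.intervalIntegrable 0 1)
  have e1 : φ x - φ y = ∫ s in Set.Icc (0:ℝ) 1, (⟪gradient φ (s • x + (1 - s) • y), x - y⟫ : ℝ) := by
    rw [integral_Icc_eq_integral_Ioc, ← intervalIntegral.integral_of_le zero_le_one, hftc]; simp [hγ]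
  rw [e1]
  refine (enorm_integral_le_lintegral_enorm _).trans ?_
  rw [← lintegral_const_mul' _ _ ENNReal.ofReal_ne_top]
  apply setLIntegral_mono' measurableSet_Icc
  intro s hs
  rw [Set.indicator_of_mem (hmem s hs), mul_comm, ← ofReal_norm, ← ofReal_norm, ← ENNReal.ofReal_mul (norm_nonneg _)]
  apply ENNReal.ofReal_le_ofReal
  refine (norm_inner_le_norm _ _).trans ?_
  gcongr
  rw [← dist_eq_norm]
  have := dist_triangle_right x y c
  rw [mem_ball] at hx hy; linarith

lemma triple_bound (G : Euc d → ℝ≥0∞) (hGm : Measurable G) (B : Set (Euc d)) :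
    ∫⁻ x in B, ∫⁻ y in B, ∫⁻ s in Set.Icc (0:ℝ) 1, G (s • x + (1 - s) • y) ≤
      ENNReal.ofReal (2 ^ d) * (volume B * ∫⁻ x, G x) := by
  have hm3 : Measurable fun p : (Euc d × Euc d) × ℝ => G (p.2 • p.1.1 + (1 - p.2) • p.1.2) := by
    apply hGm.comp; apply Continuous.measurable; fun_prop
  have sw1 : ∀ x, ∫⁻ y in B, ∫⁻ s in Set.Icc (0:ℝ) 1, G (s • x + (1 - s) • y) =
        ∫⁻ s in Set.Icc (0:ℝ) 1, ∫⁻ y in B, G (s • x + (1 - s) • y) := by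
    intro x
    apply lintegral_lintegral_swap (f := fun (y : Euc d) (s : ℝ) => G (s • x + (1 - s) • y))
    apply Measurable.aemeasurable
    exact hm3.comp (by fun_prop : Measurable fun p : Euc d × ℝ => ((x, p.1), p.2))
  have step2 : ∫⁻ x in B, ∫⁻ s in Set.Icc (0:ℝ) 1, ∫⁻ y in B, G (s • x + (1 - s) • y)
      = ∫⁻ s in Set.Icc (0:ℝ) 1, ∫⁻ x in B, ∫⁻ y in B, G (s • x + (1 - s) • y) := by
    apply lintegral_lintegral_swap (f := fun (x : Euc d) (s : ℝ) => ∫⁻ y in B, G (s • x + (1 - s) • y))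
    apply Measurable.aemeasurable
    have := Measurable.lintegral_prod_right' (ν := volume.restrict B)
      (f := fun p : (Euc d × ℝ) × Euc d => G (p.1.2 • p.1.1 + (1 - p.1.2) • p.2))
      (hm3.comp (by fun_prop : Measurable fun p : (Euc d × ℝ) × Euc d => ((p.1.1, p.2), p.1.2)))
    exact this
  have step3 : ∀ s ∈ Set.Icc (0:ℝ) 1, ∫⁻ x in B, ∫⁻ y in B, G (s • x + (1 - s) • y)
      ≤ ENNReal.ofReal (2 ^ d) * (volume B * ∫⁻ x, G x) := by
    intro s hs
    have hc : ∫⁻ _y in B, ENNReal.ofReal (2 ^ d) * ∫⁻ x, G x = ENNReal.ofReal (2 ^ d) * (volume B * ∫⁻ x, G x) := by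
      rw [setLIntegral_const]; ring
    rw [← hc]
    rcases le_total (1/2) s with h | h
    · have sw : ∫⁻ x in B, ∫⁻ y in B, G (s • x + (1 - s) • y) = ∫⁻ y in B, ∫⁻ x in B, G (s • x + (1 - s) • y) := by
        apply lintegral_lintegral_swap (f := fun (x y : Euc d) => G (s • x + (1 - s) • y))
        apply Measurable.aemeasurable
        exact hm3.comp (by fun_prop : Measurable fun p : Euc d × Euc d => ((p.1, p.2), s))
      rw [sw]
      apply lintegral_mono
      intro y
      exact (setLIntegral_le_lintegral _ _).trans (lintegral_affine G hGm h _)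
    · apply lintegral_mono
      intro x
      refine (setLIntegral_le_lintegral _ _).trans ?_
      have := lintegral_affine G hGm (by linarith : 1 / 2 ≤ 1 - s) (s • x)
      simp_rw [add_comm _ (s • x)] at this
      exact this
  simp_rw [sw1]
  rw [step2]
  refine (setLIntegral_mono' measurableSet_Icc step3).trans ?_
  rw [setLIntegral_const]; simp

lemma poinc_l (c : Euc d) {R : ℝ} {φ : Euc d → ℝ} (hφ : ContDiff ℝ (⊤ : ℕ∞) φ) :
    ∫⁻ x in ball c R, ∫⁻ y in ball c R, ‖φ x - φ y‖ₑ ≤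
      ENNReal.ofReal (2 * R) * (ENNReal.ofReal (2 ^ d) * (volume (ball c R) * ∫⁻ x in ball c R, ‖gradient φ x‖ₑ)) := by
  have hGm : Measurable ((ball c R).indicator (fun z => ‖gradient φ z‖ₑ)) :=
    ((continuous_gradient hφ).measurable.enorm).indicator measurableSet_ball
  have step1 : ∫⁻ x in ball c R, ∫⁻ y in ball c R, ‖φ x - φ y‖ₑ ≤
      ∫⁻ x in ball c R, ∫⁻ y in ball c R, ENNReal.ofReal (2 * R) *
        ∫⁻ s in Set.Icc (0:ℝ) 1, (ball c R).indicator (fun z => ‖gradient φ z‖ₑ) (s • x + (1 - s) • y) := by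
    apply setLIntegral_mono' measurableSet_ball
    intro x hx
    apply setLIntegral_mono' measurableSet_ball
    intro y hy
    exact seg_bound hφ hx hy
  refine step1.trans ?_
  simp_rw [lintegral_const_mul' _ _ ENNReal.ofReal_ne_top]
  gcongr
  have := triple_bound _ hGm (ball c R)
  rwa [lintegral_indicator measurableSet_ball] at this

lemma poinc (hd : 0 < d) (c : Euc d) {R : ℝ} (hR : 0 < R) {φ : Euc d → ℝ} (hφ : ContDiff ℝ (⊤ : ℕ∞) φ) :
    ∫ x in ball c R, ∫ y in ball c R, |φ x - φ y| ≤
      2 * R * (2 ^ d * (R ^ d * vd d * ∫ x in ball c R, ‖gradient φ x‖)) := by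
  have hfin : volume (ball c R) ≠ ∞ := measure_ball_lt_top.ne
  have hgi : IntegrableOn (fun x => ‖gradient φ x‖) (ball c R) :=
    ((continuous_gradient hφ).norm.continuousOn.integrableOn_compact (isCompact_closedBall c R)).mono_set ball_subset_closedBall
  have hi : ∀ x, IntegrableOn (fun y => |φ x - φ y|) (ball c R) := fun x =>
    ((continuous_const.sub hφ.continuous).abs.continuousOn.integrableOn_compact (isCompact_closedBall c R)).mono_set ball_subset_closedBall
  haveI : Nontrivial (Euc d) := by
    haveI : Nonempty (Fin d) := ⟨⟨0, hd⟩⟩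
    infer_instance
  have hvol : volume (ball c R) = ENNReal.ofReal (R ^ d * vd d) := by
    rw [← vol_cb c hR.le, Measure.real, ENNReal.ofReal_toReal (measure_closedBall_lt_top).ne,
      Measure.addHaar_closedBall_eq_addHaar_ball]
  have key := poinc_l c (R := R) hφ
  have e2 : ∫⁻ x in ball c R, ‖gradient φ x‖ₑ = ENNReal.ofReal (∫ x in ball c R, ‖gradient φ x‖) := by
    rw [ofReal_integral_eq_lintegral_ofReal hgi (Eventually.of_forall fun _ => norm_nonneg _)]
    simp
  have e3 : ∀ x, ∫⁻ y in ball c R, ‖φ x - φ y‖ₑ = ENNReal.ofReal (∫ y in ball c R, |φ x - φ y|) := by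
    intro x
    rw [ofReal_integral_eq_lintegral_ofReal (hi x) (Eventually.of_forall fun _ => abs_nonneg _)]
    simp only [← ofReal_norm, Real.norm_eq_abs]
  have hI0 : 0 ≤ ∫ x in ball c R, ‖gradient φ x‖ := integral_nonneg fun _ => norm_nonneg _
  have hv := vd_pos (d := d)
  simp_rw [e3] at key
  rw [e2, hvol, ← ENNReal.ofReal_mul (by positivity), ← ENNReal.ofReal_mul (by positivity),
    ← ENNReal.ofReal_mul (by positivity)] at key
  rw [integral_eq_lintegral_of_nonneg_ae (Eventually.of_forall fun x => integral_nonneg fun _ => abs_nonneg _)]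
  · exact ENNReal.toReal_le_of_le_ofReal (by positivity) key
  · apply AEMeasurable.aestronglyMeasurable
    have hm : Measurable fun x => ∫⁻ y in ball c R, ‖φ x - φ y‖ₑ :=
      Measurable.lintegral_prod_right' (ν := volume.restrict (ball c R)) (f := fun p : Euc d × Euc d => ‖φ p.1 - φ p.2‖ₑ)
       (by have := hφ.continuous.measurable; fun_prop)
    have : (fun x => ∫ y in ball c R, |φ x - φ y|) = fun x => (∫⁻ y in ball c R, ‖φ x - φ y‖ₑ).toReal := by
      ext x; rw [e3, ENNReal.toReal_ofReal (integral_nonneg fun _ => abs_nonneg _)]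
    rw [this]
    exact hm.ennreal_toReal.aemeasurable

end W11

end

section

namespace W11
variable {d : ℕ}

lemma pd_scale {ψ : Euc d → ℝ} (h : ContDiff ℝ (⊤ : ℕ∞) ψ) (r : ℝ) (x0 e : Euc d) :
    pd e (fun x => ψ (r⁻¹ • (x - x0))) = fun x => r⁻¹ * pd e ψ (r⁻¹ • (x - x0)) := by
  funext x
  have h1 : HasFDerivAt (fun x : Euc d => r⁻¹ • (x - x0)) (r⁻¹ • ContinuousLinearMap.id ℝ (Euc d)) x :=
    ((hasFDerivAt_id x).sub_const x0).const_smul r⁻¹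
  have h2 := (h.differentiable (by simp) (r⁻¹ • (x - x0))).hasFDerivAt.comp x h1
  have h3 : fderiv ℝ (fun x => ψ (r⁻¹ • (x - x0))) x = _ := h2.fderiv
  simp only [pd]
  rw [h3]
  simp

lemma pd_const_mul' {ψ : Euc d → ℝ} (h : ContDiff ℝ (⊤ : ℕ∞) ψ) (c : ℝ) (e : Euc d) :
    pd e (fun x => c * ψ x) = fun x => c * pd e ψ x := by
  funext x
  simp only [pd]
  rw [fderiv_const_mul (h.differentiable (by simp) x)]; simp

lemma pd2_bdd {ψ : Euc d → ℝ} (h : Test Set.univ ψ) :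
    ∃ K : ℝ, 0 ≤ K ∧ ∀ (i : Fin d) (e x : Euc d), |pd (bv i) (pd e ψ) x| ≤ K * ‖e‖ := by
  choose K hK0 hK using fun i : Fin d => (h.pd (bv i)).bdd_grad
  refine ⟨∑ i, K i, Finset.sum_nonneg fun i _ => hK0 i, fun i e x => ?_⟩
  rw [pd_comm h.smooth]
  have h1 : pd e (pd (bv i) ψ) x = ⟪gradient (pd (bv i) ψ) x, e⟫ := (inner_gradient _ _ _).symm
  rw [h1]
  refine (abs_real_inner_le_norm _ _).trans ?_
  gcongr
  exact (hK i x).trans (Finset.single_le_sum (f := K) (fun j _ => hK0 j) (Finset.mem_univ i))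

lemma scaled_bump (d : ℕ) : ∃ K : ℝ, 0 ≤ K ∧ ∀ r > 0, ∀ x0 : Euc d, ∃ χ : Euc d → ℝ,
    Test (closedBall x0 (20 * r)) χ ∧ (∀ x ∈ closedBall x0 (12 * r), χ x = 1) ∧
    (∀ x, ‖gradient χ x‖ ≤ K / r) ∧
    ∀ (A : Euc d →L[ℝ] Euc d) (lam Lam : ℝ), Ell A lam Lam → ∀ x, |dvA A χ x| ≤ K * Lam / r ^ 2 := by
  obtain ⟨θ, tθ, pθ, qθ, eθ, sθ, -, t2⟩ := exists_bump (0 : Euc d) (by norm_num : (0:ℝ) < 12) (by norm_num : (12:ℝ) < 20)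
  obtain ⟨K1, hK1, hb1⟩ := tθ.bdd_grad
  obtain ⟨K2, hK2, hb2⟩ := pd2_bdd tθ
  refine ⟨K1 + d * K2, by positivity, fun r hr x0 => ⟨fun x => θ (r⁻¹ • (x - x0)), ?_, ?_, ?_, ?_⟩⟩
  · have hsm : ContDiff ℝ (⊤ : ℕ∞) (fun x => θ (r⁻¹ • (x - x0))) :=
      tθ.smooth.comp ((contDiff_id.sub contDiff_const).const_smul _)
    have hsupp : tsupport (fun x => θ (r⁻¹ • (x - x0))) ⊆ closedBall x0 (20 * r) := by
      apply closure_minimal _ isClosed_closedBall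
      intro x hx
      have : r⁻¹ • (x - x0) ∈ closedBall (0 : Euc d) 20 := by
        by_contra hc; exact hx (t2.zero_off hc)
      rw [mem_closedBall_zero_iff, norm_smul, norm_inv, Real.norm_of_nonneg hr.le, inv_mul_le_iff₀ hr] at this
      rw [mem_closedBall, dist_eq_norm]; linarith
    exact ⟨hsm, HasCompactSupport.of_support_subset_isCompact (isCompact_closedBall x0 (20 * r))
      (subset_closure.trans hsupp), hsupp⟩
  · intro x hx
    apply eθ
    rw [mem_closedBall_zero_iff, norm_smul, norm_inv, Real.norm_of_nonneg hr.le, inv_mul_le_iff₀ hr]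
    rw [mem_closedBall, dist_eq_norm] at hx; linarith
  · intro x
    have : gradient (fun x => θ (r⁻¹ • (x - x0))) x = r⁻¹ • gradient θ (r⁻¹ • (x - x0)) := by
      apply ext_inner_right ℝ
      intro e
      rw [inner_smul_left, inner_gradient, inner_gradient]
      exact congrFun (pd_scale tθ.smooth r x0 e) x
    rw [this, norm_smul, norm_inv, Real.norm_of_nonneg hr.le, inv_mul_le_iff₀ hr, mul_div_cancel₀ _ hr.ne']
    have : 0 ≤ d * K2 := by positivity
    linarith [hb1 (r⁻¹ • (x - x0))]
  · intro A lam Lam hE x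
    have hL := hE.posL
    have : ∀ i, |pd (bv i) (pd (A (bv i)) (fun x => θ (r⁻¹ • (x - x0)))) x| ≤ K2 * Lam / r ^ 2 := by
      intro i
      rw [pd_scale tθ.smooth, pd_const_mul' (ψ := fun x => pd (A (bv i)) θ (r⁻¹ • (x - x0)))
        ((contDiff_pd tθ.smooth _).comp ((contDiff_id.sub contDiff_const).const_smul _)),
        pd_scale (contDiff_pd tθ.smooth _)]
      simp only
      rw [abs_mul, abs_mul, abs_of_pos (inv_pos.2 hr)]
      have h1 := hb2 i (A (bv i)) (r⁻¹ • (x - x0))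
      have h2 : ‖(bv i : Euc d)‖ = 1 := by simp
      have h3 := hE.bdd (bv i)
      rw [h2, mul_one] at h3
      rw [le_div_iff₀ (by positivity)]
      have : r⁻¹ * (r⁻¹ * |pd (bv i) (pd (A (bv i)) θ) (r⁻¹ • (x - x0))|) * r ^ 2 = |pd (bv i) (pd (A (bv i)) θ) (r⁻¹ • (x - x0))| := by
        field_simp
      rw [this]
      exact h1.trans (by gcongr)
    simp only [dvA]
    refine (Finset.abs_sum_le_sum_abs _ _).trans ((Finset.sum_le_sum fun i _ => this i).trans ?_)
    rw [Finset.sum_const, Finset.card_univ, Fintype.card_fin, nsmul_eq_mul]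
    rw [← mul_div_assoc, ← mul_assoc]
    gcongr
    linarith

variable {A : Euc d →L[ℝ] Euc d} {lam Lam : ℝ}

/-- The localisation identity. -/
lemma cut_identity (hE : Ell A lam Lam) {D : Set (Euc d)} {x0 : Euc d} {r : ℝ} (hr : 0 < r) {b g w W}
    (h : WSol A (D ∩ ball x0 (40 * r)) b g w W) (hsupp : ∀ y ∉ closedBall x0 (5 * r), b y = 0 ∧ g y = 0)
    {χ : Euc d → ℝ} (hχ : Test (closedBall x0 (20 * r)) χ) (hχ1 : ∀ x ∈ closedBall x0 (12 * r), χ x = 1)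
    {φ : Euc d → ℝ} (hφ : Test D φ) :
    ∫ x, ⟪A (χ x • W x + w x • gradient χ x), gradient φ x⟫ =
      (∫ x, ⟪b x, gradient φ x⟫) + (∫ x, g x * φ x) + 2 * (∫ x, w x * ⟪A (gradient χ x), gradient φ x⟫)
        + ∫ x, w x * dvA A χ x * φ x := by
  have hχu : Test Set.univ χ := hχ.mono (Set.subset_univ _)
  have hφu : Test Set.univ φ := hφ.mono (Set.subset_univ _)
  have hη : Test (D ∩ ball x0 (40 * r)) (fun x => χ x * φ x) := by
    have h1 := hφ.smooth_mul hχ.smooth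
    refine ⟨h1.smooth, h1.cpt, Set.subset_inter h1.supp ?_⟩
    exact (tsupport_mul_subset_left.trans hχ.supp).trans (closedBall_subset_ball (by linarith))
  have e1 := h.weak _ hη
  have e2 := (h.w0.smul hφu).ibpA hE.sym hχu
  have near : ∀ y ∈ closedBall x0 (5 * r), χ =ᶠ[𝓝 y] fun _ => 1 := by
    intro y hy
    have : y ∈ ball x0 (12 * r) := closedBall_subset_ball (by linarith) hy
    filter_upwards [isOpen_ball.mem_nhds this] with z hz using hχ1 z (ball_subset_closedBall hz)
  have g0 : ∀ y ∈ closedBall x0 (5 * r), gradient χ y = 0 := by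
    intro y hy
    rw [gradient, (near y hy).fderiv_eq]; simp
  have gm : ∀ x, gradient (fun x => χ x * φ x) x = χ x • gradient φ x + φ x • gradient χ x :=
    gradient_mul' hχ.diff hφ.diff
  have e3 : ∫ x, ⟪b x, gradient (fun x => χ x * φ x) x⟫ = ∫ x, ⟪b x, gradient φ x⟫ := by
    congr 1; ext x
    by_cases hx : x ∈ closedBall x0 (5 * r)
    · rw [gm, g0 x hx, (near x hx).eq_of_nhds]; simp
    · rw [(hsupp x hx).1]; simp
  have e4 : ∫ x, g x * (χ x * φ x) = ∫ x, g x * φ x := by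
    congr 1; ext x
    by_cases hx : x ∈ closedBall x0 (5 * r)
    · rw [(near x hx).eq_of_nhds]; simp
    · rw [(hsupp x hx).2]; simp
  rw [e3, e4] at e1
  obtain ⟨C, hC0, hC⟩ := hφ.bdd
  obtain ⟨C', hC0', hC'⟩ := hχ.bdd
  obtain ⟨Cg, -, hCg⟩ := hφ.bdd_grad
  have mW := memLp_clm h.w0.memg A
  have mc := hφ.cont.aestronglyMeasurable (μ := (volume : Measure (Euc d)))
  have mc' := hχ.cont.aestronglyMeasurable (μ := (volume : Measure (Euc d)))
  have i1 : Integrable fun x => χ x * ⟪A (W x), gradient φ x⟫ := by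
    have := integrable_inner (memLp_smul_bdd mc' hC' mW) (hφ.memLp_grad (p := 2))
    simpa only [inner_smul_left, RCLike.conj_to_real] using this
  have i2 : Integrable fun x => φ x * ⟪A (W x), gradient χ x⟫ := by
    have := integrable_inner (memLp_smul_bdd mc hC mW) (hχ.memLp_grad (p := 2))
    simpa only [inner_smul_left, RCLike.conj_to_real] using this
  have i3 : Integrable fun x => w x * ⟪A (gradient χ x), gradient φ x⟫ := by
    have := integrable_inner (memLp_clm (memLp_bdd_smul (hφ.contg.aestronglyMeasurable (μ := (volume : Measure (Euc d)))) hCg h.w0.mem) A)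
      (hχ.memLp_grad (p := 2))
    refine this.congr (Eventually.of_forall fun x => ?_)
    simp only [map_smul, inner_smul_left, RCLike.conj_to_real]
    rw [hE.sym, real_inner_comm]
  have s1 : ∫ x, ⟪A (W x), gradient (fun x => χ x * φ x) x⟫ =
      (∫ x, χ x * ⟪A (W x), gradient φ x⟫) + ∫ x, φ x * ⟪A (W x), gradient χ x⟫ := by
    rw [← integral_add i1 i2]; congr 1; ext x
    rw [gm, inner_add_right, inner_smul_right, inner_smul_right]
  have s2 : ∫ x, ⟪A (φ x • W x + w x • gradient φ x), gradient χ x⟫ =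
      (∫ x, φ x * ⟪A (W x), gradient χ x⟫) + ∫ x, w x * ⟪A (gradient χ x), gradient φ x⟫ := by
    rw [← integral_add i2 i3]; congr 1; ext x
    rw [map_add, map_smul, map_smul, inner_add_left, inner_smul_left, inner_smul_left, hE.sym (gradient φ x),
      real_inner_comm (gradient φ x)]
    simp
  have s3 : ∫ x, ⟪A (χ x • W x + w x • gradient χ x), gradient φ x⟫ =
      (∫ x, χ x * ⟪A (W x), gradient φ x⟫) + ∫ x, w x * ⟪A (gradient χ x), gradient φ x⟫ := by
    rw [← integral_add i1 i3]; congr 1; ext x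
    rw [map_add, map_smul, map_smul, inner_add_left, inner_smul_left, inner_smul_left]
    simp
  have s4 : ∫ x, φ x * w x * dvA A χ x = ∫ x, w x * dvA A χ x * φ x := by
    congr 1; ext x; ring
  rw [s1] at e1
  rw [s2, s4] at e2
  rw [s3]
  linarith

end W11

end

section

namespace W11
variable {d : ℕ}

lemma mean_split (hd : 0 < d) {x0 x' : Euc d} {r R Q : ℝ} (hr : 0 < r) (hQ : 0 ≤ Q) (hB : ball x' r ⊆ ball x0 R)
    {q φ : Euc d → ℝ} (hq : Integrable q) (hqb : ∀ᵐ x, |q x| ≤ Q) (hq0 : ∀ x ∉ ball x0 R, q x = 0)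
    (hφ : Test Set.univ φ) :
    |∫ x, q x * φ x| * (r ^ d * vd d) ≤ Q * (∫ x in ball x0 R, ∫ y in ball x0 R, |φ x - φ y|)
      + |∫ x, q x| * |∫ y in ball x' r, φ y| := by
  haveI : Nontrivial (Euc d) := by
    haveI : Nonempty (Fin d) := ⟨⟨0, hd⟩⟩
    infer_instance
  have hvol : volume.real (ball x' r) = r ^ d * vd d := by
    rw [← vol_cb x' hr.le, Measure.real, Measure.real, Measure.addHaar_closedBall_eq_addHaar_ball]
  obtain ⟨M, hM0, hM⟩ := hφ.bdd
  have hφi : Integrable φ := hφ.cont.integrable_of_hasCompactSupport hφ.cpt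
  have iqφ : Integrable fun x => q x * φ x := by
    refine hq.mul_bdd hφ.cont.aestronglyMeasurable (c := M) (Eventually.of_forall hM)
  have hab : ∀ x, IntegrableOn (fun y => |φ x - φ y|) (ball x0 R) := fun x =>
    ((integrableOn_const (by exact measure_ball_lt_top.ne)).sub hφi.integrableOn).abs
  have e1 : ∀ x, ∫ y in ball x' r, (φ x - φ y) = (r ^ d * vd d) * φ x - ∫ y in ball x' r, φ y := by
    intro x
    have hci : Integrable (fun _ : Euc d => φ x) (volume.restrict (ball x' r)) := integrableOn_const (by exact measure_ball_lt_top.ne)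
    rw [integral_sub hci hφi.integrableOn, setIntegral_const, hvol, smul_eq_mul]
  have e2 : (∫ x, q x * φ x) * (r ^ d * vd d) = (∫ x, q x * ∫ y in ball x' r, (φ x - φ y)) + (∫ x, q x) * ∫ y in ball x' r, φ y := by
    simp_rw [e1, mul_sub]
    rw [integral_sub, integral_mul_const]
    · rw [sub_add_cancel, ← integral_mul_const]; congr 1; ext x; ring
    · refine (iqφ.mul_const (r ^ d * vd d)).congr (Eventually.of_forall fun x => ?_)
      ring
    · exact hq.mul_const _
  have hv : 0 ≤ r ^ d * vd d := by have := vd_pos (d := d); positivity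
  rw [← abs_of_nonneg hv, ← abs_mul, e2, ← abs_mul]
  refine (abs_add_le _ _).trans (add_le_add_left ?_ _)
  rw [← integral_const_mul, ← Real.norm_eq_abs, ← integral_indicator measurableSet_ball]
  apply norm_integral_le_of_norm_le
  · rw [integrable_indicator_iff measurableSet_ball]
    apply Integrable.const_mul
    have hcont : Continuous fun x => ∫ y in ball x0 R, |φ x - φ y| := by
      refine continuous_of_dominated (bound := fun _ => M + M) ?_ ?_ ?_ ?_
      · intro x; exact (hab x).aestronglyMeasurable
      · intro x; refine Eventually.of_forall fun y => ?_
        rw [Real.norm_eq_abs, abs_abs]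
        exact (abs_sub _ _).trans (add_le_add (hM x) (hM y))
      · exact integrableOn_const (by exact measure_ball_lt_top.ne)
      · refine Eventually.of_forall fun y => ?_
        exact (hφ.cont.sub continuous_const).abs
    exact (hcont.continuousOn.integrableOn_compact (isCompact_closedBall x0 R)).mono_set ball_subset_closedBall
  · filter_upwards [hqb] with x hx
    by_cases hxB : x ∈ ball x0 R
    · rw [Set.indicator_of_mem hxB, norm_mul]
      apply mul_le_mul hx _ (norm_nonneg _) hQ
      refine (norm_integral_le_integral_norm _).trans ?_
      exact setIntegral_mono_set (hab x) (Eventually.of_forall fun _ => abs_nonneg _) hB.eventuallyLE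
    · rw [Set.indicator_of_notMem hxB, hq0 x hxB]; simp

theorem local_sol (d : ℕ) (hd : 0 < d) (lam Lam : ℝ) : ∃ C > 0, ∀ A : Euc d →L[ℝ] Euc d, Ell A lam Lam →
    ∀ ρ0 r : ℝ, 0 < ρ0 → ρ0 ≤ 1 → 0 < r → r ≤ 1 → ∀ (x0 : Euc d) (b : Euc d → Euc d) (g : Euc d → ℝ),
    MemLp b 2 → MemLp g 2 → Integrable b → Integrable g → (∀ y ∉ closedBall x0 (5 * r), b y = 0 ∧ g y = 0) →
    ∃ y Y, W0 (ball 0 ρ0) y Y ∧ (∀ x ∉ closedBall x0 (20 * r), Y x = 0) ∧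
      ∀ φ, Test (ball 0 ρ0) φ →
        |(∫ x, ⟪A (Y x), gradient φ x⟫) - (∫ x, ⟪b x, gradient φ x⟫) - ∫ x, g x * φ x| ≤
          C * ((∫ y, ‖b y‖) + ∫ y, |g y|) * (r ^ d)⁻¹ * ∫ x in ball x0 (50 * r), (‖gradient φ x‖ + |φ x|) := by
  obtain ⟨C1, hC1, H1⟩ := single_ball d hd lam Lam
  obtain ⟨K, hK, HK⟩ := scaled_bump d
  have hv := vd_pos (d := d)
  refine ⟨2 * (C1 * K * |Lam|) + C1 * K * |Lam| * (100 * 2 ^ d * 50 ^ d) + (vd d)⁻¹, by positivity, ?_⟩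
  intro A hE ρ0 r hρ0 hρ1 hr hr1 x0 b g hb hg ib ig hsupp
  have hLam : |Lam| = Lam := abs_of_pos hE.posL
  have hLp := hE.posL
  rw [hLam]
  obtain ⟨w, W, h⟩ := exists_sol hd hE.pos hE.coer
    (Set.inter_subset_left.trans (ball_subset_ball hρ1) : ball (0 : Euc d) ρ0 ∩ ball x0 (40 * r) ⊆ _) hb hg
  have hw := H1 A hE ρ0 r hρ0 hρ1 hr hr1 x0 b g w W h ib ig hsupp
  obtain ⟨χ, tχ, eχ, gχ, dχ⟩ := HK r hr x0
  have dχ := dχ A lam Lam hE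
  have tχu : Test Set.univ χ := tχ.mono (Set.subset_univ _)
  have near : ∀ x ∈ ball x0 (12 * r), χ =ᶠ[𝓝 x] fun _ => 1 := by
    intro x hx
    filter_upwards [isOpen_ball.mem_nhds hx] with z hz using eχ z (ball_subset_closedBall hz)
  have far : ∀ x, x ∉ ball x0 (12 * r) → 10 * r < ‖x - x0‖ := by
    intro x hx; rw [mem_ball, dist_eq_norm] at hx; linarith
  have g0 : ∀ x ∈ ball x0 (12 * r), gradient χ x = 0 := by
    intro x hx; rw [gradient, (near x hx).fderiv_eq]; simp
  have d0 : ∀ x ∈ ball x0 (12 * r), dvA A χ x = 0 := by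
    intro x hx
    rw [dvA_congr (near x hx)]
    have : ∀ e : Euc d, pd e (fun _ : Euc d => (1:ℝ)) = fun _ => 0 := by
      intro e; funext y; simp [pd]
    simp only [dvA, this]
    simp [pd]
  obtain ⟨m, hm⟩ : ∃ m, m = (∫ y, ‖b y‖) + ∫ y, |g y| := ⟨_, rfl⟩
  have hgm : ∫ y, |g y| ≤ m := by
    have : 0 ≤ ∫ y, ‖b y‖ := integral_nonneg fun _ => norm_nonneg _
    linarith
  have hm0 : 0 ≤ m := le_trans (integral_nonneg fun _ => abs_nonneg _) hgm
  rw [← hm] at hw ⊢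
  refine ⟨_, _, (h.w0.smul tχu).mono Set.inter_subset_left, ?_, ?_⟩
  · intro x hx
    rw [tχ.zero_off hx, tχ.grad_zero hx]; simp
  intro φ hφ
  have hφu : Test Set.univ φ := hφ.mono (Set.subset_univ _)
  rw [cut_identity hE hr h hsupp tχ eχ hφ]
  set q : Euc d → ℝ := fun x => w x * dvA A χ x with hq
  set Q := C1 * (r * (r ^ d)⁻¹) * m * (K * Lam / r ^ 2) with hQ
  have hQ0 : 0 ≤ Q := by positivity
  have qi : Integrable q := integrable_mul2 h.w0.mem (tχu.dvA A).memLp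
  have qb : ∀ᵐ x, |q x| ≤ Q := by
    filter_upwards [hw] with x hx
    simp only [hq]
    by_cases hxb : x ∈ ball x0 (12 * r)
    · rw [d0 x hxb]; simpa using hQ0
    · rw [abs_mul]
      exact mul_le_mul (hx (far x hxb)) (dχ x) (abs_nonneg _) (by positivity)
  have sub2050 : closedBall x0 (20 * r) ⊆ ball x0 (50 * r) := closedBall_subset_ball (by linarith)
  have q0 : ∀ x ∉ ball x0 (50 * r), q x = 0 := by
    intro x hx
    simp only [hq]
    rw [(tχ.dvA A).zero_off (fun hc => hx (sub2050 hc)), mul_zero]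
  have igφ : IntegrableOn (fun x => ‖gradient φ x‖) (ball x0 (50 * r)) :=
    (hφ.contg.norm.continuousOn.integrableOn_compact (isCompact_closedBall x0 (50*r))).mono_set ball_subset_closedBall
  have iφ : IntegrableOn (fun x => |φ x|) (ball x0 (50 * r)) :=
    (hφ.cont.abs.continuousOn.integrableOn_compact (isCompact_closedBall x0 (50*r))).mono_set ball_subset_closedBall
  have iφ' : IntegrableOn φ (ball x0 (50 * r)) :=
    (hφ.cont.continuousOn.integrableOn_compact (isCompact_closedBall x0 (50*r))).mono_set ball_subset_closedBall
  rw [integral_add igφ iφ]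
  set I1 := ∫ x in ball x0 (50 * r), ‖gradient φ x‖ with hI1
  set I2 := ∫ x in ball x0 (50 * r), |φ x| with hI2
  have hI10 : 0 ≤ I1 := integral_nonneg fun _ => norm_nonneg _
  have hI20 : 0 ≤ I2 := integral_nonneg fun _ => abs_nonneg _
  have T1 : |∫ x, w x * ⟪A (gradient χ x), gradient φ x⟫| ≤ (C1 * K * Lam) * m * (r ^ d)⁻¹ * I1 := by
    rw [hI1, ← integral_const_mul, ← Real.norm_eq_abs, ← integral_indicator measurableSet_ball]
    apply norm_integral_le_of_norm_le
    · rw [integrable_indicator_iff measurableSet_ball]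
      exact igφ.const_mul _
    · filter_upwards [hw] with x hx
      by_cases hxb : x ∈ ball x0 (50 * r)
      · rw [Set.indicator_of_mem hxb]
        by_cases hx12 : x ∈ ball x0 (12 * r)
        · rw [g0 x hx12]; simp; positivity
        · rw [norm_mul]
          have a1 := hx (far x hx12)
          have a2 : ‖⟪A (gradient χ x), gradient φ x⟫‖ ≤ (Lam * (K / r)) * ‖gradient φ x‖ := by
            refine (norm_inner_le_norm _ _).trans ?_
            gcongr
            exact (hE.bdd _).trans (by gcongr; exact gχ x)
          calc _ ≤ (C1 * (r * (r ^ d)⁻¹) * m) * ((Lam * (K / r)) * ‖gradient φ x‖) :=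
                mul_le_mul a1 a2 (norm_nonneg _) (by positivity)
            _ = _ := by field_simp
      · rw [Set.indicator_of_notMem hxb, tχ.grad_zero (fun hc => hxb (sub2050 hc))]; simp
  have T2 : |∫ x, q x * φ x| * (r ^ d * vd d) ≤ Q * (2 * (50 * r) * (2 ^ d * ((50 * r) ^ d * vd d * I1))) + m * I2 := by
    have P := poinc hd x0 (by positivity : 0 < 50 * r) hφ.smooth
    by_cases hin : closedBall x0 (40 * r) ⊆ ball (0 : Euc d) ρ0
    · have hB : ball x0 r ⊆ ball x0 (50 * r) := ball_subset_ball (by linarith)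
      refine (mean_split hd hr hQ0 hB qi qb q0 hφu).trans ?_
      gcongr
      · obtain ⟨η, tη, -, -, eη, sη, gη, tη'⟩ := exists_bump x0 (by linarith : 0 < 25 * r) (by linarith : 25 * r < 35 * r)
        have tηD : Test (ball (0 : Euc d) ρ0) η := tη'.mono ((closedBall_subset_closedBall (by linarith)).trans hin)
        have id := cut_identity hE hr h hsupp tχ eχ tηD
        have gη0 : ∀ x ∈ closedBall x0 (20 * r), gradient η x = 0 := by
          intro x hx
          by_contra hc
          have := (gη x hc).1
          rw [mem_closedBall] at hx; linarith
        have z1 : ∀ x, ⟪A (χ x • W x + w x • gradient χ x), gradient η x⟫ = 0 := by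
          intro x
          by_cases hx : x ∈ closedBall x0 (20 * r)
          · rw [gη0 x hx, inner_zero_right]
          · rw [tχ.zero_off hx, tχ.grad_zero hx]; simp
        have z2 : ∀ x, ⟪b x, gradient η x⟫ = 0 := by
          intro x
          by_cases hx : x ∈ closedBall x0 (20 * r)
          · rw [gη0 x hx, inner_zero_right]
          · rw [(hsupp x (fun hc => hx (closedBall_subset_closedBall (by linarith) hc))).1]; simp
        have z3 : ∀ x, w x * ⟪A (gradient χ x), gradient η x⟫ = 0 := by
          intro x
          by_cases hx : x ∈ closedBall x0 (20 * r)
          · rw [gη0 x hx, inner_zero_right, mul_zero]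
          · rw [tχ.grad_zero hx]; simp
        have z4 : ∀ x, g x * η x = g x := by
          intro x
          by_cases hx : x ∈ closedBall x0 (20 * r)
          · rw [eη x (closedBall_subset_closedBall (by linarith) hx), mul_one]
          · rw [(hsupp x (fun hc => hx (closedBall_subset_closedBall (by linarith) hc))).2]; simp
        have z5 : ∀ x, w x * dvA A χ x * η x = q x := by
          intro x
          by_cases hx : x ∈ closedBall x0 (20 * r)
          · rw [eη x (closedBall_subset_closedBall (by linarith) hx), mul_one]
          · simp only [hq]; rw [(tχ.dvA A).zero_off hx]; simp
        simp only [z1, z2, z3, z4, z5, integral_zero] at id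
        have : ∫ x, q x = - ∫ x, g x := by linarith
        rw [this, abs_neg]
        exact (abs_integral_le_integral_abs).trans hgm
      · refine (abs_integral_le_integral_abs).trans ?_
        exact setIntegral_mono_set iφ (Eventually.of_forall fun _ => abs_nonneg _) hB.eventuallyLE
    · rw [Set.not_subset] at hin
      obtain ⟨p, hp, hpD⟩ := hin
      obtain ⟨ν, hν, hpν⟩ := exists_dir hd p
      have hpn : ρ0 ≤ ‖p‖ := by simpa using hpD
      have hx'n : ‖p + r • ν‖ = ‖p‖ + r := by
        conv_lhs => rw [hpν]
        rw [← add_smul, norm_smul, hν, mul_one, Real.norm_of_nonneg (by positivity)]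
      have hB : ball (p + r • ν) r ⊆ ball x0 (50 * r) := by
        intro z hz
        rw [mem_ball] at hz ⊢
        rw [mem_closedBall] at hp
        have h1 := dist_triangle z (p + r • ν) x0
        have h2 := dist_triangle (p + r • ν) p x0
        have h3 : dist (p + r • ν) p = r := by
          rw [dist_eq_norm, add_sub_cancel_left, norm_smul, hν, mul_one, Real.norm_of_nonneg hr.le]
        linarith
      have hz : ∫ y in ball (p + r • ν) r, φ y = 0 := by
        apply setIntegral_eq_zero_of_forall_eq_zero
        intro z hz
        apply hφ.zero_off
        rw [mem_ball, dist_eq_norm] at hz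
        rw [mem_ball_zero_iff, not_lt]
        have := norm_sub_norm_le (p + r • ν) z
        rw [norm_sub_rev] at this
        linarith
      refine (mean_split hd hr hQ0 hB qi qb q0 hφu).trans ?_
      rw [hz, abs_zero, mul_zero]
      gcongr
      positivity
  have T2' : |∫ x, q x * φ x| ≤ (C1 * K * Lam * (100 * 2 ^ d * 50 ^ d)) * m * (r ^ d)⁻¹ * I1 + (vd d)⁻¹ * m * (r ^ d)⁻¹ * I2 := by
    rw [← le_div_iff₀ (by positivity)] at T2
    refine T2.trans (le_of_eq ?_)
    rw [hQ, mul_pow]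
    field_simp
    ring
  have e : ∀ a b c e : ℝ, a + b + 2 * c + e - a - b = 2 * c + e := by intros; ring
  rw [e]
  refine (abs_add_le _ _).trans ?_
  rw [abs_mul, abs_of_pos (by norm_num : (0:ℝ) < 2)]
  have p1 : 0 ≤ (C1 * K * Lam) * m * (r ^ d)⁻¹ * I2 := by positivity
  have p2 : 0 ≤ (C1 * K * Lam * (100 * 2 ^ d * 50 ^ d)) * m * (r ^ d)⁻¹ * I2 := by positivity
  have p3 : 0 ≤ (vd d)⁻¹ * m * (r ^ d)⁻¹ * I1 := by positivity
  have hfin : (2 * (C1 * K * Lam) + C1 * K * Lam * (100 * 2 ^ d * 50 ^ d) + (vd d)⁻¹) * m * (r ^ d)⁻¹ * (I1 + I2)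
    = 2 * ((C1 * K * Lam) * m * (r ^ d)⁻¹ * I1) + ((C1 * K * Lam * (100 * 2 ^ d * 50 ^ d)) * m * (r ^ d)⁻¹ * I1 + (vd d)⁻¹ * m * (r ^ d)⁻¹ * I2)
      + (2 * ((C1 * K * Lam) * m * (r ^ d)⁻¹ * I2) + (C1 * K * Lam * (100 * 2 ^ d * 50 ^ d)) * m * (r ^ d)⁻¹ * I2 + (vd d)⁻¹ * m * (r ^ d)⁻¹ * I1) := by ring
  rw [hfin]
  linarith

end W11

end

section

namespace W11
variable {d : ℕ}

lemma cz_cover {h : Euc d → ℝ} (h0 : ∀ x, 0 ≤ h x) (hi : Integrable h)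
    (hz : ∀ x ∉ ball (0 : Euc d) 1, h x = 0) {M t : ℝ} (hM : ∫ x, h x ≤ M) (hM0 : 0 < M) (hMt : M ≤ t)
    {δ : ℝ≥0∞} (hδ : δ ≠ 0) :
    ∃ (s : Finset (Euc d)) (r : Euc d → ℝ),
      (∀ x ∈ s, 0 < r x ∧ r x ≤ 1 ∧ ∫ y in closedBall x (5 * r x), h y ≤ t * 5 ^ d * r x ^ d) ∧
      ((s : Set (Euc d)).PairwiseDisjoint fun x => closedBall x (r x)) ∧
      (∑ x ∈ s, r x ^ d ≤ M / t) ∧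
      ∃ N : Set (Euc d), MeasurableSet N ∧ volume N ≤ δ ∧
        ∀ᵐ x, x ∉ N → (∀ a ∈ s, x ∉ closedBall a (5 * r a)) → h x ≤ t / vd d := by
  classical
  have ht : 0 < t := hM0.trans_le hMt
  have hle : ∀ (x : Euc d) (ρ : ℝ), ∫ y in closedBall x ρ, h y ≤ M := fun x ρ =>
    (setIntegral_le_integral hi (.of_forall h0)).trans hM
  let P : Euc d → ℝ → Prop := fun x ρ => 0 < ρ ∧ t * ρ ^ d < ∫ y in closedBall x ρ, h y
  have P1 : ∀ x ρ, P x ρ → ρ < 1 := by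
    intro x ρ ⟨h1, h2⟩
    by_contra hc
    have : (1:ℝ) ≤ ρ ^ d := one_le_pow₀ (not_lt.mp hc)
    nlinarith [hle x ρ]
  have P2 : ∀ x ρ, P x ρ → ‖x‖ ≤ 2 := by
    intro x ρ hP
    by_contra hc
    have hρ := P1 x ρ hP
    obtain ⟨h1, h2⟩ := hP
    have : ∫ y in closedBall x ρ, h y = 0 := by
      apply setIntegral_eq_zero_of_forall_eq_zero
      intro y hy
      apply hz
      intro hy'
      rw [mem_closedBall, dist_eq_norm] at hy
      rw [mem_ball_zero_iff] at hy'
      have := norm_sub_norm_le x y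
      rw [norm_sub_rev] at this
      linarith
    rw [this] at h2
    have : 0 < t * ρ ^ d := by positivity
    linarith
  have P3 : ∀ x, (∃ ρ, P x ρ) → ∃ ρ, P x ρ ∧ ¬ P x (5 * ρ) := by
    rintro x ⟨ρ0, hρ0⟩
    have hb : BddAbove {ρ | P x ρ} := ⟨1, fun ρ hρ => (P1 x ρ hρ).le⟩
    have h1 : ρ0 ≤ sSup {ρ | P x ρ} := le_csSup hb hρ0
    have h2 : sSup {ρ | P x ρ} / 2 < sSup {ρ | P x ρ} := by linarith [hρ0.1]
    obtain ⟨ρ, hρ, hρ'⟩ := exists_lt_of_lt_csSup ⟨ρ0, hρ0⟩ h2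
    refine ⟨ρ, hρ, fun hc => ?_⟩
    have := le_csSup hb hc
    linarith [hρ.1]
  choose! r hr using P3
  set G : Set (Euc d) := {x | ∃ ρ, P x ρ} with hG
  set V : Set (Euc d) := ⋃ x ∈ G, ball x (r x) with hV
  have hVo : IsOpen V := isOpen_biUnion fun x _ => isOpen_ball
  have hVs : V ⊆ ball 0 3 := by
    intro y hy
    simp only [hV, Set.mem_iUnion] at hy
    obtain ⟨x, hx, hy⟩ := hy
    rw [mem_ball, dist_eq_norm] at hy
    have h1 := P1 x _ (hr x hx).1
    have h2 := P2 x _ (hr x hx).1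
    rw [mem_ball_zero_iff]
    have := norm_le_norm_add_norm_sub' y x
    linarith
  have hVf : volume V ≠ ∞ := ((measure_mono hVs).trans_lt measure_ball_lt_top).ne
  obtain ⟨K, hKV, hKc, hKδ⟩ := hVo.measurableSet.exists_isCompact_sdiff_lt hVf hδ
  obtain ⟨b, hbG, hbf, hKb⟩ := hKc.elim_finite_subcover_image (b := G) (c := fun x => ball x (r x))
    (fun x _ => isOpen_ball) hKV
  obtain ⟨u, hub, hud, huc⟩ := Vitali.exists_disjoint_subfamily_covering_enlargement_closedBall b
    (fun x => x) r 1 (fun a ha => (P1 a _ (hr a (hbG ha)).1).le) 5 (by norm_num)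
  have huf : u.Finite := hbf.subset hub
  refine ⟨huf.toFinset, r, ?_, ?_, ?_, V \ K, hVo.measurableSet.diff hKc.measurableSet, hKδ.le, ?_⟩
  · intro x hx
    have hx := hr x (hbG (hub (huf.mem_toFinset.mp hx)))
    refine ⟨hx.1.1, (P1 x _ hx.1).le, ?_⟩
    by_contra hc
    apply hx.2
    refine ⟨by linarith [hx.1.1], ?_⟩
    rw [mul_pow, ← mul_assoc]
    exact not_le.mp hc
  · rw [huf.coe_toFinset]; exact hud
  · rw [le_div_iff₀ ht]
    calc (∑ x ∈ huf.toFinset, r x ^ d) * t ≤ ∑ x ∈ huf.toFinset, ∫ y in closedBall x (r x), h y := by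
          rw [Finset.sum_mul]
          refine Finset.sum_le_sum fun x hx => ?_
          have hx := hr x (hbG (hub (huf.mem_toFinset.mp hx)))
          rw [mul_comm]
          exact hx.1.2.le
      _ = ∫ y in ⋃ x ∈ huf.toFinset, closedBall x (r x), h y := by
          rw [integral_biUnion_finset]
          · exact fun _ _ => measurableSet_closedBall
          · rw [huf.coe_toFinset]; exact hud
          · exact fun _ _ => hi.integrableOn
      _ ≤ M := (setIntegral_le_integral hi (.of_forall h0)).trans hM
  · filter_upwards [IsUnifLocDoublingMeasure.ae_tendsto_average volume hi.locallyIntegrable 1] with x hx hN hs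
    have hxK : x ∉ K := by
      intro hxK
      have := hKb hxK
      simp only [Set.mem_iUnion] at this
      obtain ⟨a, ha, hxa⟩ := this
      obtain ⟨c, hc, hac⟩ := huc a ha
      exact hs c (huf.mem_toFinset.mpr hc) (hac (ball_subset_closedBall hxa))
    have hxV : x ∉ V := fun hxV => hN ⟨hxV, hxK⟩
    have hxG : x ∉ G := by
      intro hxG
      apply hxV
      simp only [hV, Set.mem_iUnion]
      exact ⟨x, hxG, mem_ball_self (hr x hxG).1.1⟩
    have h1 := hx (l := 𝓝[>] (0:ℝ)) (fun _ => x) (fun ε => ε) tendsto_id (by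
      filter_upwards [self_mem_nhdsWithin] with ε hε
      rw [one_mul]
      exact mem_closedBall_self (le_of_lt hε))
    refine le_of_tendsto h1 ?_
    filter_upwards [self_mem_nhdsWithin] with ε hε
    have hε : 0 < ε := hε
    have h2 : ∫ y in closedBall x ε, h y ≤ t * ε ^ d := by
      by_contra hc
      exact hxG ⟨ε, hε, not_le.mp hc⟩
    rw [setAverage_eq, vol_cb x hε.le, smul_eq_mul]
    have hv : 0 < vd d := vd_pos
    calc (ε ^ d * vd d)⁻¹ * ∫ y in closedBall x ε, h y ≤ (ε ^ d * vd d)⁻¹ * (t * ε ^ d) := by gcongr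
      _ = t / vd d := by field_simp
end W11

end

section

namespace W11
variable {d : ℕ}

lemma ind_memLp (a : Euc d) (ρ : ℝ) : MemLp ((ball a ρ).indicator (fun _ => (1:ℝ))) 2 volume :=
  memLp_indicator_const 2 measurableSet_ball 1 (Or.inr measure_ball_lt_top.ne)

lemma overlap {s : Finset (Euc d)} {r : Euc d → ℝ} (hr : ∀ x ∈ s, 0 < r x)
    (hd : (s : Set (Euc d)).PairwiseDisjoint fun x => closedBall x (r x)) :
    MemLp (fun x => ∑ a ∈ s, (ball a (50 * r a)).indicator (fun _ => (1:ℝ)) x) 2 ∧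
    nrm (fun x => ∑ a ∈ s, (ball a (50 * r a)).indicator (fun _ => (1:ℝ)) x) ^ 2 ≤
      2 * (50 ^ d * (101 ^ d * vd d)) * ∑ a ∈ s, r a ^ d := by
  classical
  have hm : MemLp (fun x => ∑ a ∈ s, (ball a (50 * r a)).indicator (fun _ => (1:ℝ)) x) 2 :=
    memLp_finset_sum s fun a _ => ind_memLp a _
  refine ⟨hm, ?_⟩
  have hv : 0 < vd d := vd_pos
  rw [← nrm_sq hm]
  set m : Euc d → Euc d → ℝ := fun a b => volume.real (ball a (50 * r a) ∩ ball b (50 * r b)) with hmdef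
  have hm0 : ∀ a b, 0 ≤ m a b := fun a b => measureReal_nonneg
  have e1 : ∫ x, ‖∑ a ∈ s, (ball a (50 * r a)).indicator (fun _ => (1:ℝ)) x‖ ^ 2 =
      ∑ a ∈ s, ∑ b ∈ s, m a b := by
    have : ∀ x, ‖∑ a ∈ s, (ball a (50 * r a)).indicator (fun _ => (1:ℝ)) x‖ ^ 2 =
        ∑ a ∈ s, ∑ b ∈ s, (ball a (50 * r a) ∩ ball b (50 * r b)).indicator (fun _ => (1:ℝ)) x := by
      intro x
      rw [Real.norm_eq_abs, sq_abs, sq, Finset.sum_mul_sum]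
      refine Finset.sum_congr rfl fun a _ => Finset.sum_congr rfl fun b _ => ?_
      simp only [Set.indicator_apply, Set.mem_inter_iff]
      split_ifs <;> simp_all
    simp_rw [this]
    have hintg : ∀ a b : Euc d, Integrable
        ((ball a (50 * r a) ∩ ball b (50 * r b)).indicator (fun _ => (1:ℝ))) := fun a b =>
      (integrable_indicator_iff (measurableSet_ball.inter measurableSet_ball)).mpr
        (integrableOn_const ((measure_mono Set.inter_subset_left).trans_lt measure_ball_lt_top).ne)
    rw [integral_finset_sum _ fun a _ => integrable_finset_sum _ fun b _ => hintg a b]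
    refine Finset.sum_congr rfl fun a _ => ?_
    rw [integral_finset_sum _ fun b _ => hintg a b]
    refine Finset.sum_congr rfl fun b _ => ?_
    rw [integral_indicator (measurableSet_ball.inter measurableSet_ball)]
    simp [hmdef]
  rw [e1]
  have e2 : ∑ a ∈ s, ∑ b ∈ s, m a b ≤ 2 * ∑ a ∈ s, ∑ b ∈ s, (if r b ≤ r a then m a b else 0) := by
    have : ∑ a ∈ s, ∑ b ∈ s, m a b ≤ (∑ a ∈ s, ∑ b ∈ s, (if r b ≤ r a then m a b else 0)) +
        ∑ a ∈ s, ∑ b ∈ s, (if r a ≤ r b then m b a else 0) := by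
      rw [← Finset.sum_add_distrib]
      refine Finset.sum_le_sum fun a _ => ?_
      rw [← Finset.sum_add_distrib]
      refine Finset.sum_le_sum fun b _ => ?_
      have : m b a = m a b := by simp only [hmdef, Set.inter_comm]
      rw [this]
      rcases le_total (r a) (r b) with h | h
      · rw [if_pos h]; split_ifs <;> linarith [hm0 a b]
      · rw [if_pos h]; split_ifs <;> linarith [hm0 a b]
    rw [Finset.sum_comm (f := fun a b => if r a ≤ r b then m b a else 0)] at this
    linarith
  have e3 : ∀ a ∈ s, ∑ b ∈ s, (if r b ≤ r a then m a b else 0) ≤ 50 ^ d * (101 ^ d * vd d) * r a ^ d := by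
    intro a ha
    set s' := s.filter (fun b => r b ≤ r a ∧ (ball a (50 * r a) ∩ ball b (50 * r b)).Nonempty) with hs'
    have hs's : s' ⊆ s := Finset.filter_subset _ _
    calc ∑ b ∈ s, (if r b ≤ r a then m a b else 0) ≤ ∑ b ∈ s', 50 ^ d * volume.real (closedBall b (r b)) := by
          rw [hs', Finset.sum_filter]
          refine Finset.sum_le_sum fun b hb => ?_
          by_cases h1 : r b ≤ r a
          · by_cases h2 : (ball a (50 * r a) ∩ ball b (50 * r b)).Nonempty
            · rw [if_pos h1, if_pos ⟨h1, h2⟩]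
              have hb0 := hr b hb
              calc m a b ≤ volume.real (closedBall b (50 * r b)) :=
                    measureReal_mono (Set.inter_subset_right.trans ball_subset_closedBall)
                      measure_closedBall_lt_top.ne
                _ = _ := by rw [vol_cb b (by positivity), vol_cb b hb0.le]; ring
            · rw [if_pos h1, if_neg (fun h => h2 h.2)]
              simp only [hmdef]
              rw [Set.not_nonempty_iff_eq_empty.mp h2]
              simp
          · rw [if_neg h1, if_neg (fun h => h1 h.1)]
      _ = 50 ^ d * volume.real (⋃ b ∈ s', closedBall b (r b)) := by
          rw [← Finset.mul_sum, measureReal_biUnion_finset (h := ?_)]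
          · exact hd.subset (by exact_mod_cast hs's)
          · exact fun _ _ => measurableSet_closedBall
          · exact fun _ _ => measure_closedBall_lt_top.ne
      _ ≤ 50 ^ d * volume.real (closedBall a (101 * r a)) := by
          gcongr
          · exact measure_closedBall_lt_top.ne
          · refine Set.iUnion₂_subset fun b hb => ?_
            obtain ⟨_, h1, y, hy1, hy2⟩ := Finset.mem_filter.mp hb
            apply closedBall_subset_closedBall'
            rw [mem_ball] at hy1 hy2
            have := dist_triangle_left b a y
            linarith
      _ = _ := by
          rw [vol_cb a (by linarith [hr a ha])]; ring
  calc _ ≤ _ := e2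
    _ ≤ 2 * ∑ a ∈ s, 50 ^ d * (101 ^ d * vd d) * r a ^ d := by
        gcongr with a ha
        exact e3 a ha
    _ = _ := by rw [← Finset.mul_sum]; ring
end W11

end

section

namespace W11
variable {d : ℕ}

lemma energy {A : Euc d →L[ℝ] Euc d} {lam Lam : ℝ} (hE : Ell A lam Lam) {D : Set (Euc d)} {e : Euc d → ℝ}
    {E : Euc d → Euc d} (h : W0 D e E) {K : ℝ} (hK0 : 0 ≤ K)
    (hK : ∀ φ, Test D φ → |∫ x, ⟪A (E x), gradient φ x⟫| ≤ K * nrm (gradient φ)) :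
    lam * nrm E ≤ K := by
  have hAE : MemLp (fun x => A (E x)) 2 := memLp_clm h.memg A
  obtain ⟨φ, hφ, _, hφ2⟩ := h.seq
  have t1 : Tendsto (fun n => ∫ x, ⟪A (E x), gradient (φ n) x⟫) atTop (𝓝 (∫ x, ⟪A (E x), E x⟫)) := by
    apply tendsto_inner (fun n => (hφ n).memLp_grad) h.memg hAE hφ2
  have t2 : Tendsto (fun n => nrm (gradient (φ n))) atTop (𝓝 (nrm E)) := by
    rw [tendsto_iff_norm_sub_tendsto_zero]
    refine squeeze_zero (fun _ => norm_nonneg _) (fun n => ?_) hφ2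
    have hg : MemLp (gradient (φ n)) 2 := (hφ n).memLp_grad
    have a1 := nrm_add_le (hg.sub h.memg) h.memg
    have a2 := nrm_add_le (h.memg.sub hg) hg
    simp only [Pi.sub_apply, sub_add_cancel] at a1 a2
    have a3 : nrm (E - gradient (φ n)) = nrm (gradient (φ n) - E) := nrm_sub_comm ..
    have a4 : nrm (gradient (φ n) - E) = nrm (fun x => gradient (φ n) x - E x) := rfl
    rw [Real.norm_eq_abs, abs_le]
    constructor <;> linarith
  have t3 := le_of_tendsto_of_tendsto t1.abs (t2.const_mul K) (.of_forall fun n => hK _ (hφ n))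
  have h1 : lam * nrm E ^ 2 ≤ ∫ x, ⟪A (E x), E x⟫ := by
    rw [← nrm_sq h.memg, ← integral_const_mul]
    refine integral_mono ((integrable_norm_sq h.memg).const_mul _) (integrable_inner hAE h.memg) fun x => ?_
    exact hE.coer _
  have h2 := le_abs_self (∫ x, ⟪A (E x), E x⟫)
  have h0 : 0 ≤ nrm E := nrm_nonneg
  rcases h0.eq_or_lt with h3 | h3
  · rw [← h3, mul_zero]; exact hK0
  · nlinarith

noncomputable def cnt (s : Finset (Euc d)) (r : Euc d → ℝ) (x : Euc d) : ℝ :=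
  ∑ a ∈ s, (closedBall a (5 * r a)).indicator (fun _ => (1:ℝ)) x
noncomputable def wt (s : Finset (Euc d)) (r : Euc d → ℝ) (a x : Euc d) : ℝ :=
  (closedBall a (5 * r a)).indicator (fun _ => (1:ℝ)) x / cnt s r x

lemma cnt_meas (s : Finset (Euc d)) (r : Euc d → ℝ) : Measurable (cnt s r) :=
  Finset.measurable_sum _ fun a _ => measurable_const.indicator measurableSet_closedBall
lemma wt_meas (s : Finset (Euc d)) (r : Euc d → ℝ) (a : Euc d) : Measurable (wt s r a) :=
  (measurable_const.indicator measurableSet_closedBall).div (cnt_meas s r)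
lemma wt_nonneg (s : Finset (Euc d)) (r : Euc d → ℝ) (a x : Euc d) : 0 ≤ wt s r a x := by
  unfold wt cnt
  have : ∀ (S : Set (Euc d)) x, 0 ≤ S.indicator (fun _ => (1:ℝ)) x := fun S x =>
    Set.indicator_nonneg (fun _ _ => zero_le_one) x
  exact div_nonneg (this _ _) (Finset.sum_nonneg fun _ _ => this _ _)
lemma wt_le (s : Finset (Euc d)) (r : Euc d → ℝ) {a : Euc d} (ha : a ∈ s) (x : Euc d) : wt s r a x ≤ 1 := by
  have : ∀ (S : Set (Euc d)) x, 0 ≤ S.indicator (fun _ => (1:ℝ)) x := fun S x =>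
    Set.indicator_nonneg (fun _ _ => zero_le_one) x
  unfold wt cnt
  apply div_le_one_of_le₀ _ (Finset.sum_nonneg fun _ _ => this _ _)
  exact Finset.single_le_sum (f := fun a => (closedBall a (5 * r a)).indicator (fun _ => (1:ℝ)) x)
    (fun _ _ => this _ _) ha
lemma wt_zero (s : Finset (Euc d)) (r : Euc d → ℝ) {a x : Euc d} (hx : x ∉ closedBall a (5 * r a)) :
    wt s r a x = 0 := by
  unfold wt
  rw [Set.indicator_of_notMem hx, zero_div]
lemma wt_sum (s : Finset (Euc d)) (r : Euc d → ℝ) (x : Euc d) :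
    (∑ a ∈ s, wt s r a x = 1 ∧ ∃ a ∈ s, x ∈ closedBall a (5 * r a)) ∨
    (∑ a ∈ s, wt s r a x = 0 ∧ ∀ a ∈ s, x ∉ closedBall a (5 * r a)) := by
  by_cases h : ∃ a ∈ s, x ∈ closedBall a (5 * r a)
  · left
    refine ⟨?_, h⟩
    unfold wt
    rw [← Finset.sum_div]
    apply div_self
    obtain ⟨a, ha, hx⟩ := h
    have h1 := Finset.single_le_sum (f := fun a => (closedBall a (5 * r a)).indicator (fun _ => (1:ℝ)) x)
      (fun a _ => Set.indicator_nonneg (fun _ _ => zero_le_one) x) ha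
    simp only [Set.indicator_of_mem hx] at h1
    linarith
  · right
    push Not at h
    exact ⟨Finset.sum_eq_zero fun a ha => wt_zero s r (h a ha), h⟩

/-- L² bound of the good part -/
lemma good_bound {h h0 : Euc d → ℝ} {N : Set (Euc d)} (hN : MeasurableSet N) {K0 T M : ℝ} (hT : 0 ≤ T)
    (hK0 : ∀ x, h x ≤ K0) (hpos : ∀ x, 0 ≤ h0 x) (hle : ∀ x, h0 x ≤ h x) (hi : Integrable h)
    (hh0 : MemLp h0 2) (hM : ∫ x, h x ≤ M) {δ : ℝ} (hδ0 : 0 ≤ δ) (hδ : volume N ≤ ENNReal.ofReal δ)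
    (hb : ∀ᵐ x, x ∉ N → h0 x ≤ T) : nrm h0 ^ 2 ≤ T * M + K0 ^ 2 * δ := by
  have hNf : volume N < ∞ := hδ.trans_lt ENNReal.ofReal_lt_top
  have hNi : Integrable (N.indicator (fun _ => K0 ^ 2)) :=
    (integrable_indicator_iff hN).mpr (integrableOn_const hNf.ne)
  rw [← nrm_sq hh0]
  calc ∫ x, ‖h0 x‖ ^ 2 ≤ ∫ x, (T * h x + N.indicator (fun _ => K0 ^ 2) x) := by
        refine integral_mono_ae (integrable_norm_sq hh0) ((hi.const_mul T).add hNi) ?_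
        filter_upwards [hb] with x hx
        simp only [Real.norm_eq_abs, sq_abs]
        have a1 := hpos x
        have a2 := hle x
        have a3 := hK0 x
        by_cases hxN : x ∈ N
        · rw [Set.indicator_of_mem hxN]
          have : h0 x ^ 2 ≤ K0 ^ 2 := by gcongr; linarith
          have : 0 ≤ T * h x := mul_nonneg hT (a1.trans a2)
          linarith
        · rw [Set.indicator_of_notMem hxN]
          have := hx hxN
          rw [sq, add_zero]
          exact mul_le_mul this a2 a1 hT
    _ = T * (∫ x, h x) + K0 ^ 2 * volume.real N := by
        rw [integral_add (hi.const_mul T) hNi, integral_const_mul, integral_indicator hN]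
        simp [mul_comm]
    _ ≤ _ := by
        have : volume.real N ≤ δ := by
          rw [measureReal_def]
          exact ENNReal.toReal_le_of_le_ofReal hδ0 hδ
        gcongr
end W11

end

section

namespace W11
variable {d : ℕ}

/-- duality bound for the difference of `U` and the sum of local solutions -/
lemma diff_bound (hd : 0 < d) {A : Euc d →L[ℝ] Euc d} {D : Set (Euc d)} (hD : D ⊆ ball 0 1) {F g u U}
    (hS : WSol A D F g u U) {s : Finset (Euc d)} {r : Euc d → ℝ} (hr : ∀ a ∈ s, 0 < r a)
    {y : Euc d → Euc d → ℝ} {Y : Euc d → Euc d → Euc d} (hY : ∀ a ∈ s, W0 D (y a) (Y a))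
    {T : ℝ} (hT : 0 ≤ T)
    (hloc : ∀ a ∈ s, ∀ φ, Test D φ → |(∫ x, ⟪A (Y a x), gradient φ x⟫) -
      (∫ x, ⟪wt s r a x • F x, gradient φ x⟫) - ∫ x, (wt s r a x • g x) * φ x| ≤
          T * ∫ x in ball a (50 * r a), (‖gradient φ x‖ + |φ x|))
    (hSm : MemLp (fun x => ∑ a ∈ s, (ball a (50 * r a)).indicator (fun _ => (1:ℝ)) x) 2)
    {h0 : Euc d → ℝ} (hh0 : MemLp h0 2)
    (hh : ∀ x, (1 - ∑ a ∈ s, wt s r a x) * (‖F x‖ + |g x|) ≤ h0 x)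
    {φ : Euc d → ℝ} (hφ : Test D φ) :
    |∫ x, ⟪A (U x + (-1:ℝ) • ∑ a ∈ s, Y a x), gradient φ x⟫| ≤
      (3 * nrm h0 + 3 * T * nrm (fun x => ∑ a ∈ s, (ball a (50 * r a)).indicator (fun _ => (1:ℝ)) x))
        * nrm (gradient φ) := by
  have hg2 : MemLp (gradient φ) 2 := hφ.memLp_grad
  have hp2 : MemLp φ 2 := hφ.memLp
  have hpo : nrm φ ≤ 2 * nrm (gradient φ) := poincare hd (hφ.mono hD)
  have hU2 : MemLp (fun x => A (U x)) 2 := memLp_clm hS.w0.memg A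
  have hY2 : ∀ a ∈ s, MemLp (fun x => A (Y a x)) 2 := fun a ha => memLp_clm (hY a ha).memg A
  set σ : Euc d → ℝ := fun x => 1 - ∑ a ∈ s, wt s r a x with hσ
  have hσm : Measurable σ := measurable_const.sub (Finset.measurable_sum _ fun a _ => wt_meas s r a)
  have hσb : ∀ x, 0 ≤ σ x ∧ σ x ≤ 1 := fun x => by
    rcases wt_sum s r x with ⟨h, -⟩ | ⟨h, -⟩ <;> simp [hσ, h]
  have hσa : ∀ x, |σ x| ≤ 1 := fun x => by rw [abs_of_nonneg (hσb x).1]; exact (hσb x).2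
  have hwa : ∀ a ∈ s, ∀ x, |wt s r a x| ≤ 1 := fun a ha x => by
    rw [abs_of_nonneg (wt_nonneg ..)]; exact wt_le s r ha x
  have hF0 : MemLp (fun x => σ x • F x) 2 := memLp_smul_bdd hσm.aestronglyMeasurable hσa hS.memb
  have hg0 : MemLp (fun x => σ x • g x) 2 := memLp_smul_bdd hσm.aestronglyMeasurable hσa hS.memf
  have hbm : ∀ a ∈ s, MemLp (fun x => wt s r a x • F x) 2 := fun a ha =>
    memLp_smul_bdd (wt_meas s r a).aestronglyMeasurable (hwa a ha) hS.memb
  have hgm : ∀ a ∈ s, MemLp (fun x => wt s r a x • g x) 2 := fun a ha =>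
    memLp_smul_bdd (wt_meas s r a).aestronglyMeasurable (hwa a ha) hS.memf
  have hh0' : ∀ x, 0 ≤ h0 x := fun x => (mul_nonneg (hσb x).1 (by positivity)).trans (hh x)
  have nF0 : nrm (fun x => σ x • F x) ≤ nrm h0 := nrm_mono hh0 (.of_forall fun x => by
    rw [norm_smul, Real.norm_eq_abs, abs_of_nonneg (hσb x).1, Real.norm_eq_abs, abs_of_nonneg (hh0' x)]
    refine le_trans ?_ (hh x)
    exact mul_le_mul_of_nonneg_left (by linarith [abs_nonneg (g x)]) (hσb x).1)
  have ng0 : nrm (fun x => σ x • g x) ≤ nrm h0 := nrm_mono hh0 (.of_forall fun x => by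
    rw [norm_smul, Real.norm_eq_abs, abs_of_nonneg (hσb x).1, Real.norm_eq_abs, Real.norm_eq_abs, abs_of_nonneg (hh0' x)]
    refine le_trans ?_ (hh x)
    exact mul_le_mul_of_nonneg_left (by linarith [norm_nonneg (F x)]) (hσb x).1)
  have e1 : ∫ x, ⟪A (U x + (-1:ℝ) • ∑ a ∈ s, Y a x), gradient φ x⟫ =
      (∫ x, ⟪A (U x), gradient φ x⟫) - ∑ a ∈ s, ∫ x, ⟪A (Y a x), gradient φ x⟫ := by
    rw [← integral_finset_sum _ fun a ha => integrable_inner (hY2 a ha) hg2,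
      ← integral_sub (integrable_inner hU2 hg2)
        (integrable_finset_sum _ fun a ha => integrable_inner (hY2 a ha) hg2)]
    congr 1; ext x
    rw [map_add, map_smul, map_sum, inner_add_left, inner_smul_left, sum_inner]
    simp [sub_eq_add_neg]
  have e2 : ∫ x, ⟪F x, gradient φ x⟫ = (∫ x, ⟪σ x • F x, gradient φ x⟫) +
      ∑ a ∈ s, ∫ x, ⟪wt s r a x • F x, gradient φ x⟫ := by
    rw [← integral_finset_sum _ fun a ha => integrable_inner (hbm a ha) hg2,
      ← integral_add (integrable_inner hF0 hg2)
        (integrable_finset_sum _ fun a ha => integrable_inner (hbm a ha) hg2)]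
    congr 1; ext x
    rw [← sum_inner, ← inner_add_left, ← Finset.sum_smul, ← add_smul]
    simp [hσ]
  have e3 : ∫ x, g x * φ x = (∫ x, (σ x • g x) * φ x) +
      ∑ a ∈ s, ∫ x, (wt s r a x • g x) * φ x := by
    rw [← integral_finset_sum _ fun a ha => integrable_mul2 (hgm a ha) hp2,
      ← integral_add (integrable_mul2 hg0 hp2)
        (integrable_finset_sum _ fun a ha => integrable_mul2 (hgm a ha) hp2)]
    congr 1; ext x
    rw [← Finset.sum_mul, ← add_mul, ← Finset.sum_smul, ← add_smul]
    simp [hσ]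
  have e4 : ∫ x, ⟪A (U x + (-1:ℝ) • ∑ a ∈ s, Y a x), gradient φ x⟫ =
      (∫ x, ⟪σ x • F x, gradient φ x⟫) + (∫ x, (σ x • g x) * φ x) - ∑ a ∈ s,
        ((∫ x, ⟪A (Y a x), gradient φ x⟫) -
      (∫ x, ⟪wt s r a x • F x, gradient φ x⟫) - ∫ x, (wt s r a x • g x) * φ x) := by
    rw [e1, hS.weak φ hφ, e2, e3, Finset.sum_sub_distrib, Finset.sum_sub_distrib]
    ring
  set S : Euc d → ℝ := fun x => ∑ a ∈ s, (ball a (50 * r a)).indicator (fun _ => (1:ℝ)) x with hSdef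
  have hS0 : ∀ x, 0 ≤ S x := fun x => Finset.sum_nonneg fun a _ => Set.indicator_nonneg (fun _ _ => zero_le_one) x
  have hsum2 : MemLp (fun x => ‖gradient φ x‖ + |φ x|) 2 := hg2.norm.add hp2.norm
  have nsum : nrm (fun x => ‖gradient φ x‖ + |φ x|) ≤ 3 * nrm (gradient φ) := by
    have := nrm_add_le hg2.norm hp2.norm
    rw [nrm_norm, nrm_norm] at this
    have h' : nrm (fun x => ‖gradient φ x‖ + |φ x|) = nrm (fun x => ‖gradient φ x‖ + ‖φ x‖) := rfl
    linarith
  have e5 : |∑ a ∈ s, ((∫ x, ⟪A (Y a x), gradient φ x⟫) -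
      (∫ x, ⟪wt s r a x • F x, gradient φ x⟫) - ∫ x, (wt s r a x • g x) * φ x)| ≤
      T * (nrm S * (3 * nrm (gradient φ))) := by
    calc _ ≤ ∑ a ∈ s, T * ∫ x in ball a (50 * r a), (‖gradient φ x‖ + |φ x|) :=
          (Finset.abs_sum_le_sum_abs _ _).trans (Finset.sum_le_sum fun a ha => hloc a ha φ hφ)
      _ = T * ∫ x, S x * (‖gradient φ x‖ + |φ x|) := by
          rw [← Finset.mul_sum]
          congr 1
          have hi : Integrable (fun x => ‖gradient φ x‖ + |φ x|) :=
            (memLp_one_iff_integrable.mp hφ.memLp_grad).norm.add (memLp_one_iff_integrable.mp hφ.memLp).abs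
          have : ∀ x, S x * (‖gradient φ x‖ + |φ x|) =
              ∑ a ∈ s, (ball a (50 * r a)).indicator (fun x => ‖gradient φ x‖ + |φ x|) x := by
            intro x
            simp only [hSdef]
            rw [Finset.sum_mul]
            refine Finset.sum_congr rfl fun a _ => ?_
            by_cases hx : x ∈ ball a (50 * r a)
            · rw [Set.indicator_of_mem hx, Set.indicator_of_mem hx, one_mul]
            · rw [Set.indicator_of_notMem hx, Set.indicator_of_notMem hx, zero_mul]
          simp_rw [this]
          rw [integral_finset_sum _ fun a _ => hi.indicator measurableSet_ball]
          exact Finset.sum_congr rfl fun a _ => (integral_indicator measurableSet_ball).symm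
      _ ≤ T * (nrm S * (3 * nrm (gradient φ))) := by
          gcongr
          calc _ ≤ _ := (le_abs_self _).trans (abs_integral_mul_le hSm hsum2)
            _ ≤ _ := mul_le_mul_of_nonneg_left nsum nrm_nonneg
  rw [e4]
  have b1 := abs_integral_inner_le hF0 hg2
  have b2 := abs_integral_mul_le hg0 hp2
  have hn : 0 ≤ nrm (gradient φ) := nrm_nonneg
  have hn' : 0 ≤ nrm h0 := nrm_nonneg
  have hn2 : 0 ≤ nrm φ := nrm_nonneg
  have c1 : nrm (fun x => σ x • F x) * nrm (gradient φ) ≤ nrm h0 * nrm (gradient φ) := by gcongr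
  have c2 : nrm (fun x => σ x • g x) * nrm φ ≤ nrm h0 * (2 * nrm (gradient φ)) := by gcongr
  refine (abs_sub _ _).trans ?_
  refine (add_le_add (abs_add_le _ _) e5).trans ?_
  nlinarith
end W11

end

section

namespace W11
variable {d : ℕ}

lemma cheb {E : Euc d → Euc d} (hE : MemLp E 2) {t Q : ℝ} (ht : 0 < t) (hQ : nrm E ^ 2 ≤ Q) :
    volume {x | t < ‖E x‖} ≤ ENNReal.ofReal (Q / t ^ 2) := by
  have hi := integrable_norm_sq hE
  have h1 := mul_meas_ge_le_integral_of_nonneg (.of_forall fun x => by positivity) hi (t ^ 2)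
  have h2 : {x | t < ‖E x‖} ⊆ {x | t ^ 2 ≤ ‖E x‖ ^ 2} := fun x hx => by
    have : t < ‖E x‖ := hx
    show t ^ 2 ≤ ‖E x‖ ^ 2
    gcongr
  have hf : volume {x | t ^ 2 ≤ ‖E x‖ ^ 2} ≠ ∞ := (hi.measure_ge_lt_top (by positivity)).ne
  refine (measure_mono h2).trans ?_
  rw [← ENNReal.ofReal_toReal hf]
  apply ENNReal.ofReal_le_ofReal
  rw [le_div_iff₀ (by positivity), mul_comm]
  rw [nrm_sq hE] at h1
  exact h1.trans hQ

theorem thmB (d : ℕ) (hd : 0 < d) (lam Lam : ℝ) : ∃ C > 0, ∀ A : Euc d →L[ℝ] Euc d, Ell A lam Lam →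
    ∀ ρ0 : ℝ, 0 < ρ0 → ρ0 ≤ 1 → ∀ F g u U, WSol A (ball 0 ρ0) F g u U → ∀ K0 : ℝ,
    (∀ x, ‖F x‖ + |g x| ≤ K0) → (∀ x ∉ ball (0 : Euc d) 1, F x = 0 ∧ g x = 0) → Integrable F → Integrable g →
    ∀ M t : ℝ, 0 < M → 0 < t → ∫ x, (‖F x‖ + |g x|) ≤ M →
    volume {x | t < ‖U x‖} ≤ ENNReal.ofReal (C * M / t) := by
  obtain ⟨C0, hC0, hL⟩ := local_sol d hd lam Lam
  have hv : 0 < vd d := vd_pos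
  set C1 : ℝ := 1 / vd d + 1 with hC1
  set C2 : ℝ := 2 * (50 ^ d * (101 ^ d * vd d)) with hC2
  have hC1p : 0 < C1 := by positivity
  have hC2p : 0 < C2 := by positivity
  set C3 : ℝ := 3 * √C1 + 3 * (C0 * 5 ^ d) * √C2 with hC3
  have hC3p : 0 < C3 := by positivity
  refine ⟨(C3 / lam) ^ 2 + 20 ^ d * vd d + vd d, by positivity, ?_⟩
  intro A hE ρ0 hρ0 hρ1 F g u U hS K0 hK0 hz hFi hgi M t hM ht hintg
  have hlam := hE.pos
  have hD : ball (0 : Euc d) ρ0 ⊆ ball 0 1 := ball_subset_ball hρ1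
  rcases lt_or_ge t M with htM | hMt
  · -- trivial case
    have h1 : volume {x | t < ‖U x‖} ≤ volume (closedBall (0 : Euc d) 1) := by
      apply measure_mono_ae
      filter_upwards [hS.w0.zero_off measurableSet_ball] with x hx hxt
      by_contra hc
      have := (hx fun h => hc (ball_subset_closedBall (hD h))).2
      have h2 : t < ‖U x‖ := hxt
      rw [this, norm_zero] at h2
      linarith
    refine h1.trans ?_
    have h2 : volume (closedBall (0 : Euc d) 1) = ENNReal.ofReal (vd d) := by
      have := vol_cb (0 : Euc d) zero_le_one
      rw [one_pow, one_mul, measureReal_def] at this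
      rw [← this, ENNReal.ofReal_toReal measure_closedBall_lt_top.ne]
    rw [h2]
    apply ENNReal.ofReal_le_ofReal
    rw [le_div_iff₀ ht]
    have : 0 ≤ (C3 / lam) ^ 2 + 20 ^ d * vd d := by positivity
    nlinarith
  set h : Euc d → ℝ := fun x => ‖F x‖ + |g x| with hh
  have hh0 : ∀ x, 0 ≤ h x := fun x => by positivity
  have hhi : Integrable h := hFi.norm.add hgi.abs
  have hhz : ∀ x ∉ ball (0 : Euc d) 1, h x = 0 := fun x hx => by simp [hh, hz x hx]
  have hh2 : MemLp h 2 := hS.memb.norm.add hS.memf.norm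
  set δ : ℝ := t * M / (K0 ^ 2 + 1) with hδ
  have hδp : 0 < δ := by positivity
  obtain ⟨s, r, hsr, hsd, hsum, N, hNm, hNδ, hN⟩ := cz_cover hh0 hhi hhz hintg hM hMt
    (δ := ENNReal.ofReal δ) (by simpa using hδp)
  have hwa : ∀ a ∈ s, ∀ x, |wt s r a x| ≤ 1 := fun a ha x => by
    rw [abs_of_nonneg (wt_nonneg ..)]; exact wt_le s r ha x
  have hbm : ∀ a ∈ s, ∀ p, MemLp F p → MemLp (fun x => wt s r a x • F x) p := fun a ha p hp =>
    memLp_smul_bdd (wt_meas s r a).aestronglyMeasurable (hwa a ha) hp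
  have hgm : ∀ a ∈ s, ∀ p, MemLp g p → MemLp (fun x => wt s r a x • g x) p := fun a ha p hp =>
    memLp_smul_bdd (wt_meas s r a).aestronglyMeasurable (hwa a ha) hp
  have hbi : ∀ a ∈ s, Integrable (fun x => wt s r a x • F x) := fun a ha =>
    memLp_one_iff_integrable.mp (hbm a ha 1 (memLp_one_iff_integrable.mpr hFi))
  have hgi' : ∀ a ∈ s, Integrable (fun x => wt s r a x • g x) := fun a ha =>
    memLp_one_iff_integrable.mp (hgm a ha 1 (memLp_one_iff_integrable.mpr hgi))
  have hm : ∀ a ∈ s, (∫ x, ‖wt s r a x • F x‖) + (∫ x, |wt s r a x • g x|) ≤ t * 5 ^ d * r a ^ d := by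
    intro a ha
    refine le_trans ?_ (hsr a ha).2.2
    rw [← integral_add (hbi a ha).norm (hgi' a ha).abs,
      ← setIntegral_eq_integral_of_forall_compl_eq_zero (s := closedBall a (5 * r a))]
    · refine setIntegral_mono ((hbi a ha).norm.add (hgi' a ha).abs).integrableOn hhi.integrableOn fun x => ?_
      have h1 := wt_le s r ha x
      have h2 := wt_nonneg s r a x
      simp only [norm_smul, smul_eq_mul, abs_mul, Real.norm_eq_abs, abs_of_nonneg h2]
      rw [← mul_add]
      exact mul_le_of_le_one_left (hh0 x) h1
    · intro x hx
      simp [wt_zero s r hx]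
  have hex : ∀ a ∈ s, ∃ y Y, W0 (ball 0 ρ0) y Y ∧ (∀ x ∉ closedBall a (20 * r a), Y x = 0) ∧
      ∀ φ, Test (ball 0 ρ0) φ →
        |(∫ x, ⟪A (Y x), gradient φ x⟫) - (∫ x, ⟪wt s r a x • F x, gradient φ x⟫)
          - ∫ x, (wt s r a x • g x) * φ x| ≤
          (C0 * 5 ^ d * t) * ∫ x in ball a (50 * r a), (‖gradient φ x‖ + |φ x|) := by
    intro a ha
    obtain ⟨y, Y, h1, h2, h3⟩ := hL A hE ρ0 (r a) hρ0 hρ1 (hsr a ha).1 (hsr a ha).2.1 a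
      (fun x => wt s r a x • F x) (fun x => wt s r a x • g x) (hbm a ha 2 hS.memb) (hgm a ha 2 hS.memf)
      (hbi a ha) (hgi' a ha) (fun x hx => by simp [wt_zero s r hx])
    refine ⟨y, Y, h1, h2, fun φ hφ => (h3 φ hφ).trans ?_⟩
    apply mul_le_mul_of_nonneg_right _ (integral_nonneg fun x => by positivity)
    have hr := (hsr a ha).1
    have h4 := hm a ha
    calc _ ≤ C0 * (t * 5 ^ d * r a ^ d) * (r a ^ d)⁻¹ := by gcongr
      _ = _ := by field_simp
  choose! y Y hYW hY0 hYl using hex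
  obtain ⟨hSm, hSn⟩ := overlap (fun a ha => (hsr a ha).1) hsd
  set S : Euc d → ℝ := fun x => ∑ a ∈ s, (ball a (50 * r a)).indicator (fun _ => (1:ℝ)) x with hSdef
  set h0 : Euc d → ℝ := fun x => (1 - ∑ a ∈ s, wt s r a x) * h x with hh0def
  have hσm : Measurable (fun x => 1 - ∑ a ∈ s, wt s r a x) :=
    measurable_const.sub (Finset.measurable_sum _ fun a _ => wt_meas s r a)
  have hσb : ∀ x, 0 ≤ 1 - ∑ a ∈ s, wt s r a x ∧ 1 - ∑ a ∈ s, wt s r a x ≤ 1 := fun x => by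
    rcases wt_sum s r x with ⟨h, -⟩ | ⟨h, -⟩ <;> simp [h]
  have hh02 : MemLp h0 2 := memLp_smul_bdd hσm.aestronglyMeasurable (C := 1)
    (fun x => by rw [abs_of_nonneg (hσb x).1]; exact (hσb x).2) hh2
  have hn0 : nrm h0 ^ 2 ≤ C1 * (t * M) := by
    have := good_bound (h := h) (h0 := h0) hNm (T := t / vd d) (by positivity) hK0
      (fun x => mul_nonneg (hσb x).1 (hh0 x)) (fun x => mul_le_of_le_one_left (hh0 x) (hσb x).2) hhi hh02
      hintg hδp.le hNδ (by
        filter_upwards [hN] with x hx hxN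
        rcases wt_sum s r x with ⟨h1, -⟩ | ⟨h1, h2⟩
        · simp only [hh0def, h1, sub_self, zero_mul]; positivity
        · simp only [hh0def, h1, sub_zero, one_mul]; exact hx hxN h2)
    refine this.trans ?_
    have h1 : K0 ^ 2 * δ ≤ t * M := by
      rw [hδ, mul_div_assoc', div_le_iff₀ (by positivity)]
      nlinarith [mul_pos ht hM]
    have h2 : t / vd d * M = 1 / vd d * (t * M) := by ring
    rw [h2, hC1]
    linarith
  have hn1 : nrm h0 ≤ √C1 * √(t * M) := by
    rw [← Real.sqrt_mul hC1p.le]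
    exact Real.le_sqrt_of_sq_le hn0
  have hS1 : t * nrm S ≤ √C2 * √(t * M) := by
    rw [← Real.sqrt_mul hC2p.le]
    apply Real.le_sqrt_of_sq_le
    calc (t * nrm S) ^ 2 = t ^ 2 * nrm S ^ 2 := by ring
      _ ≤ t ^ 2 * (C2 * (M / t)) := by
          gcongr
          exact hSn.trans (mul_le_mul_of_nonneg_left hsum hC2p.le)
      _ = _ := by field_simp
  have hT : 0 ≤ C0 * 5 ^ d * t := by positivity
  have hKey := energy hE (hS.w0.lin (W0.sum s hYW) (-1)) (K := C3 * √(t * M)) (by positivity) (by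
    intro φ hφ
    refine (diff_bound hd hD hS (fun a ha => (hsr a ha).1) hYW hT hYl hSm hh02
      (fun x => le_rfl) hφ).trans ?_
    apply mul_le_mul_of_nonneg_right _ nrm_nonneg
    have : 3 * (C0 * 5 ^ d * t) * nrm S = 3 * (C0 * 5 ^ d) * (t * nrm S) := by ring
    have h2 : 3 * (C0 * 5 ^ d) * (t * nrm S) ≤ 3 * (C0 * 5 ^ d) * (√C2 * √(t * M)) := by gcongr
    change 3 * nrm h0 + 3 * (C0 * 5 ^ d * t) * nrm S ≤ _
    rw [this, hC3]
    linarith)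
  have hEm : MemLp (fun x => U x + (-1:ℝ) • ∑ a ∈ s, Y a x) 2 := (hS.w0.lin (W0.sum s hYW) (-1)).memg
  have hE2 : nrm (fun x => U x + (-1:ℝ) • ∑ a ∈ s, Y a x) ^ 2 ≤ (C3 / lam) ^ 2 * (t * M) := by
    have h1 : nrm (fun x => U x + (-1:ℝ) • ∑ a ∈ s, Y a x) ≤ (C3 / lam) * √(t * M) := by
      rw [div_mul_eq_mul_div, le_div_iff₀ hlam, mul_comm]
      exact hKey
    calc _ ≤ ((C3 / lam) * √(t * M)) ^ 2 := by
          gcongr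
          exact nrm_nonneg
      _ = _ := by rw [mul_pow, Real.sq_sqrt (by positivity)]
  have hsub : {x | t < ‖U x‖} ⊆ {x | t < ‖U x + (-1:ℝ) • ∑ a ∈ s, Y a x‖} ∪
      ⋃ a ∈ s, closedBall a (20 * r a) := by
    intro x hx
    by_cases hxu : x ∈ ⋃ a ∈ s, closedBall a (20 * r a)
    · exact Or.inr hxu
    · left
      simp only [Set.mem_iUnion, not_exists] at hxu
      have : ∑ a ∈ s, Y a x = 0 := Finset.sum_eq_zero fun a ha => hY0 a ha x (hxu a ha)
      show t < _
      rw [this, smul_zero, add_zero]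
      exact hx
  refine (measure_mono hsub).trans ((measure_union_le _ _).trans ?_)
  have k1 := cheb hEm ht hE2
  have k2 : volume (⋃ a ∈ s, closedBall a (20 * r a)) ≤ ENNReal.ofReal (20 ^ d * vd d * (M / t)) := by
    refine (measure_biUnion_finset_le s _).trans ?_
    calc ∑ a ∈ s, volume (closedBall a (20 * r a)) = ∑ a ∈ s, ENNReal.ofReal (20 ^ d * vd d * r a ^ d) := by
          refine Finset.sum_congr rfl fun a ha => ?_
          have := vol_cb a (r := 20 * r a) (by linarith [(hsr a ha).1])
          rw [measureReal_def] at this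
          rw [← ENNReal.ofReal_toReal (measure_closedBall_lt_top (x := a) (r := 20 * r a)).ne, this]
          congr 1; ring
      _ = ENNReal.ofReal (∑ a ∈ s, 20 ^ d * vd d * r a ^ d) := by
          rw [ENNReal.ofReal_sum_of_nonneg]
          intro a ha
          have := (hsr a ha).1
          positivity
      _ ≤ _ := by
          apply ENNReal.ofReal_le_ofReal
          rw [← Finset.mul_sum]
          gcongr
  refine (add_le_add k1 k2).trans ?_
  rw [← ENNReal.ofReal_add (by positivity) (by positivity)]
  apply ENNReal.ofReal_le_ofReal
  have e1 : (C3 / lam) ^ 2 * (t * M) / t ^ 2 = (C3 / lam) ^ 2 * (M / t) := by field_simp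
  rw [e1, mul_div_assoc]
  have : 0 ≤ vd d * (M / t) := by positivity
  linarith
end W11

end

section

namespace W11
variable {d : ℕ}

structure Ker (δ : ℝ) (k : Euc d → ℝ) (K : ℝ) : Prop where
  meas : Measurable k
  nonneg : ∀ y, 0 ≤ k y
  le : ∀ y, k y ≤ K
  int : Integrable k
  one : ∫ y, k y = 1
  zero : ∀ y, y ∉ ball (0 : Euc d) δ → k y = 0

lemma exists_ker {δ : ℝ} (hδ : 0 < δ) : ∃ (k : Euc d → ℝ) (K : ℝ), Ker δ k K := by
  set c : ℝ := volume.real (ball (0 : Euc d) δ) with hc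
  have hcp : 0 < c := ENNReal.toReal_pos (measure_ball_pos _ _ hδ).ne' measure_ball_lt_top.ne
  refine ⟨(ball (0 : Euc d) δ).indicator (fun _ => c⁻¹), c⁻¹, ?_, ?_, ?_, ?_, ?_, ?_⟩
  · exact measurable_const.indicator measurableSet_ball
  · exact fun y => Set.indicator_nonneg (fun _ _ => by positivity) y
  · intro y
    exact Set.indicator_le_self' (fun _ _ => by positivity) y
  · exact (integrable_indicator_iff measurableSet_ball).mpr (integrableOn_const measure_ball_lt_top.ne)
  · rw [integral_indicator measurableSet_ball]
    simp only [integral_const, MeasurableSet.univ, measureReal_restrict_apply, Set.univ_inter, smul_eq_mul]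
    exact mul_inv_cancel₀ hcp.ne'
  · exact fun y hy => Set.indicator_of_notMem hy _

section
variable {V : Type*} [NormedAddCommGroup V] [InnerProductSpace ℝ V] [CompleteSpace V]

noncomputable def mol (k : Euc d → ℝ) (H : Euc d → V) (x : Euc d) : V := ∫ y, k y • H (x - y)

variable {δ K : ℝ} {k : Euc d → ℝ} {H : Euc d → V}

lemma Ker.intx (hk : Ker δ k K) (hH : Integrable H) (x : Euc d) : Integrable (fun y => k y • H (x - y)) := by
  apply memLp_one_iff_integrable.mp
  exact memLp_smul_bdd hk.meas.aestronglyMeasurable (C := K)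
    (fun y => by rw [abs_of_nonneg (hk.nonneg y)]; exact hk.le y)
    (memLp_one_iff_integrable.mpr (hH.comp_sub_left x))

lemma Ker.intp (hk : Ker δ k K) (hH : Integrable H) :
    Integrable (fun p : Euc d × Euc d => k p.2 • H (p.1 - p.2)) (volume.prod volume) :=
  Integrable.convolution_integrand (ContinuousLinearMap.lsmul ℝ ℝ) hk.int hH

lemma Ker.mol_int (hk : Ker δ k K) (hH : Integrable H) : Integrable (mol k H) :=
  (hk.intp hH).integral_prod_left

lemma Ker.mol_bdd (hk : Ker δ k K) (hH : Integrable H) (x : Euc d) : ‖mol k H x‖ ≤ K * ∫ y, ‖H y‖ := by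
  calc ‖mol k H x‖ ≤ ∫ y, ‖k y • H (x - y)‖ := norm_integral_le_integral_norm _
    _ ≤ ∫ y, K * ‖H (x - y)‖ := by
        refine integral_mono (hk.intx hH x).norm ((hH.comp_sub_left x).norm.const_mul K) fun y => ?_
        simp only [norm_smul, Real.norm_eq_abs, abs_of_nonneg (hk.nonneg y)]
        exact mul_le_mul_of_nonneg_right (hk.le y) (norm_nonneg _)
    _ = _ := by
        rw [integral_const_mul, integral_sub_left_eq_self (fun y => ‖H y‖)]

lemma Ker.mol_l1 (hk : Ker δ k K) (hH : Integrable H) : ∫ x, ‖mol k H x‖ ≤ ∫ y, ‖H y‖ := by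
  have h1 := (hk.intp hH).norm
  calc ∫ x, ‖mol k H x‖ ≤ ∫ x, ∫ y, ‖k y • H (x - y)‖ :=
        integral_mono (hk.mol_int hH).norm h1.integral_prod_left fun x => norm_integral_le_integral_norm _
    _ = ∫ y, ∫ x, ‖k y • H (x - y)‖ := integral_integral_swap h1
    _ = ∫ y, k y * ∫ x, ‖H x‖ := by
        congr 1; ext y
        simp only [norm_smul, Real.norm_eq_abs, abs_of_nonneg (hk.nonneg y)]
        rw [integral_const_mul, integral_sub_right_eq_self (fun y => ‖H y‖)]
    _ = _ := by rw [integral_mul_const, hk.one, one_mul]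

lemma Ker.mol_sub (hk : Ker δ k K) {H' : Euc d → V} (hH : Integrable H) (hH' : Integrable H') (x : Euc d) :
    mol k (fun x => H x - H' x) x = mol k H x - mol k H' x := by
  unfold mol
  rw [← integral_sub (hk.intx hH x) (hk.intx hH' x)]
  simp only [smul_sub]

lemma Ker.mol_unif (hk : Ker δ k K) (hH : Integrable H) {ω : ℝ}
    (hu : ∀ x y, ‖y‖ < δ → ‖H x - H (x - y)‖ ≤ ω) (x : Euc d) : ‖H x - mol k H x‖ ≤ ω := by
  have e : H x - mol k H x = ∫ y, k y • (H x - H (x - y)) := by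
    simp only [smul_sub]
    rw [integral_sub (hk.int.smul_const _) (hk.intx hH x), integral_smul_const, hk.one, one_smul]
    rfl
  have hi : Integrable (fun y => k y • (H x - H (x - y))) := by
    simp only [smul_sub]
    exact (hk.int.smul_const _).sub (hk.intx hH x)
  rw [e]
  calc _ ≤ ∫ y, ‖k y • (H x - H (x - y))‖ := norm_integral_le_integral_norm _
    _ ≤ ∫ y, k y * ω := by
        refine integral_mono hi.norm (hk.int.mul_const ω) fun y => ?_
        simp only [norm_smul, Real.norm_eq_abs, abs_of_nonneg (hk.nonneg y)]
        by_cases hy : y ∈ ball (0 : Euc d) δ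
        · exact mul_le_mul_of_nonneg_left (hu x y (mem_ball_zero_iff.mp hy)) (hk.nonneg y)
        · rw [hk.zero y hy]; simp
    _ = _ := by rw [integral_mul_const, hk.one, one_mul]

lemma Ker.mol_inner (hk : Ker δ k K) (hH : Integrable H) {v : Euc d → V} (hv : Continuous v) {C : ℝ}
    (hC : ∀ x, ‖v x‖ ≤ C) :
    ∫ x, ⟪v x, mol k H x⟫ = ∫ y, k y * ∫ x, ⟪v (x + y), H x⟫ := by
  have hI : Integrable (fun p : Euc d × Euc d => ⟪v p.1, k p.2 • H (p.1 - p.2)⟫) (volume.prod volume) := by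
    have h1 := hk.intp hH
    refine (h1.norm.const_mul C).mono' ((hv.comp continuous_fst).aestronglyMeasurable.inner h1.1)
      (.of_forall fun p => ?_)
    calc _ ≤ ‖v p.1‖ * ‖k p.2 • H (p.1 - p.2)‖ := norm_inner_le_norm _ _
      _ ≤ _ := mul_le_mul_of_nonneg_right (hC _) (norm_nonneg _)
  calc ∫ x, ⟪v x, mol k H x⟫ = ∫ x, ∫ y, ⟪v x, k y • H (x - y)⟫ := by
        congr 1; ext x
        rw [integral_inner (hk.intx hH x)]; rfl
    _ = ∫ y, ∫ x, ⟪v x, k y • H (x - y)⟫ := integral_integral_swap hI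
    _ = _ := by
        congr 1; ext y
        simp only [inner_smul_right]
        rw [integral_const_mul]
        congr 1
        rw [← integral_sub_right_eq_self (fun x => ⟪v (x + y), H x⟫) y]
        simp only [sub_add_cancel]
end

lemma gradient_shift (η : Euc d → ℝ) (y x : Euc d) : gradient (fun x => η (x + y)) x = gradient η (x + y) := by
  unfold gradient
  rw [fderiv_comp_add_right]

lemma Test.shift {η : Euc d → ℝ} {δ : ℝ} (h : Test (ball 0 (1 - δ)) η) {y : Euc d} (hy : ‖y‖ < δ) :
    Test (ball 0 1) (fun x => η (x + y)) where
  smooth := h.smooth.comp (contDiff_id.add contDiff_const)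
  cpt := h.cpt.comp_homeomorph (Homeomorph.addRight y)
  supp := by
    intro x hx
    have h1 : x + y ∈ tsupport η := by
      have := tsupport_comp_subset_preimage (g := η) (f := fun x => x + y) (by fun_prop)
      exact this hx
    have := h.supp h1
    rw [mem_ball_zero_iff] at this ⊢
    have h2 : ‖x‖ ≤ ‖x + y‖ + ‖y‖ := by simpa using norm_sub_le (x + y) y
    linarith

end W11

end

section

namespace W11
variable {d : ℕ}

lemma int_inner_bdd {V : Type*} [NormedAddCommGroup V] [InnerProductSpace ℝ V] {μ : Measure (Euc d)}
    {f v : Euc d → V} (hf : Integrable f μ) (hv : Continuous v)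
    {C : ℝ} (hC : ∀ x, ‖v x‖ ≤ C) : Integrable (fun x => ⟪v x, f x⟫) μ := by
  refine (hf.norm.const_mul C).mono' (hv.aestronglyMeasurable.inner hf.1) (.of_forall fun p => ?_)
  exact (norm_inner_le_norm _ _).trans (mul_le_mul_of_nonneg_right (hC _) (norm_nonneg _))

lemma ind_memLp2 {V : Type*} [NormedAddCommGroup V] {f : Euc d → V} (hf : Integrable f) {C : ℝ}
    (hC : ∀ x, ‖f x‖ ≤ C) {D : Set (Euc d)} (hD : MeasurableSet D) (hDf : volume D ≠ ∞) :
    MemLp (D.indicator f) 2 := by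
  rw [memLp_indicator_iff_restrict hD]
  have : IsFiniteMeasure (volume.restrict D) := ⟨by simpa using hDf.lt_top⟩
  exact MemLp.of_bound hf.1.restrict C (.of_forall hC)

theorem smooth_case (d : ℕ) (hd : 0 < d) (lam Lam : ℝ) : ∃ C > 0, ∀ A : Euc d →L[ℝ] Euc d, Ell A lam Lam →
    ∀ φ, Test (ball (0 : Euc d) 1) φ → ∀ F g, Integrable F → Integrable g →
    (∀ η, Test (ball (0 : Euc d) 1) η → ∫ x, ⟪A (gradient φ x), gradient η x⟫ =
      (∫ x, ⟪F x, gradient η x⟫) + ∫ x, g x * η x) →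
    ∀ M t : ℝ, 0 < t → (∫ x, ‖F x‖) + (∫ x, |g x|) < M →
    volume {x | t < ‖gradient φ x‖} ≤ ENNReal.ofReal (C * M / t) := by
  obtain ⟨C, hC, hB⟩ := thmB d hd lam Lam
  refine ⟨C, hC, ?_⟩
  intro A hE φ hφ F g hF hg hw M t ht hM
  have hv : 0 < vd d := vd_pos
  set v : Euc d → Euc d := fun x => A (gradient φ x) with hvdef
  have hvc : Continuous v := A.continuous.comp hφ.contg
  have hvs : HasCompactSupport v := hφ.cptg.comp_left (g := A) (map_zero A)
  have hvi : Integrable v := hvc.integrable_of_hasCompactSupport hvs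
  obtain ⟨Kv, hKv⟩ := hvc.bounded_above_of_compact_support hvs
  have hvu := hvs.uniformContinuous_of_continuous hvc
  have hIF : 0 ≤ ∫ x, ‖F x‖ := integral_nonneg fun _ => norm_nonneg _
  have hIg : 0 ≤ ∫ x, |g x| := integral_nonneg fun _ => abs_nonneg _
  have hM0 : 0 < M := by linarith
  set ω : ℝ := (M - ((∫ x, ‖F x‖) + (∫ x, |g x|))) / vd d with hω
  have hωp : 0 < ω := div_pos (by linarith) hv
  obtain ⟨δ2, hδ2, hδ2u⟩ := Metric.uniformContinuous_iff.mp hvu ω hωp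
  obtain ⟨r', hr', hsr'⟩ := exists_lt_subset_ball (isClosed_tsupport φ) hφ.supp
  set δ : ℝ := min (min δ2 (1 - r')) (1/2) with hδ
  have hδp : 0 < δ := by
    rw [hδ]; exact lt_min (lt_min hδ2 (by linarith)) (by norm_num)
  have hδa : δ ≤ δ2 := (min_le_left _ _).trans (min_le_left _ _)
  have hδb : δ ≤ 1 - r' := (min_le_left _ _).trans (min_le_right _ _)
  have hδc : δ ≤ 1/2 := min_le_right _ _
  clear_value δ
  obtain ⟨k, K, hk⟩ := exists_ker (d := d) hδp
  set D : Set (Euc d) := ball 0 (1 - δ) with hD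
  have hDm : MeasurableSet D := measurableSet_ball
  have hDf : volume D ≠ ∞ := measure_ball_lt_top.ne
  have hφD : Test D φ := ⟨hφ.smooth, hφ.cpt, hsr'.trans (ball_subset_ball (by linarith))⟩
  set H : Euc d → Euc d := fun x => v x - F x with hH
  have hHi : Integrable H := hvi.sub hF
  have hmH := hk.mol_int hHi
  have hmg := hk.mol_int hg
  have hbF : ∀ x, ‖v x - mol k H x‖ ≤ Kv + K * ∫ y, ‖H y‖ := fun x =>
    (norm_sub_le _ _).trans (add_le_add (hKv x) (hk.mol_bdd hHi x))
  have hbg : ∀ x, ‖mol k g x‖ ≤ K * ∫ y, ‖g y‖ := fun x => hk.mol_bdd hg x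
  set Fd : Euc d → Euc d := D.indicator (fun x => v x - mol k H x) with hFd
  set gd : Euc d → ℝ := D.indicator (mol k g) with hgd
  have hsubi : Integrable (fun x => v x - mol k H x) := hvi.sub hmH
  have hFdi : Integrable Fd := hsubi.indicator hDm
  have hgdi : Integrable gd := hmg.indicator hDm
  have hS : WSol A D Fd gd φ (gradient φ) := by
    refine ⟨W0.of_test hφD, ind_memLp2 hsubi hbF hDm hDf,
      ind_memLp2 hmg hbg hDm hDf, fun η hη => ?_⟩
    obtain ⟨Cη, -, hCη⟩ := hη.bdd_grad
    obtain ⟨Cη', -, hCη'⟩ := hη.bdd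
    have e1 : ∫ x, ⟪Fd x, gradient η x⟫ = (∫ x, ⟪v x, gradient η x⟫) - ∫ x, ⟪gradient η x, mol k H x⟫ := by
      have i1 : Integrable (fun x => ⟪v x, gradient η x⟫) := by
        simpa only [real_inner_comm] using int_inner_bdd hvi hη.contg hCη
      rw [← integral_sub i1 (int_inner_bdd hmH hη.contg hCη)]
      congr 1; ext x
      rw [real_inner_comm (mol k H x), ← inner_sub_left]
      by_cases hx : x ∈ D
      · rw [hFd, Set.indicator_of_mem hx]
      · rw [hη.grad_zero hx, inner_zero_right, inner_zero_right]
    have e2 : ∫ x, gd x * η x = ∫ x, ⟪η x, mol k g x⟫ := by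
      congr 1; ext x
      by_cases hx : x ∈ D
      · rw [hgd, Set.indicator_of_mem hx]; simp [mul_comm]
      · rw [hη.zero_off hx]; simp
    have e3 : ∫ x, ⟪gradient η x, mol k H x⟫ = ∫ x, ⟪η x, mol k g x⟫ := by
      rw [hk.mol_inner hHi hη.contg hCη, hk.mol_inner hg hη.cont hCη']
      congr 1; ext y
      by_cases hy : y ∈ ball (0 : Euc d) δ
      · congr 1
        have ht := hη.shift (mem_ball_zero_iff.mp hy)
        have h1 := hw _ ht
        simp only [gradient_shift] at h1
        have c1 : Continuous fun x => gradient η (x + y) := hη.contg.comp (by fun_prop)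
        have i1 := int_inner_bdd hvi c1 (fun x => hCη (x + y))
        have i2 := int_inner_bdd hF c1 (fun x => hCη (x + y))
        have e4 : ∫ x, ⟪gradient η (x + y), H x⟫ = (∫ x, ⟪v x, gradient η (x + y)⟫) -
            ∫ x, ⟪F x, gradient η (x + y)⟫ := by
          simp only [real_inner_comm (gradient η _)]
          rw [← integral_sub i1 i2]
          simp only [hH, inner_sub_right]
        rw [e4, h1]
        simp [mul_comm]
      · rw [hk.zero y hy, zero_mul, zero_mul]
    rw [e1, e2, e3]
    simp [hvdef]
  refine hB A hE (1 - δ) (by linarith) (by linarith) Fd gd φ (gradient φ) hS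
    ((Kv + K * ∫ y, ‖H y‖) + K * ∫ y, ‖g y‖) ?_ ?_ hFdi hgdi M t hM0 ht ?_
  · intro x
    have n1 : ‖Fd x‖ ≤ ‖v x - mol k H x‖ := norm_indicator_le_norm_self _ _
    have n2 : ‖gd x‖ ≤ ‖mol k g x‖ := norm_indicator_le_norm_self _ _
    exact add_le_add (n1.trans (hbF x)) (n2.trans (hbg x))
  · intro x hx
    have : x ∉ D := fun h => hx (ball_subset_ball (by linarith) h)
    exact ⟨Set.indicator_of_notMem this _, Set.indicator_of_notMem this _⟩
  · rw [integral_add hFdi.norm hgdi.abs]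
    have k1 : ∫ x, |gd x| ≤ ∫ x, |g x| := by
      refine le_trans ?_ (hk.mol_l1 hg)
      exact integral_mono hgdi.abs hmg.norm fun x => by
        have n2 : ‖gd x‖ ≤ ‖mol k g x‖ := norm_indicator_le_norm_self _ _
        exact n2
    have k2 : ∫ x, ‖Fd x‖ ≤ ω * vd d + ∫ x, ‖F x‖ := by
      have hmF := hk.mol_int hF
      have i3 : Integrable ((closedBall (0 : Euc d) 1).indicator (fun _ => ω)) :=
        (integrable_indicator_iff measurableSet_closedBall).mpr (integrableOn_const measure_closedBall_lt_top.ne)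
      calc ∫ x, ‖Fd x‖ ≤ ∫ x, ((closedBall (0 : Euc d) 1).indicator (fun _ => ω) x + ‖mol k F x‖) := by
            refine integral_mono hFdi.norm (i3.add hmF.norm) fun x => ?_
            by_cases hx : x ∈ D
            · have hx' : x ∈ closedBall (0 : Euc d) 1 :=
                ball_subset_closedBall (ball_subset_ball (by linarith) hx)
              simp only [hFd]
              rw [Set.indicator_of_mem hx, Set.indicator_of_mem hx', hk.mol_sub hvi hF]
              have u1 := hk.mol_unif hvi (ω := ω) (fun x y hy => by
                have := hδ2u (a := x) (b := x - y) (by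
                  rw [dist_eq_norm, sub_sub_cancel]; linarith)
                rw [dist_eq_norm] at this
                exact this.le) x
              have : v x - (mol k v x - mol k F x) = (v x - mol k v x) + mol k F x := by abel
              rw [this]
              exact (norm_add_le _ _).trans (by linarith)
            · simp only [hFd]
              rw [Set.indicator_of_notMem hx, norm_zero]
              exact add_nonneg (Set.indicator_nonneg (fun _ _ => hωp.le) x) (norm_nonneg _)
        _ = ω * vd d + ∫ x, ‖mol k F x‖ := by
            rw [integral_add i3 hmF.norm, integral_indicator measurableSet_closedBall]
            simp only [integral_const, MeasurableSet.univ, measureReal_restrict_apply, Set.univ_inter, smul_eq_mul]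
            rw [vol_cb _ zero_le_one]
            ring
        _ ≤ _ := by
            have := hk.mol_l1 hF
            linarith
    have k3 : ω * vd d = M - ((∫ x, ‖F x‖) + (∫ x, |g x|)) := by rw [hω]; field_simp
    linarith
end W11

end

section

namespace W11
variable {d : ℕ}

noncomputable def symA (A : Euc d →L[ℝ] Euc d) : Euc d →L[ℝ] Euc d :=
  (1/2 : ℝ) • (A + ContinuousLinearMap.adjoint A)

lemma symA_inner (A : Euc d →L[ℝ] Euc d) (x y : Euc d) : ⟪symA A x, y⟫ = (⟪A x, y⟫ + ⟪A y, x⟫) / 2 := by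
  simp only [symA, ContinuousLinearMap.smul_apply, ContinuousLinearMap.add_apply, inner_smul_left,
    inner_add_left, ContinuousLinearMap.adjoint_inner_left]
  rw [real_inner_comm x (A y)]
  simp
  ring

lemma symA_ell {A : Euc d →L[ℝ] Euc d} {lam Lam : ℝ} (hl : 0 < lam) (hL : 0 < Lam)
    (h1 : ∀ ξ : Euc d, lam * ‖ξ‖ ^ 2 ≤ ⟪A ξ, ξ⟫) (h2 : ∀ ξ η : Euc d, |⟪A ξ, η⟫| ≤ Lam * ‖ξ‖ * ‖η‖) :
    Ell (symA A) lam Lam where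
  pos := hl
  posL := hL
  sym := fun x y => by rw [real_inner_comm (symA A y) x, symA_inner, symA_inner]; ring
  coer := fun ξ => by rw [symA_inner]; linarith [h1 ξ]
  bdd := fun ξ => by
    have a : ‖symA A ξ‖ ^ 2 ≤ Lam * ‖ξ‖ * ‖symA A ξ‖ := by
      rw [← real_inner_self_eq_norm_sq, symA_inner]
      have b1 := (le_abs_self _).trans (h2 ξ (symA A ξ))
      have b2 := (le_abs_self _).trans (h2 (symA A ξ) ξ)
      linarith
    rcases (norm_nonneg (symA A ξ)).eq_or_lt with h | h
    · rw [← h]; positivity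
    · nlinarith

lemma grad_swap {U : Set (Euc d)} {φ η : Euc d → ℝ} (hφ : Test U φ) (hη : Test U η) (a b : Euc d) :
    ∫ x, pd a φ x * pd b η x = ∫ x, pd b φ x * pd a η x := by
  have e1 := ibp (contDiff_pd hφ.smooth a) hη.smooth (hφ.pd a).cpt b
  have e2 := ibp (contDiff_pd hφ.smooth b) hη.smooth (hφ.pd b).cpt a
  rw [e1, e2, pd_comm hφ.smooth]

lemma grad_antisym (A : Euc d →L[ℝ] Euc d) {U : Set (Euc d)} {φ η : Euc d → ℝ} (hφ : Test U φ) (hη : Test U η) :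
    ∫ x, ⟪A (gradient φ x), gradient η x⟫ = ∫ x, ⟪A (gradient η x), gradient φ x⟫ := by
  have e : ∀ φ η : Euc d → ℝ, ∀ x, ⟪A (gradient φ x), gradient η x⟫ =
      ∑ i, ∑ j, ⟪A (bv i), bv j⟫ * (pd (bv i) φ x * pd (bv j) η x) := by
    intro φ η x
    have r : ∀ φ : Euc d → ℝ, gradient φ x = ∑ i, pd (bv i) φ x • bv i := by
      intro φ
      conv_lhs => rw [← (EuclideanSpace.basisFun (Fin d) ℝ).sum_repr' (gradient φ x)]
      refine Finset.sum_congr rfl fun i _ => ?_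
      rw [real_inner_comm, inner_gradient]; rfl
    rw [r φ, r η, map_sum, sum_inner]
    refine Finset.sum_congr rfl fun i _ => ?_
    rw [inner_sum]
    refine Finset.sum_congr rfl fun j _ => ?_
    rw [map_smul, inner_smul_left, inner_smul_right]
    simp
    ring
  have hi : ∀ {φ η : Euc d → ℝ}, Test U φ → Test U η → ∀ a b : Euc d, ∀ c : ℝ,
      Integrable (fun x => c * (pd a φ x * pd b η x)) := fun h1 h2 a b c =>
    (integrable_mul2 (h1.pd a).memLp (h2.pd b).memLp).const_mul c
  simp_rw [e]
  rw [integral_finset_sum _ fun i _ => integrable_finset_sum _ fun j _ => hi hφ hη _ _ _,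
    integral_finset_sum _ fun i _ => integrable_finset_sum _ fun j _ => hi hη hφ _ _ _]
  refine Finset.sum_congr rfl fun i _ => ?_
  rw [integral_finset_sum _ fun j _ => hi hφ hη _ _ _, integral_finset_sum _ fun j _ => hi hη hφ _ _ _]
  refine Finset.sum_congr rfl fun j _ => ?_
  rw [integral_const_mul, integral_const_mul, grad_swap hφ hη]
  congr 1
  congr 1; ext x; ring

lemma grad_symA (A : Euc d →L[ℝ] Euc d) {U : Set (Euc d)} {φ η : Euc d → ℝ} (hφ : Test U φ) (hη : Test U η) :
    ∫ x, ⟪symA A (gradient φ x), gradient η x⟫ = ∫ x, ⟪A (gradient φ x), gradient η x⟫ := by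
  have h1 : MemLp (gradient φ) 2 := hφ.memLp_grad
  have h2 : MemLp (gradient η) 2 := hη.memLp_grad
  simp_rw [symA_inner]
  rw [integral_div, integral_add (integrable_inner (memLp_clm h1 A) h2) (integrable_inner (memLp_clm h2 A) h1),
    ← grad_antisym A hφ hη]
  ring
end W11

end

section

namespace W11
variable {d : ℕ}

lemma cheb1 {μ : Measure (Euc d)} {f : Euc d → Euc d} (hf : Integrable f μ) {s Q : ℝ} (hs : 0 < s)
    (hQ : ∫ x, ‖f x‖ ∂μ ≤ Q) : μ {x | s ≤ ‖f x‖} ≤ ENNReal.ofReal (Q / s) := by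
  have h1 := mul_meas_ge_le_integral_of_nonneg (.of_forall fun x => norm_nonneg _) hf.norm s
  have hfin : μ {x | s ≤ ‖f x‖} ≠ ∞ := (hf.norm.measure_ge_lt_top hs).ne
  rw [← ENNReal.ofReal_toReal hfin]
  apply ENNReal.ofReal_le_ofReal
  rw [le_div_iff₀ hs, mul_comm]
  exact h1.trans hQ

theorem approx_step (d : ℕ) (hd : 0 < d) (lam Lam : ℝ) (hlam : 0 < lam) (hLam : 0 < Lam) :
    ∃ C > 0, ∀ A₀ : Euc d →L[ℝ] Euc d, (∀ ξ : Euc d, lam * ‖ξ‖ ^ 2 ≤ ⟪A₀ ξ, ξ⟫) →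
        (∀ ξ η : Euc d, |⟪A₀ ξ, η⟫| ≤ Lam * ‖ξ‖ * ‖η‖) →
      ∀ (F : Euc d → Euc d) (g : Euc d → ℝ) (Du : Euc d → Euc d),
        Integrable F (volume.restrict (ball (0 : Euc d) 1)) →
        Integrable g (volume.restrict (ball (0 : Euc d) 1)) →
        Integrable Du (volume.restrict (ball (0 : Euc d) 1)) →
        (∀ φ : Euc d → ℝ, Test (ball (0 : Euc d) 1) φ →
          ∫ x in ball (0 : Euc d) 1, ⟪A₀ (Du x), gradient φ x⟫
            = ∫ x in ball (0 : Euc d) 1, (⟪F x, gradient φ x⟫ - g x * φ x)) →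
      ∀ φ, Test (ball (0 : Euc d) 1) φ → ∀ t ε a : ℝ, 0 < t → 0 < ε →
        ∫ x in ball (0 : Euc d) 1, ‖Du x - gradient φ x‖ ≤ a →
        volume {x ∈ ball (0 : Euc d) 1 | t < ‖Du x‖} ≤ ENNReal.ofReal
          ((2 * C * ((∫ x in ball (0 : Euc d) 1, (‖F x‖ + |g x|)) + Lam * a + ε) + 2 * a) / t) := by
  obtain ⟨C, hC, hB⟩ := smooth_case d hd lam Lam
  refine ⟨C, hC, ?_⟩
  intro A h1 h2 F g Du hF hg hDu hw φ hφ t ε a ht hε ha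
  have hE := symA_ell hlam hLam h1 h2
  set B : Set (Euc d) := ball 0 1 with hBdef
  have hBm : MeasurableSet B := measurableSet_ball
  have hAb : ∀ ξ, ‖A ξ‖ ≤ Lam * ‖ξ‖ := fun ξ => by
    have b1 := (le_abs_self _).trans (h2 ξ (A ξ))
    rw [real_inner_self_eq_norm_sq] at b1
    rcases (norm_nonneg (A ξ)).eq_or_lt with h | h
    · rw [← h]; positivity
    · nlinarith
  have hgφ : Integrable (gradient φ) := memLp_one_iff_integrable.mp hφ.memLp_grad
  have hDi : Integrable (fun x => Du x - gradient φ x) (volume.restrict B) := hDu.sub hgφ.integrableOn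
  have hADi : Integrable (fun x => A (Du x - gradient φ x)) (volume.restrict B) := A.integrable_comp hDi
  have hf1 : Integrable (fun x => F x - A (Du x - gradient φ x)) (volume.restrict B) := hF.sub hADi
  set F1 : Euc d → Euc d := B.indicator (fun x => F x - A (Du x - gradient φ x)) with hF1
  set g1 : Euc d → ℝ := B.indicator (fun x => - g x) with hg1
  have hF1i : Integrable F1 := (integrable_indicator_iff hBm).mpr hf1
  have hg1i : Integrable g1 := (integrable_indicator_iff hBm).mpr hg.neg
  have ha0 : 0 ≤ a := (integral_nonneg fun _ => norm_nonneg _).trans ha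
  have hweak : ∀ η, Test B η → ∫ x, ⟪symA A (gradient φ x), gradient η x⟫ =
      (∫ x, ⟪F1 x, gradient η x⟫) + ∫ x, g1 x * η x := by
    intro η hη
    obtain ⟨Cη, -, hCη⟩ := hη.bdd_grad
    obtain ⟨Cη', -, hCη'⟩ := hη.bdd
    have ii : ∀ {f : Euc d → Euc d}, Integrable f (volume.restrict B) →
        Integrable (fun x => ⟪f x, gradient η x⟫) (volume.restrict B) := fun hf => by
      simpa only [real_inner_comm] using int_inner_bdd hf hη.contg hCη
    have ig : Integrable (fun x => g x * η x) (volume.restrict B) := by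
      simpa using int_inner_bdd hg hη.cont hCη'
    rw [grad_symA A hφ hη]
    have e1 : ∫ x, ⟪A (gradient φ x), gradient η x⟫ = ∫ x in B, ⟪A (gradient φ x), gradient η x⟫ := by
      rw [setIntegral_eq_integral_of_forall_compl_eq_zero]
      intro x hx
      rw [hη.grad_zero hx, inner_zero_right]
    have e2 : ∫ x, ⟪F1 x, gradient η x⟫ = ∫ x in B, ⟪F x - A (Du x - gradient φ x), gradient η x⟫ := by
      rw [← integral_indicator hBm]
      congr 1; ext x
      by_cases hx : x ∈ B
      · rw [hF1, Set.indicator_of_mem hx, Set.indicator_of_mem hx]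
      · rw [hF1, Set.indicator_of_notMem hx, Set.indicator_of_notMem hx, inner_zero_left]
    have e3 : ∫ x, g1 x * η x = ∫ x in B, - (g x * η x) := by
      rw [← integral_indicator hBm]
      congr 1; ext x
      by_cases hx : x ∈ B
      · rw [hg1, Set.indicator_of_mem hx, Set.indicator_of_mem hx, neg_mul]
      · rw [hg1, Set.indicator_of_notMem hx, Set.indicator_of_notMem hx, zero_mul]
    have iA : Integrable (fun x => A (Du x)) (volume.restrict B) := A.integrable_comp hDu
    have iAφ : Integrable (fun x => A (gradient φ x)) (volume.restrict B) := A.integrable_comp hgφ.integrableOn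
    have e4 : ∫ x in B, ⟪F x - A (Du x - gradient φ x), gradient η x⟫ =
        (∫ x in B, ⟪F x, gradient η x⟫) - (∫ x in B, ⟪A (Du x), gradient η x⟫) +
          ∫ x in B, ⟪A (gradient φ x), gradient η x⟫ := by
      have i12 : Integrable (fun x => ⟪F x, gradient η x⟫ - ⟪A (Du x), gradient η x⟫)
          (volume.restrict B) := (ii hF).sub (ii iA)
      rw [← integral_sub (ii hF) (ii iA), ← integral_add i12 (ii iAφ)]
      congr 1; ext x
      rw [map_sub, inner_sub_left, inner_sub_left]
      ring
    rw [e1, e2, e3, e4, hw η hη, integral_neg, integral_sub (ii hF) ig]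
    ring
  set I : ℝ := ∫ x in B, (‖F x‖ + |g x|) with hI
  have hIe : I = (∫ x in B, ‖F x‖) + ∫ x in B, |g x| := integral_add hF.norm hg.abs
  have n1 : ∫ x, ‖F1 x‖ ≤ (∫ x in B, ‖F x‖) + Lam * a := by
    have e : ∫ x, ‖F1 x‖ = ∫ x in B, ‖F x - A (Du x - gradient φ x)‖ := by
      simp only [hF1, norm_indicator_eq_indicator_norm]
      exact integral_indicator hBm
    rw [e]
    calc _ ≤ ∫ x in B, (‖F x‖ + Lam * ‖Du x - gradient φ x‖) := by
          refine integral_mono hf1.norm (hF.norm.add (hDi.norm.const_mul Lam)) fun x => ?_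
          exact (norm_sub_le _ _).trans (add_le_add le_rfl (hAb _))
      _ = (∫ x in B, ‖F x‖) + Lam * ∫ x in B, ‖Du x - gradient φ x‖ := by
          rw [integral_add hF.norm (hDi.norm.const_mul Lam), integral_const_mul]
      _ ≤ _ := by gcongr
  have n2 : ∫ x, |g1 x| = ∫ x in B, |g x| := by
    have : ∀ x, |g1 x| = B.indicator (fun x => |g x|) x := by
      intro x
      by_cases hx : x ∈ B
      · rw [hg1, Set.indicator_of_mem hx, Set.indicator_of_mem hx, abs_neg]
      · rw [hg1, Set.indicator_of_notMem hx, Set.indicator_of_notMem hx, abs_zero]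
    simp_rw [this]
    exact integral_indicator hBm
  have k1 := hB (symA A) hE φ hφ F1 g1 hF1i hg1i hweak (I + Lam * a + ε) (t / 2) (by positivity)
    (by rw [hIe, n2]; linarith)
  have k2 := cheb1 hDi (s := t / 2) (by positivity) ha
  have hsub : {x ∈ B | t < ‖Du x‖} ⊆ {x | t / 2 < ‖gradient φ x‖} ∪
      ({x | t / 2 ≤ ‖Du x - gradient φ x‖} ∩ B) := by
    rintro x ⟨hx, hxt⟩
    by_cases hc : t / 2 < ‖gradient φ x‖
    · exact Or.inl hc
    · refine Or.inr ⟨?_, hx⟩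
      have := norm_sub_norm_le (Du x) (gradient φ x)
      show t / 2 ≤ _
      linarith
  have hI0 : 0 ≤ I := integral_nonneg fun _ => by positivity
  refine (measure_mono hsub).trans ((measure_union_le _ _).trans
    ((add_le_add k1 ((Measure.le_restrict_apply _ _).trans k2)).trans ?_))
  clear_value I
  rw [← ENNReal.ofReal_add (by positivity) (by positivity)]
  apply ENNReal.ofReal_le_ofReal
  apply le_of_eq
  field_simp

theorem main (d : ℕ) (hd : 0 < d) (lam Lam : ℝ) (hlam : 0 < lam) (hLam : 0 < Lam) :
    ∃ C : ℝ, 0 < C ∧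
      ∀ A₀ : Euc d →L[ℝ] Euc d,
        (∀ ξ : Euc d, lam * ‖ξ‖ ^ 2 ≤ ⟪A₀ ξ, ξ⟫) →
        (∀ ξ η : Euc d, |⟪A₀ ξ, η⟫| ≤ Lam * ‖ξ‖ * ‖η‖) →
      ∀ p : ℝ, 1 < p →
      ∀ (F : Euc d → Euc d) (g : Euc d → ℝ),
        MemLp F (ENNReal.ofReal p) (volume.restrict (ball (0 : Euc d) 1)) →
        MemLp g (ENNReal.ofReal p) (volume.restrict (ball (0 : Euc d) 1)) →
      ∀ (u : Euc d → ℝ) (Du : Euc d → Euc d),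
        MemW1p0 p (ball (0 : Euc d) 1) u Du →
        (∀ φ : Euc d → ℝ, ContDiff ℝ (⊤ : ℕ∞) φ → HasCompactSupport φ →
            tsupport φ ⊆ ball (0 : Euc d) 1 →
          ∫ x in ball (0 : Euc d) 1, ⟪A₀ (Du x), gradient φ x⟫
            = ∫ x in ball (0 : Euc d) 1, (⟪F x, gradient φ x⟫ - g x * φ x)) →
      ∀ t : ℝ, 0 < t →
        volume {x ∈ ball (0 : Euc d) 1 | t < ‖Du x‖}
          ≤ ENNReal.ofReal ((C / t) * ∫ x in ball (0 : Euc d) 1, (‖F x‖ + |g x|)) := by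
  obtain ⟨C, hC, hS⟩ := approx_step d hd lam Lam hlam hLam
  refine ⟨2 * C, by positivity, ?_⟩
  intro A h1 h2 p hp F g hF hg u Du hu hw t ht
  obtain ⟨-, -, hDu, hap⟩ := hu
  have hfm : IsFiniteMeasure (volume.restrict (ball (0 : Euc d) 1)) := ⟨by simpa using measure_ball_lt_top⟩
  have hp1 : 1 ≤ ENNReal.ofReal p := by
    rw [← ENNReal.ofReal_one]; exact ENNReal.ofReal_le_ofReal hp.le
  set B : Set (Euc d) := ball 0 1 with hB
  set cc : ℝ≥0∞ := (volume.restrict B) Set.univ ^ (1 / (1:ℝ≥0∞).toReal - 1 / (ENNReal.ofReal p).toReal) with hcc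
  have hccf : cc ≠ ∞ := by
    apply ENNReal.rpow_ne_top_of_nonneg
    · rw [ENNReal.toReal_ofReal (by linarith)]
      have : 1 / p ≤ 1 := by rw [div_le_one (by linarith)]; exact hp.le
      simp only [ENNReal.toReal_one, div_one]
      linarith
    · exact measure_ne_top _ _
  set I : ℝ := ∫ x in B, (‖F x‖ + |g x|) with hI
  have key : ∀ ε : ℝ, 0 < ε → volume {x ∈ B | t < ‖Du x‖} ≤ ENNReal.ofReal
      ((2 * C * (I + Lam * (ε * cc.toReal) + ε) + 2 * (ε * cc.toReal)) / t) := by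
    intro ε hε
    obtain ⟨φ, hφ1, hφ2, hφ3, -, hφ4⟩ := hap ε hε
    have hφ : Test B φ := ⟨hφ1, hφ2, hφ3⟩
    have hDm : MemLp (fun x => Du x - gradient φ x) (ENNReal.ofReal p) (volume.restrict B) :=
      hDu.sub (hφ.memLp_grad.restrict B)
    refine hS A h1 h2 F g Du (hF.integrable hp1) (hg.integrable hp1) (hDu.integrable hp1)
      (fun η hη => hw η hη.smooth hη.cpt hη.supp) φ hφ t ε _ ht hε ?_
    have h3 := eLpNorm_le_eLpNorm_mul_rpow_measure_univ hp1 hDm.1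
    rw [eLpNorm_one_eq_lintegral_enorm] at h3
    have h4 : ∫⁻ x in B, ‖Du x - gradient φ x‖ₑ ≤ ENNReal.ofReal ε * cc :=
      h3.trans (mul_le_mul_left hφ4.le _)
    rw [integral_norm_eq_lintegral_enorm hDm.1]
    have h5 := ENNReal.toReal_mono (ENNReal.mul_ne_top ENNReal.ofReal_ne_top hccf) h4
    rwa [ENNReal.toReal_mul, ENNReal.toReal_ofReal hε.le] at h5
  have hlim : Tendsto (fun ε : ℝ => ENNReal.ofReal
      ((2 * C * (I + Lam * (ε * cc.toReal) + ε) + 2 * (ε * cc.toReal)) / t)) (𝓝[>] 0)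
      (𝓝 (ENNReal.ofReal ((2 * C * (I + Lam * (0 * cc.toReal) + 0) + 2 * (0 * cc.toReal)) / t))) := by
    apply Tendsto.mono_left _ nhdsWithin_le_nhds
    apply Continuous.tendsto (f := fun ε : ℝ => ENNReal.ofReal
      ((2 * C * (I + Lam * (ε * cc.toReal) + ε) + 2 * (ε * cc.toReal)) / t))
    exact ENNReal.continuous_ofReal.comp (by fun_prop)
  have := ge_of_tendsto hlim (by
    filter_upwards [self_mem_nhdsWithin] with ε hε
    exact key ε hε)
  refine this.trans (le_of_eq ?_)
  congr 1
  ring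
end W11

end

/-- weak type-(1,1) estimate for the gradient of solutions of constant-coefficient
divergence-form equations in the unit ball. -/
theorem stmt4 (d : ℕ) (lam Lam : ℝ) (hlam : 0 < lam) (hLam : 0 < Lam) :
    ∃ C : ℝ, 0 < C ∧
      ∀ A₀ : Euc d →L[ℝ] Euc d,
        (∀ ξ : Euc d, lam * ‖ξ‖ ^ 2 ≤ ⟪A₀ ξ, ξ⟫) →
        (∀ ξ η : Euc d, |⟪A₀ ξ, η⟫| ≤ Lam * ‖ξ‖ * ‖η‖) →
      ∀ p : ℝ, 1 < p →
      ∀ (F : Euc d → Euc d) (g : Euc d → ℝ),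
        MemLp F (ENNReal.ofReal p) (volume.restrict (ball (0 : Euc d) 1)) →
        MemLp g (ENNReal.ofReal p) (volume.restrict (ball (0 : Euc d) 1)) →
      ∀ (u : Euc d → ℝ) (Du : Euc d → Euc d),
        MemW1p0 p (ball (0 : Euc d) 1) u Du →
        (∀ φ : Euc d → ℝ, ContDiff ℝ (⊤ : ℕ∞) φ → HasCompactSupport φ →
            tsupport φ ⊆ ball (0 : Euc d) 1 →
          ∫ x in ball (0 : Euc d) 1, ⟪A₀ (Du x), gradient φ x⟫
            = ∫ x in ball (0 : Euc d) 1, (⟪F x, gradient φ x⟫ - g x * φ x)) →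
      ∀ t : ℝ, 0 < t →
        volume {x ∈ ball (0 : Euc d) 1 | t < ‖Du x‖}
          ≤ ENNReal.ofReal ((C / t) * ∫ x in ball (0 : Euc d) 1, (‖F x‖ + |g x|)) := by
  rcases Nat.eq_zero_or_pos d with rfl | hd
  · refine ⟨1, one_pos, ?_⟩
    intro A₀ _ _ p _ F g _ _ u Du _ _ t ht
    have h : {x ∈ ball (0 : Euc 0) 1 | t < ‖Du x‖} = ∅ := by
      ext x
      have h0 : Du x = 0 := Subsingleton.elim _ _
      simp only [Set.mem_setOf_eq, Set.mem_empty_iff_false, iff_false, not_and, not_lt]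
      intro _
      rw [h0, norm_zero]
      exact ht.le
    rw [h, measure_empty]
    exact zero_le
  · exact W11.main d hd lam Lam hlam hLam
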